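/- arXiv:1107.2351 — 2 statements merged into one kernel-verified Lean document; each statement's English description precedes it below -/
import Mathlib

section
/- Let Ω ⊂ ℝⁿ be a bounded open set with C² boundary whose second fundamental form with respect to the outward normal is positive definite (strictly convex), with diameter D, and let q be a convex function, C¹ on the closure of Ω. Let φ₀ be a first Dirichlet eigenfunction of L_q = Δ − q with eigenvalue λ₀, and let φ₁ be a second eigenfunction: φ₁ is C² on the closure of Ω, vanishes on ∂Ω, is not identically zero, satisfies Δφ₁ − qφ₁ = −λ₁φ₁ in Ω for a real number λ₁, and w = φ₁/φ₀ extends to a nonconstant C² function on the closure of Ω with vanishing outward normal derivative on ∂Ω. Then λ₁ ≥ (n + 3)(π/D)² + inf_{x ∈ Ω} q(x). -/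
open scoped RealInnerProductSpace
open Set MeasureTheory

noncomputable def lap {n : ℕ} (f : EuclideanSpace ℝ (Fin n) → ℝ) (x : EuclideanSpace ℝ (Fin n)) : ℝ :=
  ∑ i, fderiv ℝ (fun y => fderiv ℝ f y (EuclideanSpace.single i 1)) x
      (EuclideanSpace.single i 1)

section Helpers
open Filter Topology

/-- Euclidean space. -/
abbrev Rn (n : ℕ) : Type := EuclideanSpace ℝ (Fin n)

/-- Second order necessary condition at a local maximum in one variable. -/
lemma second_order_max {h h1 : ℝ → ℝ} {h2 : ℝ}
    (hh : ∀ᶠ s in 𝓝 (0:ℝ), HasDerivAt h (h1 s) s) (hh1 : HasDerivAt h1 h2 0)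
    (hm : IsLocalMax h 0) : h1 0 = 0 ∧ h2 ≤ 0 := by
  have h0 : HasDerivAt h (h1 0) 0 := hh.self_of_nhds
  have e0 : h1 0 = 0 := hm.hasDerivAt_eq_zero h0
  refine ⟨e0, ?_⟩
  by_contra hc
  push Not at hc
  have hd : deriv h =ᶠ[𝓝 0] h1 := hh.mono fun s hs => hs.deriv
  have hd2 : deriv (deriv h) 0 = h2 := by rw [hd.deriv_eq, hh1.deriv]
  have hmin : IsLocalMin h 0 :=
    isLocalMin_of_deriv_deriv_pos (by rw [hd2]; exact hc) (by rw [h0.deriv, e0]) h0.continuousAt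
  have hconst : h =ᶠ[𝓝 0] fun _ => h 0 := by
    filter_upwards [hm, hmin] with s h1 h2 using le_antisymm h1 h2
  have h3 : deriv h =ᶠ[𝓝 0] fun _ => 0 := by
    have := hconst.eventuallyEq_nhds
    filter_upwards [this] with s hs
    rw [hs.deriv_eq]; simp
  rw [h3.deriv_eq] at hd2
  simp at hd2
  linarith

section calculus
variable {E : Type*} [NormedAddCommGroup E] [InnerProductSpace ℝ E]

lemma line_deriv1 {f : E → ℝ} {x : E} (v : E) {s : ℝ} (hf : DifferentiableAt ℝ f (x + s • v)) :
    HasDerivAt (fun s : ℝ => f (x + s • v)) (fderiv ℝ f (x + s • v) v) s := by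
  have h1 : HasDerivAt (fun s : ℝ => x + s • v) v s := by
    simpa using ((hasDerivAt_id s).smul_const v).const_add x
  exact hf.hasFDerivAt.comp_hasDerivAt s h1

lemma line_deriv2 {f : E → ℝ} {x : E} (v : E) {s : ℝ} (hf : ContDiffAt ℝ 2 f (x + s • v)) :
    HasDerivAt (fun s : ℝ => fderiv ℝ f (x + s • v) v)
      (fderiv ℝ (fderiv ℝ f) (x + s • v) v v) s := by
  have h1 : HasDerivAt (fun s : ℝ => x + s • v) v s := by
    simpa using ((hasDerivAt_id s).smul_const v).const_add x
  have h2 : DifferentiableAt ℝ (fderiv ℝ f) (x + s • v) :=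
    (hf.fderiv_right (m := 1) (by norm_num)).differentiableAt (by norm_num)
  have h3 := h2.hasFDerivAt.comp_hasDerivAt s h1
  simpa using h3.clm_apply (hasDerivAt_const s v)

lemma line_derivs {f : E → ℝ} {x : E} (v : E) (hf : ContDiffAt ℝ 2 f x) :
    (∀ᶠ s in 𝓝 (0:ℝ), HasDerivAt (fun s : ℝ => f (x + s • v)) (fderiv ℝ f (x + s • v) v) s) ∧
    HasDerivAt (fun s : ℝ => fderiv ℝ f (x + s • v) v) (fderiv ℝ (fderiv ℝ f) x v v) 0 := by
  constructor
  · have h1 : Tendsto (fun s : ℝ => x + s • v) (𝓝 0) (𝓝 x) := by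
      have : Continuous (fun s : ℝ => x + s • v) := by fun_prop
      simpa using this.tendsto 0
    filter_upwards [h1.eventually (hf.eventually (by simp))] with s hs
    exact line_deriv1 v (hs.differentiableAt (by norm_num))
  · have := line_deriv2 (f := f) (x := x) v (s := 0) (by simpa using hf)
    simpa using this

lemma log_derivs {f : E → ℝ} {x : E} (hf : ContDiffAt ℝ 2 f x) (hp : 0 < f x) (v : E) :
    ContDiffAt ℝ 2 (fun y => Real.log (f y)) x ∧
    fderiv ℝ (fun y => Real.log (f y)) x v = fderiv ℝ f x v / f x ∧
    fderiv ℝ (fderiv ℝ (fun y => Real.log (f y))) x v v =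
      fderiv ℝ (fderiv ℝ f) x v v / f x - (fderiv ℝ f x v / f x) ^ 2 := by
  have hC : ContDiffAt ℝ 2 (fun y => Real.log (f y)) x := hf.log hp.ne'
  have key : ∀ y, DifferentiableAt ℝ f y → 0 < f y → 
      fderiv ℝ (fun y => Real.log (f y)) y v = fderiv ℝ f y v / f y := by
    intro y hy hpy
    rw [(hy.hasFDerivAt.log hpy.ne').fderiv]
    simp [div_eq_inv_mul]
  refine ⟨hC, key x (hf.differentiableAt (by norm_num)) hp, ?_⟩
  obtain ⟨a1, a2⟩ := line_derivs v hC
  obtain ⟨b1, b2⟩ := line_derivs v hf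
  have h1 : Tendsto (fun s : ℝ => x + s • v) (𝓝 0) (𝓝 x) := by
    have : Continuous (fun s : ℝ => x + s • v) := by fun_prop
    simpa using this.tendsto 0
  have hev : (fun s : ℝ => fderiv ℝ (fun y => Real.log (f y)) (x + s • v) v) =ᶠ[𝓝 0]
      fun s => fderiv ℝ f (x + s • v) v / f (x + s • v) := by
    filter_upwards [h1.eventually (hf.eventually (by simp)),
      h1.eventually (hf.continuousAt.eventually (lt_mem_nhds hp))] with s hs hs2
    exact key _ (hs.differentiableAt (by norm_num)) hs2
  have b0 := b1.self_of_nhds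
  have hdiv := b2.div b0 (by simpa using hp.ne')
  have := (a2.congr_of_eventuallyEq hev.symm).unique hdiv
  rw [this]
  simp
  field_simp

end calculus

section euc
variable {n : ℕ}


lemma lap_eq {f : Rn n → ℝ} {x : Rn n} (hf : ContDiffAt ℝ 2 f x) :
    lap f x = ∑ i, fderiv ℝ (fderiv ℝ f) x (EuclideanSpace.single i 1)
      (EuclideanSpace.single i 1) := by
  unfold lap
  refine Finset.sum_congr rfl fun i _ => ?_
  have h2 : DifferentiableAt ℝ (fderiv ℝ f) x :=
    (hf.fderiv_right (m := 1) (by norm_num)).differentiableAt (by norm_num)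
  have := (h2.hasFDerivAt.clm_apply (hasFDerivAt_const (EuclideanSpace.single i (1:ℝ)) x)).fderiv
  rw [this]
  simp

lemma trace_basis (B : Rn n →L[ℝ] Rn n →L[ℝ] ℝ) (b : OrthonormalBasis (Fin n) ℝ (Rn n)) :
    ∑ i, B (EuclideanSpace.single i 1) (EuclideanSpace.single i 1) = ∑ j, B (b j) (b j) := by
  have hx : ∀ v w : Rn n, B v w = ∑ i, ∑ k, v i * w k *
      B (EuclideanSpace.single i 1) (EuclideanSpace.single k 1) := by
    intro v w
    have hv : ∀ v : Rn n, v = ∑ i, v i • EuclideanSpace.single i (1:ℝ) := by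
      intro v
      have := (EuclideanSpace.basisFun (Fin n) ℝ).sum_repr v
      simpa using this.symm
    conv_lhs => rw [hv v, hv w]
    simp only [map_sum, map_smul, sum_apply, smul_apply,
      smul_eq_mul, Finset.mul_sum]
    rw [Finset.sum_comm]
    refine Finset.sum_congr rfl fun i _ => Finset.sum_congr rfl fun k _ => by ring
  have ho : ∀ i k : Fin n, ∑ j, (b j) i * (b j) k = if i = k then 1 else 0 := by
    intro i k
    have := b.sum_inner_mul_inner (EuclideanSpace.single i (1:ℝ)) (EuclideanSpace.single k (1:ℝ))
    simp [EuclideanSpace.inner_single_left, EuclideanSpace.inner_single_right] at this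
    rw [this]
    simp [eq_comm]
  calc _ = ∑ i, ∑ k, (if i = k then (1:ℝ) else 0) *
      B (EuclideanSpace.single i 1) (EuclideanSpace.single k 1) := by simp
    _ = ∑ i, ∑ k, ∑ j, (b j) i * (b j) k *
      B (EuclideanSpace.single i 1) (EuclideanSpace.single k 1) := by
        refine Finset.sum_congr rfl fun i _ => Finset.sum_congr rfl fun k _ => ?_
        rw [← ho, Finset.sum_mul]
    _ = ∑ j, ∑ i, ∑ k, (b j) i * (b j) k *
      B (EuclideanSpace.single i 1) (EuclideanSpace.single k 1) := by
        rw [Finset.sum_comm]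
        conv_rhs => rw [Finset.sum_comm]
        rw [Finset.sum_comm]
        refine Finset.sum_congr rfl fun i _ => Finset.sum_comm
    _ = _ := by
        refine Finset.sum_congr rfl fun j _ => ?_
        rw [← hx]

lemma trace_le (B : Rn n →L[ℝ] Rn n →L[ℝ] ℝ) (hB : ∀ v, B v v ≤ 0) {e : Rn n} (he : ‖e‖ = 1) :
    ∑ i, B (EuclideanSpace.single i 1) (EuclideanSpace.single i 1) ≤ B e e := by
  rcases n with _ | n
  · have : e = 0 := Subsingleton.elim _ _
    simp [this] at he
  have ho : Orthonormal ℝ (({0} : Set (Fin (n+1))).domRestrict (fun _ => e)) := by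
    constructor
    · intro i; simpa using he
    · intro i j hij
      exact absurd (Subtype.ext (by rw [i.2, j.2])) hij
  obtain ⟨b, hb⟩ := Orthonormal.exists_orthonormalBasis_extension_of_card_eq (by simp) ho
  rw [trace_basis B b, Fin.sum_univ_succ]
  have h0 : b 0 = e := hb 0 rfl
  rw [h0]
  have : ∑ i : Fin n, B (b i.succ) (b i.succ) ≤ 0 := Finset.sum_nonpos fun i _ => hB _
  linarith
end euc

/-- The standing hypotheses on the domain. -/
structure Dom {n : ℕ} (Ω : Set (Rn n)) (ρ : Rn n → ℝ) : Prop where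
  op : IsOpen Ω
  bd : Bornology.IsBounded Ω
  sm : ContDiff ℝ 2 ρ
  eq : Ω = {x | ρ x < 0}
  fr : frontier Ω = {x | ρ x = 0}
  gr : ∀ x ∈ frontier Ω, gradient ρ x ≠ 0
  sc : ∀ x ∈ frontier Ω, ∀ v : Rn n, v ≠ 0 → fderiv ℝ ρ x v = 0 →
      0 < fderiv ℝ (fderiv ℝ ρ) x v v
  cv : Convex ℝ (closure Ω)
  ne : Ω.Nonempty

namespace Dom
variable {n : ℕ} {Ω : Set (Rn n)} {ρ : Rn n → ℝ}

lemma mem_iff (H : Dom Ω ρ) {x : Rn n} : x ∈ Ω ↔ ρ x < 0 := by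
  have := H.eq
  constructor
  · intro h; rw [this] at h; exact h
  · intro h; rw [this]; exact h

lemma fr_iff (H : Dom Ω ρ) {x : Rn n} : x ∈ frontier Ω ↔ ρ x = 0 := by rw [H.fr]; rfl

lemma cl_iff (H : Dom Ω ρ) {x : Rn n} : x ∈ closure Ω ↔ ρ x ≤ 0 := by
  rw [closure_eq_self_union_frontier, mem_union, H.mem_iff, H.fr_iff, le_iff_lt_or_eq]

lemma cl_cases {x : Rn n} (hx : x ∈ closure Ω) : x ∈ Ω ∨ x ∈ frontier Ω := by
  rwa [closure_eq_self_union_frontier, mem_union] at hx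

lemma compact (H : Dom Ω ρ) : IsCompact (closure Ω) := H.bd.isCompact_closure

lemma nhds (H : Dom Ω ρ) {x : Rn n} (hx : x ∈ Ω) : closure Ω ∈ 𝓝 x :=
  mem_of_superset (H.op.mem_nhds hx) subset_closure

lemma udiff (H : Dom Ω ρ) : UniqueDiffOn ℝ (closure Ω) :=
  uniqueDiffOn_convex H.cv (H.ne.mono (interior_maximal subset_closure H.op))

lemma grad_pos (H : Dom Ω ρ) {p : Rn n} (hp : p ∈ frontier Ω) : 0 < fderiv ℝ ρ p (gradient ρ p) := by
  rw [← inner_gradient_left]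
  exact real_inner_self_pos.mpr (H.gr p hp)

lemma rdiff (H : Dom Ω ρ) (p : Rn n) : DifferentiableAt ℝ ρ p := H.sm.differentiable (by norm_num) p

lemma inward (H : Dom Ω ρ) {p d : Rn n} (hp : p ∈ frontier Ω) (hd : fderiv ℝ ρ p d < 0) :
    ∀ᶠ t in 𝓝[>] (0:ℝ), p + t • d ∈ Ω := by
  have h1 := line_deriv1 (f := ρ) (x := p) d (s := 0) (H.rdiff _)
  simp only [zero_smul, add_zero] at h1
  have h2 := hasDerivAt_iff_tendsto_slope_zero.mp h1
  have h3 : ∀ᶠ t in 𝓝[≠] (0:ℝ), t⁻¹ • (ρ (p + (0 + t) • d) - ρ (p + (0:ℝ) • d)) < 0 :=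
    h2.eventually (gt_mem_nhds hd)
  have h4 : ∀ᶠ t in 𝓝[>] (0:ℝ), t⁻¹ • (ρ (p + (0 + t) • d) - ρ (p + (0:ℝ) • d)) < 0 :=
    h3.filter_mono (nhdsWithin_mono _ fun x hx => ne_of_gt hx)
  filter_upwards [h4, self_mem_nhdsWithin] with t ht ht0
  rw [H.mem_iff]
  have hp0 := H.fr_iff.mp hp
  simp [hp0] at ht
  have ht0 : 0 < t := ht0
  by_contra hcon
  push Not at hcon
  have := mul_nonneg (inv_pos.mpr ht0).le hcon
  linarith

lemma support (H : Dom Ω ρ) {p y : Rn n} (hp : p ∈ frontier Ω) (hy : y ∈ closure Ω) (hne : y ≠ p) :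
    fderiv ℝ ρ p (y - p) < 0 := by
  have hp0 := H.fr_iff.mp hp
  have hpc : p ∈ closure Ω := frontier_subset_closure hp
  have hseg : ∀ t ∈ Icc (0:ℝ) 1, ρ (p + t • (y - p)) ≤ 0 := by
    intro t ht
    rw [← H.cl_iff]
    exact H.cv.add_smul_sub_mem hpc hy ht
  set v := y - p with hv
  have hv0 : v ≠ 0 := sub_ne_zero.mpr hne
  have hd1 : ∀ t : ℝ, HasDerivAt (fun s : ℝ => ρ (p + s • v)) (fderiv ℝ ρ (p + t • v) v) t :=
    fun t => line_deriv1 v (H.rdiff _)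
  by_contra hc
  push Not at hc
  -- the first derivative is eventually positive to the right
  have hpos : ∀ᶠ t in 𝓝[>] (0:ℝ), 0 < fderiv ℝ ρ (p + t • v) v := by
    rcases hc.lt_or_eq with h | h
    · have hcont : ContinuousAt (fun t : ℝ => fderiv ℝ ρ (p + t • v) v) 0 :=
        (line_deriv2 v (H.sm.contDiffAt)).continuousAt
      have : ∀ᶠ t in 𝓝 (0:ℝ), 0 < fderiv ℝ ρ (p + t • v) v :=
        hcont.eventually (lt_mem_nhds (by simpa using h))
      exact this.filter_mono nhdsWithin_le_nhds
    · have h2 := H.sc p hp v hv0 h.symm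
      have hd2 := line_deriv2 (x := p) (s := 0) v (H.sm.contDiffAt)
      simp only [zero_smul, add_zero] at hd2
      have h3 := (hasDerivAt_iff_tendsto_slope_zero.mp hd2).eventually (lt_mem_nhds h2)
      have h4 := h3.filter_mono (nhdsWithin_mono (0:ℝ) (s := Ioi 0) fun x hx => ne_of_gt hx)
      filter_upwards [h4, self_mem_nhdsWithin] with t ht ht0
      simp [← h] at ht
      exact (mul_pos_iff_of_pos_left (inv_pos.mpr ht0)).mp ht
  obtain ⟨δ, hδ, hball⟩ := mem_nhdsGT_iff_exists_Ioo_subset.mp hpos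
  have hδ0 : (0:ℝ) < δ := hδ
  set c := min (δ / 2) 1
  have hc0 : 0 < c := by positivity
  have hcd : c < δ := lt_of_le_of_lt (min_le_left _ _) (by linarith)
  obtain ⟨t, ht, hte⟩ := exists_hasDerivAt_eq_slope (fun s : ℝ => ρ (p + s • v)) _ hc0
    (fun s _ => (hd1 s).continuousAt.continuousWithinAt) (fun s _ => hd1 s)
  have h5 : 0 < fderiv ℝ ρ (p + t • v) v := hball ⟨ht.1, ht.2.trans hcd⟩
  have h6 := hseg c ⟨hc0.le, min_le_right _ _⟩
  rw [hte] at h5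
  simp [hp0] at h5
  rcases (div_pos_iff.mp h5) with h | h
  · linarith [h.1]
  · linarith [h.2]

lemma seg (H : Dom Ω ρ) {x y : Rn n} (hx : x ∈ closure Ω) (hy : y ∈ closure Ω) (hne : x ≠ y) {t : ℝ}
    (ht : t ∈ Ioo (0:ℝ) 1) : x + t • (y - x) ∈ Ω := by
  have hm : x + t • (y - x) ∈ closure Ω := H.cv.add_smul_sub_mem hx hy ⟨ht.1.le, ht.2.le⟩
  rcases cl_cases hm with h | h
  · exact h
  exfalso
  have hyx : y - x ≠ 0 := sub_ne_zero.mpr hne.symm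
  have h1 : x - (x + t • (y - x)) = (-t) • (y - x) := by module
  have h2 : y - (x + t • (y - x)) = (1 - t) • (y - x) := by module
  have a1 := H.support h hx (by
    intro h0; rw [← sub_eq_zero, h1] at h0
    rcases smul_eq_zero.mp h0 with h0 | h0
    · linarith [ht.1]
    · exact hyx h0)
  have a2 := H.support h hy (by
    intro h0; rw [← sub_eq_zero, h2] at h0
    rcases smul_eq_zero.mp h0 with h0 | h0
    · linarith [ht.2]
    · exact hyx h0)
  rw [h1, map_smul, smul_eq_mul] at a1
  rw [h2, map_smul, smul_eq_mul] at a2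
  have h3 : 0 < 1 - t := by linarith [ht.2]
  have h5 : 0 < t := ht.1
  by_cases hs : 0 ≤ fderiv ℝ ρ (x + t • (y - x)) (y - x)
  · have := mul_nonneg h3.le hs
    linarith
  · push Not at hs
    have := mul_pos_of_neg_of_neg (neg_neg_of_pos h5) hs
    linarith

lemma seg' (H : Dom Ω ρ) {m e : Rn n} {r s : ℝ} (he : ‖e‖ = 1) (h1 : m + r • e ∈ closure Ω)
    (h2 : m - r • e ∈ closure Ω) (hs : |s| < r) : m + s • e ∈ Ω := by
  have hr : 0 < r := lt_of_le_of_lt (abs_nonneg _) hs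
  have hs' := abs_lt.mp hs
  have e0 : e ≠ 0 := by rintro rfl; simp at he
  have := H.seg (t := (r + s) / (2 * r)) h2 h1 (by
    intro h
    have : (2 * r) • e = 0 := by
      rw [sub_eq_add_neg, add_right_inj] at h
      have : (2 * r) • e = r • e + r • e := by module
      rw [this]; nth_rw 1 [← h]; simp
    rcases smul_eq_zero.mp this with h0 | h0
    · linarith
    · exact e0 h0) ⟨by apply div_pos <;> linarith, by rw [div_lt_one (by linarith)]; linarith⟩
  convert this using 1
  have h3 : (r + s) / (2 * r) * (2 * r) = r + s := by field_simp
  have : ((r + s) / (2 * r)) • (m + r • e - (m - r • e)) = ((r + s) / (2 * r) * (2 * r)) • e := by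
    module
  rw [this, h3]; module

lemma convex (H : Dom Ω ρ) : Convex ℝ Ω := by
  rw [convex_iff_forall_pos]
  intro x hx y hy a b ha hb hab
  by_cases hxy : x = y
  · subst hxy; rw [← add_smul, hab, one_smul]; exact hx
  have := H.seg (subset_closure hx) (subset_closure hy) hxy (t := b) ⟨hb, by linarith⟩
  convert this using 1
  have : a = 1 - b := by linarith
  rw [this]; module

end Dom

lemma Dom.inward_deriv {n : ℕ} {Ω : Set (Rn n)} {ρ : Rn n → ℝ} (H : Dom Ω ρ) {p d : Rn n}
    (hp : p ∈ frontier Ω) (hd : fderiv ℝ ρ p d < 0) {f : Rn n → ℝ}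
    (hf : DifferentiableOn ℝ f (closure Ω)) :
    HasDerivWithinAt (fun t : ℝ => f (p + t • d)) (fderivWithin ℝ f (closure Ω) p d) (Ioi 0) 0 := by
  have h1 : HasDerivAt (fun s : ℝ => p + s • d) d 0 := by
    simpa using ((hasDerivAt_id (0:ℝ)).smul_const d).const_add p
  have h2 : HasFDerivWithinAt f (fderivWithin ℝ f (closure Ω) p) (closure Ω) (p + (0:ℝ) • d) := by
    simpa using (hf p (frontier_subset_closure hp)).hasFDerivWithinAt
  have h3 := HasFDerivWithinAt.comp_hasDerivWithinAt (0:ℝ) h2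
    (h1.hasDerivWithinAt (s := {t : ℝ | p + t • d ∈ closure Ω})) (fun t ht => ht)
  refine h3.mono_of_mem_nhdsWithin ?_
  filter_upwards [H.inward hp hd] with t ht using subset_closure ht

/-- First derivative up to the boundary. -/
noncomputable def d1 {n : ℕ} (Ω : Set (Rn n)) (f : Rn n → ℝ) : Rn n → Rn n →L[ℝ] ℝ :=
  fderivWithin ℝ f (closure Ω)

/-- Second derivative up to the boundary. -/
noncomputable def d2 {n : ℕ} (Ω : Set (Rn n)) (f : Rn n → ℝ) : Rn n → Rn n →L[ℝ] Rn n →L[ℝ] ℝ :=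
  fderivWithin ℝ (d1 Ω f) (closure Ω)

section
variable {n : ℕ} {Ω : Set (Rn n)} {ρ : Rn n → ℝ} {f : Rn n → ℝ}

lemma d1_smooth (H : Dom Ω ρ) (hf : ContDiffOn ℝ 2 f (closure Ω)) :
    ContDiffOn ℝ 1 (d1 Ω f) (closure Ω) := hf.fderivWithin H.udiff (by norm_num)

lemma d1_cont (H : Dom Ω ρ) (hf : ContDiffOn ℝ 2 f (closure Ω)) :
    ContinuousOn (d1 Ω f) (closure Ω) := (d1_smooth H hf).continuousOn

lemma d2_cont (H : Dom Ω ρ) (hf : ContDiffOn ℝ 2 f (closure Ω)) :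
    ContinuousOn (d2 Ω f) (closure Ω) :=
  ((d1_smooth H hf).fderivWithin H.udiff (m := 0) (by norm_num)).continuousOn

lemma d1_eq (H : Dom Ω ρ) {x : Rn n} (hx : x ∈ Ω) : d1 Ω f x = fderiv ℝ f x :=
  fderivWithin_of_mem_nhds (H.nhds hx)

lemma d2_eq (H : Dom Ω ρ) {x : Rn n} (hx : x ∈ Ω) : d2 Ω f x = fderiv ℝ (fderiv ℝ f) x := by
  unfold d2
  rw [fderivWithin_of_mem_nhds (H.nhds hx)]
  apply Filter.EventuallyEq.fderiv_eq
  filter_upwards [H.op.mem_nhds hx] with y hy using d1_eq H hy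

lemma cdat (H : Dom Ω ρ) (hf : ContDiffOn ℝ 2 f (closure Ω)) {x : Rn n} (hx : x ∈ Ω) :
    ContDiffAt ℝ 2 f x := hf.contDiffAt (H.nhds hx)
end

/-- Hypotheses on a first eigenfunction, without the equation. -/
structure Phi {n : ℕ} (Ω : Set (Rn n)) (ρ φ : Rn n → ℝ) : Prop where
  sm : ContDiffOn ℝ 2 φ (closure Ω)
  pos : ∀ x ∈ Ω, 0 < φ x
  bdv : ∀ x ∈ frontier Ω, φ x = 0
  nrm : ∀ x ∈ frontier Ω, d1 Ω φ x (gradient ρ x) < 0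

namespace Phi
variable {n : ℕ} {Ω : Set (Rn n)} {ρ φ : Rn n → ℝ}

lemma nonneg (F : Phi Ω ρ φ) {x : Rn n} (hx : x ∈ closure Ω) : 0 ≤ φ x := by
  rcases Dom.cl_cases hx with h | h
  · exact (F.pos x h).le
  · exact (F.bdv x h).ge

lemma inw (F : Phi Ω ρ φ) (H : Dom Ω ρ) {p d : Rn n} (hp : p ∈ frontier Ω)
    (hd : fderiv ℝ ρ p d < 0) : 0 ≤ d1 Ω φ p d := by
  have h1 := H.inward_deriv hp hd (F.sm.differentiableOn (by norm_num))
  have h2 := (hasDerivWithinAt_iff_tendsto_slope' (by simp)).mp h1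
  refine ge_of_tendsto h2 ?_
  filter_upwards [H.inward hp hd, self_mem_nhdsWithin] with t ht ht0
  have ht0 : (0:ℝ) < t := ht0
  have := F.pos _ ht
  rw [slope_def_field]
  simp only [zero_smul, add_zero, F.bdv p hp, sub_zero]
  positivity

lemma tan (F : Phi Ω ρ φ) (H : Dom Ω ρ) {p v : Rn n} (hp : p ∈ frontier Ω)
    (hv : fderiv ℝ ρ p v = 0) : d1 Ω φ p v = 0 := by
  have key : ∀ v, fderiv ℝ ρ p v = 0 → 0 ≤ d1 Ω φ p v := by
    intro v hv
    have hN := F.nrm p hp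
    have hG := H.grad_pos hp
    by_contra hc
    push Not at hc
    have := F.inw H hp (d := v - (d1 Ω φ p v / (2 * d1 Ω φ p (gradient ρ p))) • gradient ρ p) (by
      rw [map_sub, map_smul, hv, smul_eq_mul, zero_sub, neg_lt_zero]
      exact mul_pos (div_pos_of_neg_of_neg hc (by linarith)) hG)
    rw [map_sub, map_smul, smul_eq_mul] at this
    have h2 : d1 Ω φ p v / (2 * d1 Ω φ p (gradient ρ p)) * d1 Ω φ p (gradient ρ p)
        = d1 Ω φ p v / 2 := by
      have := hN.ne
      field_simp
    rw [h2] at this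
    linarith
  have h1 := key v hv
  have h2 := key (-v) (by simp [hv])
  rw [map_neg] at h2
  linarith

/-- The differential of φ at the boundary is a negative multiple of the one of ρ. -/
lemma mult (F : Phi Ω ρ φ) (H : Dom Ω ρ) {p : Rn n} (hp : p ∈ frontier Ω) :
    ∃ k : ℝ, 0 < k ∧ ∀ v, d1 Ω φ p v = - (k * fderiv ℝ ρ p v) := by
  have hN := F.nrm p hp
  have hG := H.grad_pos hp
  refine ⟨- d1 Ω φ p (gradient ρ p) / fderiv ℝ ρ p (gradient ρ p),
    div_pos (by linarith) hG, fun v => ?_⟩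
  have := F.tan H hp (v := v - (fderiv ℝ ρ p v / fderiv ℝ ρ p (gradient ρ p)) • gradient ρ p) (by
    rw [map_sub, map_smul, smul_eq_mul]; field_simp; ring)
  rw [map_sub, map_smul, smul_eq_mul] at this
  have h3 : d1 Ω φ p v = fderiv ℝ ρ p v / fderiv ℝ ρ p (gradient ρ p) * d1 Ω φ p (gradient ρ p) := by
    linarith
  rw [h3]; ring

lemma hess_aux (F : Phi Ω ρ φ) (H : Dom Ω ρ) {p v : Rn n} (hp : p ∈ frontier Ω) (hv0 : v ≠ 0)
    (hv : fderiv ℝ ρ p v = 0) {k : ℝ} (hk : ∀ v, d1 Ω φ p v = - (k * fderiv ℝ ρ p v))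
    {ε : ℝ} (hε : 0 < ε) :
    ∃ ξ ∈ Ω, ∃ v' : Rn n, dist ξ p < ε ∧ dist v' v < ε ∧
      d2 Ω φ ξ v' v' + k * fderiv ℝ (fderiv ℝ ρ) ξ v' v' = 0 := by
  set N := gradient ρ p with hNdef
  have hG := H.grad_pos hp
  have hN0 : 0 < ‖N‖ := norm_pos_iff.mpr (H.gr p hp)
  have hp0 := H.fr_iff.mp hp
  have hpc : p ∈ closure Ω := frontier_subset_closure hp
  set η := ε / (2 * ‖N‖) with hη
  have hη0 : 0 < η := by positivity
  have hηN : η * ‖N‖ < ε := by rw [hη]; field_simp; norm_num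
  have hin := H.inward hp (d := v - η • N) (by
    rw [map_sub, map_smul, hv, smul_eq_mul, zero_sub, neg_lt_zero]
    exact mul_pos hη0 hG)
  have hsm : ∀ᶠ t in 𝓝[>] (0:ℝ), t * (‖v‖ + ε) < ε := by
    have : Tendsto (fun t : ℝ => t * (‖v‖ + ε)) (𝓝 0) (𝓝 (0 * (‖v‖ + ε))) :=
      (continuous_id.mul continuous_const).tendsto 0
    rw [zero_mul] at this
    exact (this.eventually (gt_mem_nhds hε)).filter_mono nhdsWithin_le_nhds
  obtain ⟨t, ⟨ht1, ht2⟩, ht0⟩ := ((hin.and hsm).and self_mem_nhdsWithin).exists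
  have ht0 : (0:ℝ) < t := ht0
  -- the point p + t v lies outside
  have hout : 0 < ρ (p + t • v) := by
    by_contra hc
    push Not at hc
    have h1 := H.support hp (H.cl_iff.mpr hc) (by simp [ht0.ne', hv0])
    simp [hv] at h1
  have hin' : ρ (p + t • v - (η * t) • N) < 0 := by
    have := H.mem_iff.mp ht1
    convert this using 2
    module
  obtain ⟨s, hs, hs0⟩ : ∃ s ∈ Ioo 0 (η * t), ρ (p + t • v - s • N) = 0 := by
    have hcont : Continuous (fun s : ℝ => ρ (p + t • v - s • N)) :=
      H.sm.continuous.comp (by fun_prop)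
    have := intermediate_value_Ioo' (by positivity : (0:ℝ) ≤ η * t) hcont.continuousOn
    exact this ⟨hin', by simpa using hout⟩
  set v' := v - (s / t) • N with hv'
  have hP : p + t • v - s • N = p + t • v' := by
    rw [hv', smul_sub, smul_smul, mul_div_cancel₀ _ ht0.ne']; module
  rw [hP] at hs0
  have hst : 0 < s / t := div_pos hs.1 ht0
  have hstη : s / t < η := by rw [div_lt_iff₀ ht0]; exact hs.2
  have hvz0 : v' ≠ 0 := by
    intro h
    have : fderiv ℝ ρ p v' = - (s / t * fderiv ℝ ρ p N) := by
      rw [hv', map_sub, map_smul, hv, smul_eq_mul, zero_sub]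
    rw [h, map_zero] at this
    have := mul_pos hst hG
    linarith
  have hdv : dist v' v < ε := by
    rw [dist_eq_norm, hv', sub_sub_cancel_left, norm_neg, norm_smul, Real.norm_of_nonneg hst.le]
    exact (mul_lt_mul_of_pos_right hstη hN0).trans hηN
  have hPf : p + t • v' ∈ frontier Ω := H.fr_iff.mpr hs0
  have hPc : p + t • v' ∈ closure Ω := frontier_subset_closure hPf
  have hne : p ≠ p + t • v' := by simp [ht0.ne', hvz0]
  have hsegΩ : ∀ τ ∈ Ioo (0:ℝ) t, p + τ • v' ∈ Ω := by
    intro τ hτ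
    have := H.seg hpc hPc hne (t := τ / t) ⟨div_pos hτ.1 ht0, by rw [div_lt_one ht0]; exact hτ.2⟩
    convert this using 1
    rw [add_sub_cancel_left, smul_smul, div_mul_cancel₀ _ ht0.ne']
  have hsegK : ∀ τ ∈ Icc (0:ℝ) t, p + τ • v' ∈ closure Ω := by
    intro τ hτ
    rcases hτ.1.eq_or_lt with h | h
    · rw [← h]; simpa using hpc
    rcases hτ.2.eq_or_lt with h2 | h2
    · rw [h2]; exact hPc
    exact subset_closure (hsegΩ τ ⟨h, h2⟩)
  have hline : Continuous (fun τ : ℝ => p + τ • v') := by fun_prop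
  obtain ⟨τ1, hτ1, e1⟩ := exists_hasDerivAt_eq_zero
    (f := fun τ : ℝ => φ (p + τ • v') + k * ρ (p + τ • v'))
    (f' := fun τ => fderiv ℝ φ (p + τ • v') v' + k * fderiv ℝ ρ (p + τ • v') v') ht0
    ((F.sm.continuousOn.comp hline.continuousOn hsegK).add
      (continuous_const.mul (H.sm.continuous.comp hline)).continuousOn)
    (by simp [F.bdv p hp, hp0, F.bdv _ hPf, hs0])
    (fun τ hτ => (line_deriv1 v' ((cdat H F.sm (hsegΩ τ hτ)).differentiableAt (by norm_num))).add
      ((line_deriv1 v' (H.rdiff _)).const_mul k))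
  have hDr : Continuous (fun τ : ℝ => fderiv ℝ ρ (p + τ • v') v') :=
    ((H.sm.continuous_fderiv (by norm_num)).comp hline).clm_apply continuous_const
  obtain ⟨τ2, hτ2, e2⟩ := exists_hasDerivAt_eq_zero
    (f := fun τ : ℝ => d1 Ω φ (p + τ • v') v' + k * fderiv ℝ ρ (p + τ • v') v')
    (f' := fun τ => fderiv ℝ (fderiv ℝ φ) (p + τ • v') v' v'
      + k * fderiv ℝ (fderiv ℝ ρ) (p + τ • v') v' v') hτ1.1
    ((((d1_cont H F.sm).comp hline.continuousOn
      (fun τ hτ => hsegK τ ⟨hτ.1, hτ.2.trans hτ1.2.le⟩)).clm_apply continuousOn_const).add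
      (continuous_const.mul hDr).continuousOn)
    (by
      rw [d1_eq H (hsegΩ τ1 hτ1)]
      rw [e1, zero_smul, add_zero, hk]; ring)
    (fun τ hτ => by
      have hm := hsegΩ τ ⟨hτ.1, hτ.2.trans hτ1.2⟩
      have hA := line_deriv2 v' (cdat H F.sm hm)
      have hev : (fun τ : ℝ => d1 Ω φ (p + τ • v') v') =ᶠ[𝓝 τ]
          fun τ => fderiv ℝ φ (p + τ • v') v' := by
        filter_upwards [hline.continuousAt.eventually (H.op.mem_nhds hm)] with σ hσ
        rw [d1_eq H hσ]
      exact (hA.congr_of_eventuallyEq hev).add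
        ((line_deriv2 v' H.sm.contDiffAt).const_mul k))
  have hm2 := hsegΩ τ2 ⟨hτ2.1, hτ2.2.trans hτ1.2⟩
  refine ⟨p + τ2 • v', hm2, v', ?_, hdv, ?_⟩
  · rw [dist_eq_norm, add_sub_cancel_left, norm_smul, Real.norm_of_nonneg hτ2.1.le]
    have h1 : ‖v'‖ ≤ ‖v‖ + ε := by
      have : ‖v'‖ ≤ ‖v‖ + ‖v' - v‖ := by
        have := norm_add_le v (v' - v); rwa [add_sub_cancel] at this
      rw [dist_eq_norm] at hdv
      linarith
    have h2 : τ2 ≤ t := (hτ2.2.trans hτ1.2).le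
    calc τ2 * ‖v'‖ ≤ t * (‖v‖ + ε) := by
          apply mul_le_mul h2 h1 (norm_nonneg _) ht0.le
      _ < ε := ht2
  · rw [d2_eq H hm2]; exact e2

lemma hess (F : Phi Ω ρ φ) (H : Dom Ω ρ) {p v : Rn n} (hp : p ∈ frontier Ω) (hv0 : v ≠ 0)
    (hv : fderiv ℝ ρ p v = 0) : d2 Ω φ p v v < 0 := by
  obtain ⟨k, hk0, hk⟩ := F.mult H hp
  have hpc : p ∈ closure Ω := frontier_subset_closure hp
  have hsc := H.sc p hp v hv0 hv
  suffices h : d2 Ω φ p v v + k * fderiv ℝ (fderiv ℝ ρ) p v v = 0 by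
    have := mul_pos hk0 hsc
    linarith
  by_contra hne
  have hDr : Continuous (fderiv ℝ (fderiv ℝ ρ)) :=
    (H.sm.fderiv_right (m := 1) (by norm_num)).continuous_fderiv (by norm_num)
  have hc : ContinuousWithinAt (fun z : Rn n × Rn n => d2 Ω φ z.1 z.2 z.2 +
      k * fderiv ℝ (fderiv ℝ ρ) z.1 z.2 z.2) (closure Ω ×ˢ univ) (p, v) := by
    have h1 : ContinuousOn (fun z : Rn n × Rn n => d2 Ω φ z.1) (closure Ω ×ˢ univ) :=
      (d2_cont H F.sm).comp continuous_fst.continuousOn (fun z hz => hz.1)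
    have h2 : ContinuousOn (fun z : Rn n × Rn n => d2 Ω φ z.1 z.2 z.2) (closure Ω ×ˢ univ) :=
      (h1.clm_apply continuous_snd.continuousOn).clm_apply continuous_snd.continuousOn
    have h3 : Continuous (fun z : Rn n × Rn n => k * fderiv ℝ (fderiv ℝ ρ) z.1 z.2 z.2) :=
      continuous_const.mul (((hDr.comp continuous_fst).clm_apply continuous_snd).clm_apply
        continuous_snd)
    exact (h2.add h3.continuousOn) (p, v) ⟨hpc, mem_univ _⟩
  have hev := hc.eventually_ne hne
  obtain ⟨ε, hε, hball⟩ := Metric.mem_nhdsWithin_iff.mp hev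
  obtain ⟨ξ, hξ, v', a1, a2, a3⟩ := F.hess_aux H hp hv0 hv hk hε
  have hin : ((ξ, v') : Rn n × Rn n) ∈ Metric.ball (p, v) ε ∩ closure Ω ×ˢ univ :=
    ⟨by rw [Metric.mem_ball, Prod.dist_eq]; exact max_lt a1 a2, subset_closure hξ, mem_univ _⟩
  exact hball hin a3

lemma conc (F : Phi Ω ρ φ) (H : Dom Ω ρ) {p : Rn n} (hp : p ∈ frontier Ω) :
    ∀ᶠ ξ in 𝓝 p, ξ ∈ Ω → ∀ v, φ ξ * d2 Ω φ ξ v v ≤ (d1 Ω φ ξ v) ^ 2 := by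
  obtain ⟨k, hk0, hk⟩ := F.mult H hp
  have hpc : p ∈ closure Ω := frontier_subset_closure hp
  have h1 : ContinuousOn (fun z : Rn n × Rn n => d2 Ω φ z.1) (closure Ω ×ˢ univ) :=
    (d2_cont H F.sm).comp continuous_fst.continuousOn (fun z hz => hz.1)
  have h2 : ContinuousOn (fun z : Rn n × Rn n => d2 Ω φ z.1 z.2 z.2) (closure Ω ×ˢ univ) :=
    (h1.clm_apply continuous_snd.continuousOn).clm_apply continuous_snd.continuousOn
  have h3 : ContinuousOn (fun z : Rn n × Rn n => d1 Ω φ z.1 z.2) (closure Ω ×ˢ univ) :=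
    ((d1_cont H F.sm).comp continuous_fst.continuousOn (fun z hz => hz.1)).clm_apply
      continuous_snd.continuousOn
  have h4 : ContinuousOn (fun z : Rn n × Rn n => φ z.1) (closure Ω ×ˢ univ) :=
    F.sm.continuousOn.comp continuous_fst.continuousOn (fun z hz => hz.1)
  have hsph : ∀ᶠ ξ in 𝓝 p, ∀ v ∈ Metric.sphere (0 : Rn n) 1,
      ξ ∈ Ω → φ ξ * d2 Ω φ ξ v v ≤ (d1 Ω φ ξ v) ^ 2 := by
    apply (isCompact_sphere (0 : Rn n) 1).eventually_forall_of_forall_eventually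
    intro v hv
    have hv0 : v ≠ 0 := by rintro rfl; simp at hv
    have hmem : (p, v) ∈ closure Ω ×ˢ (univ : Set (Rn n)) := ⟨hpc, mem_univ _⟩
    suffices hs : ∀ᶠ z : Rn n × Rn n in 𝓝[closure Ω ×ˢ univ] (p, v),
        z.1 ∈ Ω → φ z.1 * d2 Ω φ z.1 z.2 z.2 ≤ (d1 Ω φ z.1 z.2) ^ 2 by
      have := eventually_nhdsWithin_iff.mp hs
      filter_upwards [this] with z hz hzΩ
      exact hz ⟨subset_closure hzΩ, mem_univ _⟩ hzΩ
    by_cases hd : fderiv ℝ ρ p v = 0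
    · have hneg := F.hess H hp hv0 hd
      have := (h2 (p, v) hmem).eventually (gt_mem_nhds hneg)
      filter_upwards [this] with z hz hzΩ
      have := mul_neg_of_pos_of_neg (F.pos _ hzΩ) hz
      nlinarith [sq_nonneg (d1 Ω φ z.1 z.2)]
    · have hlt : φ p * d2 Ω φ p v v - (d1 Ω φ p v) ^ 2 < 0 := by
        rw [F.bdv p hp, hk]
        have : k * fderiv ℝ ρ p v ≠ 0 := mul_ne_zero hk0.ne' hd
        have := sq_pos_of_ne_zero this
        nlinarith
      have := (((h4.mul h2).sub (h3.pow 2)) (p, v) hmem).eventually (gt_mem_nhds hlt)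
      filter_upwards [this] with z hz _
      have hz' : φ z.1 * d2 Ω φ z.1 z.2 z.2 - (d1 Ω φ z.1 z.2) ^ 2 < 0 := hz
      linarith
  filter_upwards [hsph] with ξ hξ hξΩ v
  by_cases hv : v = 0
  · simp [hv]
  have hn : 0 < ‖v‖ := norm_pos_iff.mpr hv
  have hvv : v = ‖v‖ • (‖v‖⁻¹ • v) := by rw [smul_smul, mul_inv_cancel₀ hn.ne', one_smul]
  have := hξ (‖v‖⁻¹ • v) (by simp [norm_smul, hn.ne']) hξΩ
  set w := ‖v‖⁻¹ • v
  rw [hvv]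
  simp only [map_smul, smul_apply, smul_eq_mul]
  have h5 := mul_le_mul_of_nonneg_left this (sq_nonneg ‖v‖)
  nlinarith

lemma mono (F : Phi Ω ρ φ) (H : Dom Ω ρ) {p e : Rn n} (hp : p ∈ frontier Ω)
    (he : 0 < fderiv ℝ ρ p e) :
    ∃ ε > 0, ∀ ξ ∈ closure Ω, ∀ e', dist ξ p < ε → dist e' e < ε → d1 Ω φ ξ e' < 0 := by
  obtain ⟨k, hk0, hk⟩ := F.mult H hp
  have hpc : p ∈ closure Ω := frontier_subset_closure hp
  have h3 : ContinuousOn (fun z : Rn n × Rn n => d1 Ω φ z.1 z.2) (closure Ω ×ˢ univ) :=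
    ((d1_cont H F.sm).comp continuous_fst.continuousOn (fun z hz => hz.1)).clm_apply
      continuous_snd.continuousOn
  have hlt : d1 Ω φ p e < 0 := by rw [hk]; have := mul_pos hk0 he; linarith
  have := (h3 (p, e) ⟨hpc, mem_univ _⟩).eventually (gt_mem_nhds hlt)
  obtain ⟨ε, hε, hball⟩ := Metric.mem_nhdsWithin_iff.mp this
  refine ⟨ε, hε, fun ξ hξ e' a1 a2 => ?_⟩
  have hin : ((ξ, e') : Rn n × Rn n) ∈ Metric.ball (p, e) ε ∩ closure Ω ×ˢ univ :=
    ⟨by rw [Metric.mem_ball, Prod.dist_eq]; exact max_lt a1 a2, hξ, mem_univ _⟩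
  exact hball hin

end Phi

/-- Logarithm of the comparison function. -/
noncomputable def Psi (a b s : ℝ) : ℝ := b * Real.log (Real.cos (a * s))

lemma cos_pos_of {a D s : ℝ} (ha : 0 < a) (haD : a * D < Real.pi) (hs : |s| ≤ D / 2) :
    0 < Real.cos (a * s) := by
  have h := abs_le.mp hs
  apply Real.cos_pos_of_mem_Ioo
  constructor <;> nlinarith

lemma Psi_deriv {a b s : ℝ} (h : 0 < Real.cos (a * s)) :
    HasDerivAt (Psi a b) (-(a * b * Real.tan (a * s))) s := by
  have h1 : HasDerivAt (fun s => a * s) a s := by simpa using (hasDerivAt_id s).const_mul a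
  have h2 := ((h1.cos).log h.ne').const_mul b
  have h3 : -(a * b * Real.tan (a * s)) = b * (-Real.sin (a * s) * a / Real.cos (a * s)) := by
    rw [Real.tan_eq_sin_div_cos]; field_simp
  rw [h3]
  exact h2

lemma Psi_deriv2 {a b s : ℝ} (h : 0 < Real.cos (a * s)) :
    HasDerivAt (fun s => -(a * b * Real.tan (a * s)))
      (-(a ^ 2 * b * (1 + Real.tan (a * s) ^ 2))) s := by
  have h1 : HasDerivAt (fun s => a * s) a s := by simpa using (hasDerivAt_id s).const_mul a
  have h2 := (((Real.hasDerivAt_tan h.ne').comp s h1).const_mul (a * b)).neg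
  have h3 : -(a ^ 2 * b * (1 + Real.tan (a * s) ^ 2)) =
      -(a * b * (1 / Real.cos (a * s) ^ 2 * a)) := by
    rw [Real.tan_eq_sin_div_cos]
    have := Real.sin_sq_add_cos_sq (a * s)
    field_simp
    linear_combination (-(a ^ 2 * b)) * this
  rw [h3]
  exact h2

lemma Psi_even {a b s : ℝ} : Psi a b (-s) = Psi a b s := by
  unfold Psi; rw [mul_neg, Real.cos_neg]

section
variable {n : ℕ} {Ω : Set (Rn n)} {ρ φ : Rn n → ℝ}

/-- The logarithm of φ. -/
noncomputable def lg (φ : Rn n → ℝ) : Rn n → ℝ := fun y => Real.log (φ y)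

lemma lg_smooth (F : Phi Ω ρ φ) (H : Dom Ω ρ) {x : Rn n} (hx : x ∈ Ω) :
    ContDiffAt ℝ 2 (lg φ) x := (log_derivs (cdat H F.sm hx) (F.pos x hx) 0).1

lemma line_mem (H : Dom Ω ρ) {m e : Rn n} {r t : ℝ} (h1 : m + r • e ∈ Ω) (h2 : m - r • e ∈ Ω)
    (ht : |t| ≤ r) : m + t • e ∈ Ω := by
  have h := abs_le.mp ht
  rcases eq_or_lt_of_le ((abs_nonneg t).trans ht) with h0 | h0
  · have : t = r := by linarith
    rw [this]; exact h1
  have := H.convex h1 h2 (a := (r + t) / (2 * r)) (b := (r - t) / (2 * r))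
    (by apply div_nonneg <;> linarith) (by apply div_nonneg <;> linarith) (by field_simp; ring)
  convert this using 1
  have e1 : ((r + t) / (2 * r)) + ((r - t) / (2 * r)) = 1 := by field_simp; ring
  have e2 : ((r + t) / (2 * r)) * r - ((r - t) / (2 * r)) * r = t := by field_simp; ring
  calc m + t • e = (((r + t) / (2 * r)) + ((r - t) / (2 * r))) • m +
      (((r + t) / (2 * r)) * r - ((r - t) / (2 * r)) * r) • e := by rw [e1, e2, one_smul]
    _ = _ := by module

lemma quad_ineq (F : Phi Ω ρ φ) (H : Dom Ω ρ) {p m e : Rn n} {r s ε : ℝ}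
    (hc : ∀ ξ ∈ Metric.ball p ε, ξ ∈ Ω → ∀ v, φ ξ * d2 Ω φ ξ v v ≤ (d1 Ω φ ξ v) ^ 2)
    (h1 : m + r • e ∈ Ω) (h2 : m - r • e ∈ Ω)
    (b1 : m + r • e ∈ Metric.ball p ε) (b2 : m - r • e ∈ Metric.ball p ε) (hs : |s| ≤ r) :
    lg φ (m + r • e) + lg φ (m - r • e) ≤ lg φ (m + s • e) + lg φ (m - s • e) := by
  have h := abs_le.mp hs
  rcases eq_or_lt_of_le ((abs_nonneg s).trans hs) with h0 | h0
  · have : s = r := by linarith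
    rw [this]
  have hmem : ∀ t ∈ Icc (-r) r, m + t • e ∈ Ω := fun t ht => line_mem H h1 h2 (abs_le.mpr ht)
  have hball : ∀ t ∈ Icc (-r) r, m + t • e ∈ Metric.ball p ε := by
    intro t ht
    have := (convex_ball p ε) b1 b2 (a := (r + t) / (2 * r)) (b := (r - t) / (2 * r))
      (by apply div_nonneg <;> linarith [ht.1, ht.2])
      (by apply div_nonneg <;> linarith [ht.1, ht.2]) (by field_simp; ring)
    convert this using 1
    have e1 : ((r + t) / (2 * r)) + ((r - t) / (2 * r)) = 1 := by field_simp; ring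
    have e2 : ((r + t) / (2 * r)) * r - ((r - t) / (2 * r)) * r = t := by field_simp; ring
    calc m + t • e = (((r + t) / (2 * r)) + ((r - t) / (2 * r))) • m +
        (((r + t) / (2 * r)) * r - ((r - t) / (2 * r)) * r) • e := by rw [e1, e2, one_smul]
      _ = _ := by module
  have hcv : ConcaveOn ℝ (Icc (-r) r) (fun t => lg φ (m + t • e)) := by
    refine concaveOn_of_hasDerivWithinAt2_nonpos (convex_Icc _ _)
      (f' := fun t => fderiv ℝ (lg φ) (m + t • e) e)
      (f'' := fun t => fderiv ℝ (fderiv ℝ (lg φ)) (m + t • e) e e) ?_ ?_ ?_ ?_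
    · intro t ht
      exact (line_deriv1 e ((lg_smooth F H (hmem t ht)).differentiableAt
        (by norm_num))).continuousAt.continuousWithinAt
    · intro t ht
      exact (line_deriv1 e ((lg_smooth F H (hmem t (interior_subset ht))).differentiableAt
        (by norm_num))).hasDerivWithinAt
    · intro t ht
      exact (line_deriv2 e (lg_smooth F H (hmem t (interior_subset ht)))).hasDerivWithinAt
    · intro t ht
      have ht := interior_subset ht
      have hx := hmem t ht
      have := (log_derivs (cdat H F.sm hx) (F.pos _ hx) e).2.2
      have hcc := hc _ (hball t ht) hx e
      rw [d1_eq H hx, d2_eq H hx] at hcc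
      unfold lg
      rw [this]
      have hp := F.pos _ hx
      rw [sub_nonpos, div_pow, div_le_div_iff₀ hp (by positivity)]
      nlinarith
  have hcv' := fun (x y : ℝ) (hx : x ∈ Icc (-r) r) (hy : y ∈ Icc (-r) r) (a b : ℝ)
    (ha : 0 ≤ a) (hb : 0 ≤ b) (hab : a + b = 1) => hcv.2 hx hy ha hb hab
  have k1 := hcv' r (-r) ⟨by linarith, le_refl _⟩ ⟨le_refl _, by linarith⟩
    ((r + s) / (2 * r)) ((r - s) / (2 * r))
    (by apply div_nonneg <;> linarith) (by apply div_nonneg <;> linarith) (by field_simp; ring)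
  have k2 := hcv' r (-r) ⟨by linarith, le_refl _⟩ ⟨le_refl _, by linarith⟩
    ((r - s) / (2 * r)) ((r + s) / (2 * r))
    (by apply div_nonneg <;> linarith) (by apply div_nonneg <;> linarith) (by field_simp; ring)
  have e1 : (r + s) / (2 * r) * r + (r - s) / (2 * r) * (-r) = s := by field_simp; ring
  have e2 : (r - s) / (2 * r) * r + (r + s) / (2 * r) * (-r) = -s := by field_simp; ring
  have e3 : (r + s) / (2 * r) + (r - s) / (2 * r) = 1 := by field_simp; ring
  simp only [smul_eq_mul, e1, e2, neg_smul, ← sub_eq_add_neg] at k1 k2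
  have e4 : (r - s) / (2 * r) = 1 - (r + s) / (2 * r) := by linarith
  rw [e4] at k1 k2
  linarith

/-- The four point function. -/
noncomputable def Fn (φ : Rn n → ℝ) (a b : ℝ) (z : Rn n × Rn n × ℝ × ℝ) : ℝ :=
  lg φ (z.1 + z.2.2.1 • z.2.1) + lg φ (z.1 - z.2.2.1 • z.2.1)
    - lg φ (z.1 + z.2.2.2 • z.2.1) - lg φ (z.1 - z.2.2.2 • z.2.1)
    - 2 * Psi a b z.2.2.1 + 2 * Psi a b z.2.2.2

/-- The domain of the four point function. -/
def An (Ω : Set (Rn n)) : Set (Rn n × Rn n × ℝ × ℝ) :=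
  {z | ‖z.2.1‖ = 1 ∧ z.1 + z.2.2.1 • z.2.1 ∈ Ω ∧ z.1 - z.2.2.1 • z.2.1 ∈ Ω ∧ |z.2.2.2| ≤ z.2.2.1}

lemma endpoint (F : Phi Ω ρ φ) (H : Dom Ω ρ) {mk ek : ℕ → Rn n} {rk sk : ℕ → ℝ}
    {m e : Rn n} {r : ℝ} (hr : 0 < r) (he : ‖e‖ = 1)
    (hm : Tendsto mk atTop (𝓝 m)) (hek : Tendsto ek atTop (𝓝 e))
    (hrk : Tendsto rk atTop (𝓝 r)) (hsk : Tendsto sk atTop (𝓝 r))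
    (hs0 : ∀ k, 0 ≤ sk k) (hsr : ∀ k, sk k ≤ rk k)
    (h1 : ∀ k, mk k + rk k • ek k ∈ Ω) (h2 : ∀ k, mk k - rk k • ek k ∈ Ω)
    {η : ℝ} (hη : 0 < η) :
    ∀ᶠ k in atTop, lg φ (mk k + rk k • ek k) - lg φ (mk k + sk k • ek k) ≤ η := by
  have t1 : Tendsto (fun k => mk k + rk k • ek k) atTop (𝓝 (m + r • e)) := hm.add (hrk.smul hek)
  have t2 : Tendsto (fun k => mk k - rk k • ek k) atTop (𝓝 (m - r • e)) := hm.sub (hrk.smul hek)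
  have t3 : Tendsto (fun k => mk k + sk k • ek k) atTop (𝓝 (m + r • e)) := hm.add (hsk.smul hek)
  have c1 : m + r • e ∈ closure Ω := mem_closure_of_tendsto t1 (Eventually.of_forall h1)
  have c2 : m - r • e ∈ closure Ω := mem_closure_of_tendsto t2 (Eventually.of_forall h2)
  have e0 : e ≠ 0 := by rintro rfl; simp at he
  rcases Dom.cl_cases c1 with hx | hx
  · have hc := (lg_smooth F H hx).continuousAt
    have := (hc.tendsto.comp t1).sub (hc.tendsto.comp t3)
    rw [sub_self] at this
    filter_upwards [this.eventually (gt_mem_nhds hη)] with k hk using le_of_lt hk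
  · have hsup := H.support hx c2 (by
      intro h
      have : (2 * r) • e = 0 := by
        have h3 : (2 * r) • e = (m + r • e) - (m - r • e) := by module
        rw [h3, h, sub_self]
      rcases smul_eq_zero.mp this with h0 | h0
      · linarith
      · exact e0 h0)
    have h3 : m - r • e - (m + r • e) = (-(2 * r)) • e := by module
    rw [h3, map_smul, smul_eq_mul] at hsup
    have hpos : 0 < fderiv ℝ ρ (m + r • e) e := by
      by_contra hcon
      push Not at hcon
      have := mul_nonneg_of_nonpos_of_nonpos (by linarith : -(2 * r) ≤ 0) hcon
      linarith
    obtain ⟨ε, hε, hmono⟩ := F.mono H hx hpos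
    filter_upwards [t1.eventually (Metric.ball_mem_nhds _ hε),
      t3.eventually (Metric.ball_mem_nhds _ hε), hek.eventually (Metric.ball_mem_nhds _ hε)]
      with k b1 b3 be
    have hrk0 : 0 ≤ rk k := (hs0 k).trans (hsr k)
    have hmem : ∀ t ∈ Icc (sk k) (rk k), mk k + t • ek k ∈ Ω := fun t ht =>
      line_mem H (h1 k) (h2 k) (by rw [abs_of_nonneg ((hs0 k).trans ht.1)]; exact ht.2)
    suffices hle : φ (mk k + rk k • ek k) ≤ φ (mk k + sk k • ek k) by
      have := Real.log_le_log (F.pos _ (h1 k)) hle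
      unfold lg
      linarith
    rcases eq_or_lt_of_le (hsr k) with heq | hlt
    · rw [heq]
    have hd : ∀ t ∈ Icc (sk k) (rk k), HasDerivAt (fun t : ℝ => φ (mk k + t • ek k))
        (fderiv ℝ φ (mk k + t • ek k) (ek k)) t := fun t ht =>
      line_deriv1 _ ((cdat H F.sm (hmem t ht)).differentiableAt (by norm_num))
    obtain ⟨t, ht, hte⟩ := exists_hasDerivAt_eq_slope (fun t : ℝ => φ (mk k + t • ek k)) _ hlt
      (fun t ht => (hd t ht).continuousAt.continuousWithinAt)
      (fun t ht => hd t ⟨ht.1.le, ht.2.le⟩)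
    have htm := hmem t ⟨ht.1.le, ht.2.le⟩
    have hb : mk k + t • ek k ∈ Metric.ball (m + r • e) ε := by
      have := (convex_ball (m + r • e) ε).add_smul_sub_mem b3 b1
        (t := (t - sk k) / (rk k - sk k)) ⟨div_nonneg (by linarith [ht.1]) (by linarith),
          by rw [div_le_one (by linarith)]; linarith [ht.2]⟩
      convert this using 1
      have e1 : (t - sk k) / (rk k - sk k) * (rk k - sk k) = t - sk k :=
        div_mul_cancel₀ _ (by linarith)
      have e2 : mk k + rk k • ek k - (mk k + sk k • ek k) = (rk k - sk k) • ek k := by module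
      rw [e2, smul_smul, e1]; module
    have hneg := hmono _ (subset_closure htm) _ hb be
    rw [d1_eq H htm, hte] at hneg
    by_contra hcon
    push Not at hcon
    have := div_pos (sub_pos.mpr hcon) (sub_pos.mpr hlt)
    linarith

lemma An_limit (F : Phi Ω ρ φ) (H : Dom Ω ρ) {a b D : ℝ} (ha : 0 < a) (haD : a * D < Real.pi)
    (hD : ∀ x ∈ closure Ω, ∀ y ∈ closure Ω, dist x y ≤ D) {δ : ℝ} (hδ : 0 < δ)
    {zk : ℕ → Rn n × Rn n × ℝ × ℝ} {z : Rn n × Rn n × ℝ × ℝ} (hz : Tendsto zk atTop (𝓝 z))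
    (hA : ∀ k, zk k ∈ An Ω) (hF : ∀ k, δ ≤ Fn φ a b (zk k)) : z ∈ An Ω := by
  obtain ⟨m, e, r, s⟩ := z
  have hm : Tendsto (fun k => (zk k).1) atTop (𝓝 m) := (continuous_fst.tendsto _).comp hz
  have hek : Tendsto (fun k => (zk k).2.1) atTop (𝓝 e) :=
    ((continuous_fst.comp continuous_snd).tendsto _).comp hz
  have hrk : Tendsto (fun k => (zk k).2.2.1) atTop (𝓝 r) :=
    ((continuous_fst.comp (continuous_snd.comp continuous_snd)).tendsto _).comp hz
  have hsk : Tendsto (fun k => (zk k).2.2.2) atTop (𝓝 s) :=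
    ((continuous_snd.comp (continuous_snd.comp continuous_snd)).tendsto _).comp hz
  set mk := fun k => (zk k).1
  set ek := fun k => (zk k).2.1
  set rk := fun k => (zk k).2.2.1
  set sk := fun k => (zk k).2.2.2
  have hA' : ∀ k, ‖ek k‖ = 1 ∧ mk k + rk k • ek k ∈ Ω ∧ mk k - rk k • ek k ∈ Ω ∧
    |sk k| ≤ rk k := hA
  have hF' : ∀ k, δ ≤ lg φ (mk k + rk k • ek k) + lg φ (mk k - rk k • ek k)
    - lg φ (mk k + sk k • ek k) - lg φ (mk k - sk k • ek k)
    - 2 * Psi a b (rk k) + 2 * Psi a b (sk k) := hF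
  have he : ‖e‖ = 1 := by
    refine tendsto_nhds_unique hek.norm ?_
    simp [fun k => (hA' k).1]
  have e0 : e ≠ 0 := by rintro rfl; simp at he
  have hsr : |s| ≤ r := le_of_tendsto_of_tendsto' hsk.abs hrk fun k => (hA' k).2.2.2
  have t1 : Tendsto (fun k => mk k + rk k • ek k) atTop (𝓝 (m + r • e)) := hm.add (hrk.smul hek)
  have t2 : Tendsto (fun k => mk k - rk k • ek k) atTop (𝓝 (m - r • e)) := hm.sub (hrk.smul hek)
  have t3 : Tendsto (fun k => mk k + sk k • ek k) atTop (𝓝 (m + s • e)) := hm.add (hsk.smul hek)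
  have t4 : Tendsto (fun k => mk k - sk k • ek k) atTop (𝓝 (m - s • e)) := hm.sub (hsk.smul hek)
  have c1 : m + r • e ∈ closure Ω :=
    mem_closure_of_tendsto t1 (Eventually.of_forall fun k => (hA' k).2.1)
  have c2 : m - r • e ∈ closure Ω :=
    mem_closure_of_tendsto t2 (Eventually.of_forall fun k => (hA' k).2.2.1)
  have hr0 : 0 ≤ r := (abs_nonneg s).trans hsr
  have hrD : r ≤ D / 2 := by
    have := hD _ c1 _ c2
    have h3 : m + r • e - (m - r • e) = (2 * r) • e := by module
    rw [dist_eq_norm, h3, norm_smul, he, mul_one, Real.norm_of_nonneg (by linarith)] at this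
    linarith
  have pr : Tendsto (fun k => Psi a b (rk k)) atTop (𝓝 (Psi a b r)) :=
    ((Psi_deriv (cos_pos_of ha haD
      (by rwa [abs_of_nonneg hr0]))).continuousAt.tendsto).comp hrk
  have ps : Tendsto (fun k => Psi a b (sk k)) atTop (𝓝 (Psi a b s)) :=
    ((Psi_deriv (cos_pos_of ha haD (hsr.trans hrD))).continuousAt.tendsto).comp hsk
  have pd : Tendsto (fun k => - 2 * Psi a b (rk k) + 2 * Psi a b (sk k)) atTop
      (𝓝 (- 2 * Psi a b r + 2 * Psi a b s)) := (pr.const_mul (-2)).add (ps.const_mul 2)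
  by_contra hcon
  have hout : m + r • e ∈ frontier Ω ∨ m - r • e ∈ frontier Ω := by
    rcases Dom.cl_cases c1 with h1 | h1
    · rcases Dom.cl_cases c2 with h2 | h2
      · exact absurd ⟨he, h1, h2, hsr⟩ hcon
      · exact Or.inr h2
    · exact Or.inl h1
  rcases eq_or_lt_of_le hr0 with hr | hr
  · -- all points collapse to a boundary point
    have hs : s = 0 := by rw [← hr] at hsr; exact abs_nonpos_iff.mp hsr
    have hp : m ∈ frontier Ω := by simpa [← hr] using hout
    obtain ⟨ε, hε, hball⟩ := Metric.mem_nhds_iff.mp (F.conc H hp)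
    rw [hs, ← hr] at pd
    have pd' : Tendsto (fun k => - 2 * Psi a b (rk k) + 2 * Psi a b (sk k)) atTop (𝓝 0) := by
      convert pd using 2; ring
    rw [← hr, zero_smul, add_zero] at t1
    rw [← hr, zero_smul, sub_zero] at t2
    obtain ⟨k, ⟨b1, b2⟩, b3⟩ := (((t1.eventually (Metric.ball_mem_nhds _ hε)).and
      (t2.eventually (Metric.ball_mem_nhds _ hε))).and
      (pd'.eventually (gt_mem_nhds hδ))).exists
    have := quad_ineq F H (fun ξ hξ => hball hξ) (hA' k).2.1 (hA' k).2.2.1 b1 b2 (hA' k).2.2.2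
    have := hF' k
    linarith
  rcases eq_or_lt_of_le hsr with hs | hs
  · -- inner points converge to outer points
    have hpsr : Psi a b s = Psi a b r := by
      rcases abs_choice s with h | h
      · rw [← hs, h]
      · rw [← hs, h, Psi_even]
    have pd' : Tendsto (fun k => - 2 * Psi a b (rk k) + 2 * Psi a b (sk k)) atTop (𝓝 0) := by
      convert pd using 2; rw [hpsr]; ring
    have hska : Tendsto (fun k => |sk k|) atTop (𝓝 r) := by rw [← hs]; exact hsk.abs
    have g1 := endpoint F H hr he hm hek hrk hska (fun k => abs_nonneg _)
      (fun k => (hA' k).2.2.2) (fun k => (hA' k).2.1) (fun k => (hA' k).2.2.1)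
      (η := δ / 4) (by positivity)
    have g2 := endpoint F H (e := -e) (ek := fun k => - ek k) hr (by simpa using he) hm hek.neg
      hrk hska (fun k => abs_nonneg _)
      (fun k => (hA' k).2.2.2)
      (fun k => by rw [smul_neg, ← sub_eq_add_neg]; exact (hA' k).2.2.1)
      (fun k => by rw [smul_neg, sub_neg_eq_add]; exact (hA' k).2.1)
      (η := δ / 4) (by positivity)
    obtain ⟨k, ⟨b1, b2⟩, b3⟩ := ((g1.and g2).and
      (pd'.eventually (gt_mem_nhds (by positivity : 0 < δ / 4)))).exists
    simp only [smul_neg, ← sub_eq_add_neg] at b2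
    have h1 := hF' k
    have hsym : lg φ (mk k + |sk k| • ek k) + lg φ (mk k - |sk k| • ek k) =
        lg φ (mk k + sk k • ek k) + lg φ (mk k - sk k • ek k) := by
      rcases abs_choice (sk k) with h | h
      · rw [h]
      · rw [h, neg_smul, sub_neg_eq_add, ← sub_eq_add_neg, add_comm]
    linarith
  · -- inner points stay inside
    have i3 : m + s • e ∈ Ω := H.seg' he c1 c2 hs
    have i4 : m - s • e ∈ Ω := by
      have := H.seg' he c1 c2 (s := -s) (by rwa [abs_neg])
      rwa [neg_smul, ← sub_eq_add_neg] at this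
    have fc : ∀ {xk : ℕ → Rn n} {x : Rn n}, (∀ k, xk k ∈ Ω) → x ∈ closure Ω →
        Tendsto xk atTop (𝓝 x) → Tendsto (fun k => φ (xk k)) atTop (𝓝 (φ x)) := by
      intro xk x h1 h2 h3
      exact (F.sm.continuousOn x h2).tendsto.comp (tendsto_nhdsWithin_iff.mpr
        ⟨h3, Eventually.of_forall fun k => subset_closure (h1 k)⟩)
    have m3 : ∀ k, mk k + sk k • ek k ∈ Ω := fun k =>
      line_mem H (hA' k).2.1 (hA' k).2.2.1 (hA' k).2.2.2
    have m4 : ∀ k, mk k - sk k • ek k ∈ Ω := fun k => by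
      have := line_mem H (hA' k).2.1 (hA' k).2.2.1 (t := - sk k)
        (by rw [abs_neg]; exact (hA' k).2.2.2)
      rwa [neg_smul, ← sub_eq_add_neg] at this
    have L1 := (fc (fun k => (hA' k).2.1) c1 t1).mul (fc (fun k => (hA' k).2.2.1) c2 t2)
    have L2 := ((fc m3 (subset_closure i3) t3).mul (fc m4 (subset_closure i4) t4)).mul
      ((Real.continuous_exp.tendsto _).comp pd.neg)
    have hle := le_of_tendsto_of_tendsto' L2 L1 (by
      intro k
      have q1 := F.pos _ (hA' k).2.1
      have q2 := F.pos _ (hA' k).2.2.1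
      have q3 := F.pos _ (m3 k)
      have q4 := F.pos _ (m4 k)
      have hk := hF' k
      unfold lg at hk
      rw [← Real.log_le_log_iff (by simp only [Function.comp]; positivity) (by positivity)]
      simp only [Function.comp]
      rw [Real.log_mul (by positivity) (by positivity), Real.log_mul q3.ne' q4.ne',
        Real.log_mul q1.ne' q2.ne', Real.log_exp]
      linarith)
    have hz0 : φ (m + r • e) * φ (m - r • e) = 0 := by
      rcases hout with h | h
      · rw [F.bdv _ h, zero_mul]
      · rw [F.bdv _ h, mul_zero]
    rw [hz0] at hle
    have := mul_pos (mul_pos (F.pos _ i3) (F.pos _ i4))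
      (Real.exp_pos (-(-2 * Psi a b r + 2 * Psi a b s)))
    linarith

end

section
variable {n : ℕ} {Ω : Set (Rn n)} {ρ φ : Rn n → ℝ}

lemma fderiv_inner_gradient (f : Rn n → ℝ) (x v : Rn n) :
    fderiv ℝ f x v = ⟪gradient f x, v⟫ := by
  unfold gradient
  rw [InnerProductSpace.toDual_symm_apply]

lemma sum_sq_gradient (f : Rn n → ℝ) (x : Rn n) :
    ∑ i, (fderiv ℝ f x (EuclideanSpace.single i 1)) ^ 2 = ‖gradient f x‖ ^ 2 := by
  rw [EuclideanSpace.norm_sq_eq]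
  refine Finset.sum_congr rfl fun i _ => ?_
  rw [fderiv_inner_gradient, EuclideanSpace.inner_single_right]
  simp

lemma lg_pde (F : Phi Ω ρ φ) (H : Dom Ω ρ) {q : Rn n → ℝ} {lam : ℝ}
    (heig : ∀ x ∈ Ω, lap φ x - q x * φ x = -lam * φ x) {x : Rn n} (hx : x ∈ Ω) :
    ∑ i, fderiv ℝ (fderiv ℝ (lg φ)) x (EuclideanSpace.single i 1) (EuclideanSpace.single i 1) =
      q x - lam - ‖gradient (lg φ) x‖ ^ 2 := by
  have hp := F.pos x hx
  have hl := fun v => log_derivs (cdat H F.sm hx) hp v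
  have h1 : ∑ i, fderiv ℝ (fderiv ℝ (lg φ)) x (EuclideanSpace.single i 1)
      (EuclideanSpace.single i 1) = lap φ x / φ x - ‖gradient (lg φ) x‖ ^ 2 := by
    rw [lap_eq (cdat H F.sm hx), ← sum_sq_gradient, Finset.sum_div, ← Finset.sum_sub_distrib]
    refine Finset.sum_congr rfl fun i _ => ?_
    unfold lg
    rw [(hl _).2.2, (hl _).2.1]
  have h2 : lap φ x = (q x - lam) * φ x := by linarith [heig x hx]
  rw [h1, h2, mul_div_cancel_right₀ _ hp.ne']

lemma An_pts (H : Dom Ω ρ) {D : ℝ} (hD : ∀ x ∈ closure Ω, ∀ y ∈ closure Ω, dist x y ≤ D)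
    {m e : Rn n} {r s : ℝ} (hz : (m, e, r, s) ∈ An Ω) :
    ‖e‖ = 1 ∧ m + r • e ∈ Ω ∧ m - r • e ∈ Ω ∧ m + s • e ∈ Ω ∧ m - s • e ∈ Ω ∧ |s| ≤ r ∧ 0 ≤ r ∧
      r ≤ D / 2 := by
  obtain ⟨he, h1, h2, hs⟩ := hz
  simp only at he h1 h2 hs
  have hr0 : 0 ≤ r := (abs_nonneg s).trans hs
  refine ⟨he, h1, h2, line_mem H h1 h2 hs, ?_, hs, hr0, ?_⟩
  · have := line_mem H h1 h2 (t := -s) (by rwa [abs_neg])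
    rwa [neg_smul, ← sub_eq_add_neg] at this
  · have := hD _ (subset_closure h1) _ (subset_closure h2)
    have h3 : m + r • e - (m - r • e) = (2 * r) • e := by module
    rw [dist_eq_norm, h3, norm_smul, he, mul_one, Real.norm_of_nonneg (by linarith)] at this
    linarith

lemma Fn_cont (F : Phi Ω ρ φ) (H : Dom Ω ρ) {a b D : ℝ} (ha : 0 < a) (haD : a * D < Real.pi)
    (hD : ∀ x ∈ closure Ω, ∀ y ∈ closure Ω, dist x y ≤ D)
    {z : Rn n × Rn n × ℝ × ℝ} (hz : z ∈ An Ω) : ContinuousAt (Fn φ a b) z := by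
  obtain ⟨m, e, r, s⟩ := z
  obtain ⟨he, h1, h2, h3, h4, hs, hr0, hrD⟩ := An_pts H hD hz
  have k : ∀ {g : Rn n × Rn n × ℝ × ℝ → Rn n}, Continuous g → g (m, e, r, s) ∈ Ω →
      ContinuousAt (fun z => lg φ (g z)) (m, e, r, s) := fun hg hm =>
    (lg_smooth F H hm).continuousAt.comp_of_eq hg.continuousAt rfl
  have l : ∀ {g : Rn n × Rn n × ℝ × ℝ → ℝ}, Continuous g → |g (m, e, r, s)| ≤ D / 2 →
      ContinuousAt (fun z => Psi a b (g z)) (m, e, r, s) := fun hg hm =>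
    (Psi_deriv (cos_pos_of ha haD hm)).continuousAt.comp_of_eq hg.continuousAt rfl
  unfold Fn
  have l1 := l (g := fun z => z.2.2.1) (by fun_prop) (by simpa [abs_of_nonneg hr0] using hrD)
  have l2 := l (g := fun z => z.2.2.2) (by fun_prop) (by simpa using hs.trans hrD)
  exact (((((k (by fun_prop) h1).add (k (by fun_prop) h2)).sub (k (by fun_prop) h3)).sub
    (k (by fun_prop) h4)).sub (l1.const_mul 2)).add (l2.const_mul 2)

lemma Fn_max (F : Phi Ω ρ φ) (H : Dom Ω ρ) {a b D : ℝ} (ha : 0 < a) (haD : a * D < Real.pi)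
    (hD : ∀ x ∈ closure Ω, ∀ y ∈ closure Ω, dist x y ≤ D)
    {z₀ : Rn n × Rn n × ℝ × ℝ} (hz₀ : z₀ ∈ An Ω) (hF₀ : 0 < Fn φ a b z₀) :
    ∃ z ∈ An Ω, 0 < Fn φ a b z ∧ ∀ z' ∈ An Ω, Fn φ a b z' ≤ Fn φ a b z := by
  set δ := Fn φ a b z₀ with hδ
  let S := {z | z ∈ An Ω ∧ δ ≤ Fn φ a b z}
  have hcl : IsClosed S := by
    apply IsSeqClosed.isClosed
    intro zk z hk hz
    have hzA := An_limit F H ha haD hD hF₀ hz (fun k => (hk k).1) (fun k => (hk k).2)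
    exact ⟨hzA, ge_of_tendsto' ((Fn_cont F H ha haD hD hzA).tendsto.comp hz) fun k => (hk k).2⟩
  have hbd : Bornology.IsBounded S := by
    refine (H.bd.prod ((Metric.isBounded_closedBall (x := (0 : Rn n)) (r := 1)).prod
      ((Metric.isBounded_Icc (0:ℝ) (D/2)).prod (Metric.isBounded_Icc (-(D/2)) (D/2))))).subset ?_
    rintro ⟨m, e, r, s⟩ hz
    obtain ⟨he, h1, h2, h3, h4, hs, hr0, hrD⟩ := An_pts H hD hz.1
    have hm : m ∈ Ω := by simpa using line_mem H h1 h2 (t := 0) (by simpa using hr0)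
    have hs' := abs_le.mp (hs.trans hrD)
    refine ⟨hm, ?_, ⟨hr0, hrD⟩, hs'⟩
    simp [he]
  have hco : IsCompact S := Metric.isCompact_of_isClosed_isBounded hcl hbd
  obtain ⟨z, hz, hmax⟩ := hco.exists_isMaxOn ⟨z₀, hz₀, le_refl _⟩
    (fun z hz => (Fn_cont F H ha haD hD (b := b) hz.1).continuousWithinAt)
  refine ⟨z, hz.1, hF₀.trans_le hz.2, fun z' hz' => ?_⟩
  by_cases h : δ ≤ Fn φ a b z'
  · exact hmax ⟨hz', h⟩
  · push Not at h
    exact h.le.trans hz.2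

end

section
variable {n : ℕ} {Ω : Set (Rn n)} {ρ φ : Rn n → ℝ}

lemma ev_mem (H : Dom Ω ρ) {g : ℝ → Rn n} {t₀ : ℝ} (hg : ContinuousAt g t₀) (h : g t₀ ∈ Ω) :
    ∀ᶠ t in 𝓝 t₀, g t ∈ Ω := hg.eventually (H.op.mem_nhds h)

lemma var_local (H : Dom Ω ρ) {a b : ℝ} {z : Rn n × Rn n × ℝ × ℝ}
    (hmax : ∀ z' ∈ An Ω, Fn φ a b z' ≤ Fn φ a b z) {c : ℝ → Rn n × Rn n × ℝ × ℝ}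
    (hc0 : c 0 = z) (hc : ContinuousAt c 0)
    (hz : z ∈ An Ω) (hsr : |z.2.2.2| < z.2.2.1) (h1 : ∀ t, ‖(c t).2.1‖ = 1) :
    IsLocalMax (fun t => Fn φ a b (c t)) 0 := by
  subst hc0
  have e1 : ∀ᶠ t in 𝓝 (0:ℝ), (c t).1 + (c t).2.2.1 • (c t).2.1 ∈ Ω :=
    ev_mem H (hc.fst.add (hc.snd.snd.fst.smul hc.snd.fst)) hz.2.1
  have e2 : ∀ᶠ t in 𝓝 (0:ℝ), (c t).1 - (c t).2.2.1 • (c t).2.1 ∈ Ω :=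
    ev_mem H (hc.fst.sub (hc.snd.snd.fst.smul hc.snd.fst)) hz.2.2.1
  have e3 : ∀ᶠ t in 𝓝 (0:ℝ), |(c t).2.2.2| < (c t).2.2.1 :=
    hc.snd.snd.snd.abs.eventually_lt hc.snd.snd.fst hsr
  filter_upwards [e1, e2, e3] with t a1 a2 a3
  exact hmax _ ⟨h1 t, a1, a2, a3.le⟩

lemma comp_fderiv {f : Rn n → ℝ} {g : ℝ → Rn n} {x g' : Rn n} {t : ℝ}
    (hf : ContDiffAt ℝ 2 f x) (hg : HasDerivAt g g' t) (hx : g t = x) :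
    HasDerivAt (fun t => f (g t)) (fderiv ℝ f x g') t := by
  subst hx
  exact (hf.differentiableAt (by norm_num)).hasFDerivAt.comp_hasDerivAt t hg

set_option maxHeartbeats 1000000 in
lemma Fn_no_max (F : Phi Ω ρ φ) (H : Dom Ω ρ) {a b D : ℝ} (ha : 0 < a) (haD : a * D < Real.pi)
    (hb : 0 < b) (hb1 : b < 1) {q : Rn n → ℝ} {lam : ℝ} (hq : ConvexOn ℝ (closure Ω) q)
    (heig : ∀ x ∈ Ω, lap φ x - q x * φ x = -lam * φ x)
    (hD : ∀ x ∈ closure Ω, ∀ y ∈ closure Ω, dist x y ≤ D)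
    {z : Rn n × Rn n × ℝ × ℝ} (hz : z ∈ An Ω)
    (hmax : ∀ z' ∈ An Ω, Fn φ a b z' ≤ Fn φ a b z) (hsr : |z.2.2.2| < z.2.2.1) : False := by
  obtain ⟨m, e, r, s⟩ := z
  simp only at hsr
  obtain ⟨he, h1, h2, h3, h4, hs, hr0, hrD⟩ := An_pts H hD hz
  have u1 := lg_smooth F H h1
  have u2 := lg_smooth F H h2
  have u3 := lg_smooth F H h3
  have u4 := lg_smooth F H h4
  have cr : 0 < Real.cos (a * r) := cos_pos_of ha haD (by rwa [abs_of_nonneg hr0])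
  have cs : 0 < Real.cos (a * s) := cos_pos_of ha haD (hs.trans hrD)
  set x1 := m + r • e with hx1
  set x2 := m - r • e with hx2
  set x3 := m + s • e with hx3
  set x4 := m - s • e with hx4
  set u := lg φ with hu
  set Q : Rn n →L[ℝ] Rn n →L[ℝ] ℝ := fderiv ℝ (fderiv ℝ u) x1 + fderiv ℝ (fderiv ℝ u) x2
    - fderiv ℝ (fderiv ℝ u) x3 - fderiv ℝ (fderiv ℝ u) x4 with hQ
  -- translation
  have V1 : ∀ v : Rn n, fderiv ℝ u x1 v + fderiv ℝ u x2 v - fderiv ℝ u x3 v - fderiv ℝ u x4 v = 0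
      ∧ Q v v ≤ 0 := by
    intro v
    have hl := var_local H hmax (c := fun t => (m + t • v, e, r, s)) (by simp)
      (Continuous.continuousAt (by fun_prop)) hz hsr (fun t => he)
    obtain ⟨a1, b1⟩ := line_derivs v u1
    obtain ⟨a2, b2⟩ := line_derivs v u2
    obtain ⟨a3, b3⟩ := line_derivs v u3
    obtain ⟨a4, b4⟩ := line_derivs v u4
    have hfun : (fun t : ℝ => Fn φ a b (m + t • v, e, r, s)) = fun t =>
        u (x1 + t • v) + u (x2 + t • v) - u (x3 + t • v) - u (x4 + t • v)
          - 2 * Psi a b r + 2 * Psi a b s := by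
      funext t
      have j1 : x1 + t • v = m + t • v + r • e := by rw [hx1]; module
      have j2 : x2 + t • v = m + t • v - r • e := by rw [hx2]; module
      have j3 : x3 + t • v = m + t • v + s • e := by rw [hx3]; module
      have j4 : x4 + t • v = m + t • v - s • e := by rw [hx4]; module
      simp only [Fn, ← hu]
      rw [j1, j2, j3, j4]
    rw [hfun] at hl
    have := second_order_max (h1 := fun t : ℝ => fderiv ℝ u (x1 + t • v) v +
      fderiv ℝ u (x2 + t • v) v - fderiv ℝ u (x3 + t • v) v - fderiv ℝ u (x4 + t • v) v)
      (by
        filter_upwards [a1, a2, a3, a4] with t c1 c2 c3 c4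
        exact ((((c1.add c2).sub c3).sub c4).sub_const _).add_const _)
      (((b1.add b2).sub b3).sub b4) hl
    simpa [hQ] using this
  -- translation of the parameters
  have V2 : Q e e ≤ 2 * (-(a ^ 2 * b * (1 + Real.tan (a * r) ^ 2)))
      - 2 * (-(a ^ 2 * b * (1 + Real.tan (a * s) ^ 2))) := by
    have hl := var_local H hmax (c := fun t => (m, e, r + t, s + t)) (by simp)
      (Continuous.continuousAt (by fun_prop)) hz hsr (fun t => he)
    obtain ⟨a1, b1⟩ := line_derivs e u1
    obtain ⟨a2, b2⟩ := line_derivs (-e) u2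
    obtain ⟨a3, b3⟩ := line_derivs e u3
    obtain ⟨a4, b4⟩ := line_derivs (-e) u4
    have hfun : (fun t : ℝ => Fn φ a b (m, e, r + t, s + t)) = fun t =>
        u (x1 + t • e) + u (x2 + t • -e) - u (x3 + t • e) - u (x4 + t • -e)
          - 2 * Psi a b (r + t) + 2 * Psi a b (s + t) := by
      funext t
      have j1 : x1 + t • e = m + (r + t) • e := by rw [hx1]; module
      have j2 : x2 + t • -e = m - (r + t) • e := by rw [hx2]; module
      have j3 : x3 + t • e = m + (s + t) • e := by rw [hx3]; module
      have j4 : x4 + t • -e = m - (s + t) • e := by rw [hx4]; module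
      simp only [Fn, ← hu]
      rw [j1, j2, j3, j4]
    rw [hfun] at hl
    have hpos : ∀ c : ℝ, 0 < Real.cos (a * c) → ∀ᶠ t in 𝓝 (0:ℝ), 0 < Real.cos (a * (c + t)) := by
      intro c hc
      have : ContinuousAt (fun t : ℝ => Real.cos (a * (c + t))) 0 :=
        Continuous.continuousAt (by fun_prop)
      exact this.eventually (lt_mem_nhds (by simpa using hc))
    have hP : ∀ c t : ℝ, 0 < Real.cos (a * (c + t)) → HasDerivAt (fun t => Psi a b (c + t))
        (-(a * b * Real.tan (a * (c + t)))) t := fun c t h => (Psi_deriv h).comp_const_add c t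
    have hP2 : ∀ c : ℝ, 0 < Real.cos (a * c) → HasDerivAt
        (fun t => -(a * b * Real.tan (a * (c + t))))
        (-(a ^ 2 * b * (1 + Real.tan (a * c) ^ 2))) 0 := by
      intro c h
      have := (Psi_deriv2 (a := a) (b := b) (s := c + 0) (by simpa using h)).comp_const_add c 0
      simpa using this
    have := second_order_max (h1 := fun t : ℝ => fderiv ℝ u (x1 + t • e) e +
      fderiv ℝ u (x2 + t • -e) (-e) - fderiv ℝ u (x3 + t • e) e - fderiv ℝ u (x4 + t • -e) (-e)
      - 2 * (-(a * b * Real.tan (a * (r + t)))) + 2 * (-(a * b * Real.tan (a * (s + t)))))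
      (by
        filter_upwards [a1, a2, a3, a4, hpos r cr, hpos s cs] with t c1 c2 c3 c4 c5 c6
        exact ((((c1.add c2).sub c3).sub c4).sub ((hP r t c5).const_mul 2)).add
          ((hP s t c6).const_mul 2))
      ((((((b1.add b2).sub b3).sub b4).sub ((hP2 r cr).const_mul 2)).add
          ((hP2 s cs).const_mul 2))) hl
    have h2 := this.2
    simp only [map_neg, neg_apply, neg_neg] at h2
    simp only [hQ, add_apply, sub_apply]
    linarith
  have dre : ∀ c : ℝ, HasDerivAt (fun t : ℝ => m + t • e) e c := fun c => by
    simpa using ((hasDerivAt_id c).smul_const e).const_add m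
  have dre' : ∀ c : ℝ, HasDerivAt (fun t : ℝ => m - t • e) (-e) c := fun c => by
    simpa using ((hasDerivAt_id c).smul_const e).const_sub m
  have V3 : fderiv ℝ u x1 e - fderiv ℝ u x2 e = 2 * (-(a * b * Real.tan (a * r))) := by
    have hl := var_local H hmax (c := fun t => (m, e, r + t, s)) (by simp)
      (Continuous.continuousAt (by fun_prop)) hz hsr (fun t => he)
    have k1 := (comp_fderiv (t := 0) u1 ((dre (r + 0)).comp_const_add r 0) (by simp [hx1]))
    have k2 := (comp_fderiv (t := 0) u2 ((dre' (r + 0)).comp_const_add r 0) (by simp [hx2]))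
    have k3 := (Psi_deriv (a := a) (b := b) (s := r + 0) (by simpa using cr)).comp_const_add r 0
    have := hl.hasDerivAt_eq_zero ((((((k1.add k2).sub_const (u x3)).sub_const (u x4)).sub
      (k3.const_mul 2))).add_const (2 * Psi a b s))
    simp only [map_neg, add_zero] at this
    linarith
  have V4 : fderiv ℝ u x3 e - fderiv ℝ u x4 e = 2 * (-(a * b * Real.tan (a * s))) := by
    have hl := var_local H hmax (c := fun t => (m, e, r, s + t)) (by simp)
      (Continuous.continuousAt (by fun_prop)) hz hsr (fun t => he)
    have k1 := (comp_fderiv (t := 0) u3 ((dre (s + 0)).comp_const_add s 0) (by simp [hx3]))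
    have k2 := (comp_fderiv (t := 0) u4 ((dre' (s + 0)).comp_const_add s 0) (by simp [hx4]))
    have k3 := (Psi_deriv (a := a) (b := b) (s := s + 0) (by simpa using cs)).comp_const_add s 0
    have := hl.hasDerivAt_eq_zero ((((k1.const_sub (u x1 + u x2)).sub k2).sub_const
      (2 * Psi a b r)).add (k3.const_mul 2))
    simp only [map_neg, add_zero] at this
    linarith
  have V5 : ∀ v : Rn n, ‖v‖ = 1 → ⟪e, v⟫ = 0 →
      r * (fderiv ℝ u x1 v - fderiv ℝ u x2 v) = s * (fderiv ℝ u x3 v - fderiv ℝ u x4 v) := by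
    intro v hv hev
    let c : ℝ → Rn n := fun t => Real.cos t • e + Real.sin t • v
    have hc0 : c 0 = e := by simp [c]
    have hcn : ∀ t, ‖c t‖ = 1 := by
      intro t
      have : ‖c t‖ ^ 2 = 1 := by
        simp only [c]
        rw [norm_add_sq_real, inner_smul_left, inner_smul_right, hev, norm_smul, norm_smul, he, hv]
        simp
      have h0 := norm_nonneg (c t)
      nlinarith
    have hcc : Continuous c := by simp only [c]; fun_prop
    have hcd : HasDerivAt c v 0 := by
      have : HasDerivAt c (-Real.sin 0 • e + Real.cos 0 • v) 0 :=
        ((Real.hasDerivAt_cos 0).smul_const e).add ((Real.hasDerivAt_sin 0).smul_const v)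
      simpa using this
    have hl := var_local H hmax (c := fun t => (m, c t, r, s)) (by simp [hc0])
      (Continuous.continuousAt (by fun_prop)) hz hsr hcn
    have k1 := (comp_fderiv (t := 0) u1 ((hcd.const_smul r).const_add m) (by simp [hx1, hc0]))
    have k2 := (comp_fderiv (t := 0) u2 ((hcd.const_smul r).const_sub m) (by simp [hx2, hc0]))
    have k3 := (comp_fderiv (t := 0) u3 ((hcd.const_smul s).const_add m) (by simp [hx3, hc0]))
    have k4 := (comp_fderiv (t := 0) u4 ((hcd.const_smul s).const_sub m) (by simp [hx4, hc0]))
    have := hl.hasDerivAt_eq_zero (((((k1.add k2).sub k3).sub k4).sub_const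
      (2 * Psi a b r)).add_const (2 * Psi a b s))
    simp only [map_neg, map_smul, smul_eq_mul] at this
    linarith
  have T := trace_le Q (fun v => (V1 v).2) he
  -- the equation
  have hT : ∑ i, Q (EuclideanSpace.single i 1) (EuclideanSpace.single i 1) =
      (q x1 + q x2 - q x3 - q x4) - (‖gradient u x1‖ ^ 2 + ‖gradient u x2‖ ^ 2
        - ‖gradient u x3‖ ^ 2 - ‖gradient u x4‖ ^ 2) := by
    simp only [hQ, add_apply, sub_apply,
      Finset.sum_add_distrib, Finset.sum_sub_distrib]
    rw [lg_pde F H heig h1, lg_pde F H heig h2, lg_pde F H heig h3, lg_pde F H heig h4]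
    ring
  have hr : 0 < r := (abs_nonneg s).trans_lt hsr
  have hqc : q x3 + q x4 ≤ q x1 + q x2 := by
    have hs' := abs_le.mp hs
    have e1 : (r + s) / (2 * r) + (r - s) / (2 * r) = 1 := by field_simp; ring
    have e1' : (r - s) / (2 * r) + (r + s) / (2 * r) = 1 := by field_simp; ring
    have e2 : ((r + s) / (2 * r)) * r - ((r - s) / (2 * r)) * r = s := by field_simp; ring
    have n1 : 0 ≤ (r + s) / (2 * r) := by apply div_nonneg <;> linarith
    have n2 : 0 ≤ (r - s) / (2 * r) := by apply div_nonneg <;> linarith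
    have c1 := hq.2 (subset_closure h1) (subset_closure h2) n1 n2 e1
    have c2 := hq.2 (subset_closure h1) (subset_closure h2) n2 n1 e1'
    generalize (r + s) / (2 * r) = A at *
    generalize (r - s) / (2 * r) = B at *
    have p1 : A • x1 + B • x2 = x3 := by
      rw [hx1, hx2, hx3, ← e2]
      nth_rewrite 3 [← one_smul ℝ m]
      rw [← e1]
      module
    have p2 : B • x1 + A • x2 = x4 := by
      rw [hx1, hx2, hx4, ← e2]
      nth_rewrite 3 [← one_smul ℝ m]
      rw [← e1]
      module
    rw [p1] at c1
    rw [p2] at c2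
    simp only [smul_eq_mul] at c1 c2
    have : B = 1 - A := by linarith
    rw [this] at c1 c2
    linarith
  -- gradients
  simp only [fderiv_inner_gradient] at V1 V3 V4 V5
  set g1 := gradient u x1
  set g2 := gradient u x2
  set g3 := gradient u x3
  set g4 := gradient u x4
  have hsum : g1 + g2 = g3 + g4 := by
    refine ext_inner_right ℝ fun v => ?_
    rw [inner_add_left, inner_add_left]
    linarith [(V1 v).1]
  have hee : ⟪e, e⟫ = 1 := by rw [real_inner_self_eq_norm_sq, he]; norm_num
  set P := ⟪g1 - g2, e⟫ with hP
  set P' := ⟪g3 - g4, e⟫ with hP'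
  have orth : ∀ B : Rn n, ‖B‖ ^ 2 = ⟪B, e⟫ ^ 2 + ‖B - ⟪B, e⟫ • e‖ ^ 2 := by
    intro B
    rw [norm_sub_sq_real, inner_smul_right, norm_smul, he, mul_one, Real.norm_eq_abs, sq_abs]
    ring
  have orth2 : ∀ B : Rn n, ⟪B - ⟪B, e⟫ • e, e⟫ = 0 := by
    intro B
    rw [inner_sub_left, inner_smul_left, hee]; simp
  have hperp : r • ((g1 - g2) - P • e) = s • ((g3 - g4) - P' • e) := by
    rw [← sub_eq_zero]
    set W := r • ((g1 - g2) - P • e) - s • ((g3 - g4) - P' • e) with hW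
    have hWe : ⟪e, W⟫ = 0 := by
      rw [real_inner_comm, hW, inner_sub_left, inner_smul_left, inner_smul_left, orth2, orth2]
      simp
    by_contra hW0
    have hWn : 0 < ‖W‖ := norm_pos_iff.mpr hW0
    have := V5 (‖W‖⁻¹ • W) (by rw [norm_smul, norm_inv, norm_norm]; field_simp)
      (by rw [inner_smul_right, hWe, mul_zero])
    simp only [inner_smul_right] at this
    have h5 : r * (⟪g1, W⟫ - ⟪g2, W⟫) = s * (⟪g3, W⟫ - ⟪g4, W⟫) := by
      have hi : ‖W‖⁻¹ ≠ 0 := by positivity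
      apply mul_left_cancel₀ hi
      linarith
    have h6 : ⟪W, W⟫ = 0 := by
      nth_rewrite 1 [hW]
      simp only [inner_sub_left, inner_smul_left, hWe]
      simp
      linarith
    exact hW0 (inner_self_eq_zero.mp h6)
  have hperp2 : ‖(g1 - g2) - P • e‖ ^ 2 ≤ ‖(g3 - g4) - P' • e‖ ^ 2 := by
    have := congrArg norm hperp
    rw [norm_smul, norm_smul, Real.norm_of_nonneg hr0, Real.norm_eq_abs] at this
    have hle : r * ‖(g1 - g2) - P • e‖ ≤ r * ‖(g3 - g4) - P' • e‖ := by
      rw [this]; gcongr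
    have := le_of_mul_le_mul_left hle hr
    gcongr
  have o1 := orth (g1 - g2)
  have o2 := orth (g3 - g4)
  rw [← hP] at o1
  rw [← hP'] at o2
  have par1 := parallelogram_law_with_norm ℝ g1 g2
  have par2 := parallelogram_law_with_norm ℝ g3 g4
  rw [hsum] at par1
  have hPv : P = 2 * (-(a * b * Real.tan (a * r))) := by rw [hP, inner_sub_left]; exact V3
  have hPv' : P' = 2 * (-(a * b * Real.tan (a * s))) := by rw [hP', inner_sub_left]; exact V4
  have hfin : (‖g1‖ ^ 2 + ‖g2‖ ^ 2 - ‖g3‖ ^ 2 - ‖g4‖ ^ 2) ≤ (P ^ 2 - P' ^ 2) / 2 := by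
    linarith
  rw [hPv, hPv'] at hfin
  have hkey : a ^ 2 * b * (1 - b) * (Real.tan (a * r) ^ 2) ≤
      a ^ 2 * b * (1 - b) * (Real.tan (a * s) ^ 2) := by
    linarith
  have hpos : 0 < a ^ 2 * b * (1 - b) := by
    have : 0 < 1 - b := by linarith
    positivity
  have hk2 := le_of_mul_le_mul_left hkey hpos
  have hlt : Real.tan (a * |s|) < Real.tan (a * r) := by
    apply Real.tan_lt_tan_of_lt_of_lt_pi_div_two
    · have := mul_nonneg ha.le (abs_nonneg s)
      linarith [Real.pi_pos]
    · nlinarith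
    · gcongr
  have hnn : 0 ≤ Real.tan (a * |s|) := by
    apply Real.tan_nonneg_of_nonneg_of_le_pi_div_two
    · positivity
    · nlinarith
  have hsq : Real.tan (a * |s|) ^ 2 = Real.tan (a * s) ^ 2 := by
    rcases abs_choice s with h | h
    · rw [h]
    · rw [h, mul_neg, Real.tan_neg, neg_sq]
  nlinarith

lemma Fn_nonpos (F : Phi Ω ρ φ) (H : Dom Ω ρ) {a b D : ℝ} (ha : 0 < a) (haD : a * D < Real.pi)
    (hb : 0 < b) (hb1 : b < 1) {q : Rn n → ℝ} {lam : ℝ} (hq : ConvexOn ℝ (closure Ω) q)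
    (heig : ∀ x ∈ Ω, lap φ x - q x * φ x = -lam * φ x)
    (hD : ∀ x ∈ closure Ω, ∀ y ∈ closure Ω, dist x y ≤ D)
    {z : Rn n × Rn n × ℝ × ℝ} (hz : z ∈ An Ω) : Fn φ a b z ≤ 0 := by
  by_contra hcon
  push Not at hcon
  obtain ⟨z, hz, hp, hmax⟩ := Fn_max F H ha haD hD hz hcon
  rcases eq_or_lt_of_le hz.2.2.2 with h | h
  · obtain ⟨m, e, r, s⟩ := z
    simp only at h
    have : Fn φ a b (m, e, r, s) = 0 := by
      simp only [Fn]
      rcases abs_choice s with h' | h'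
      · rw [← h, h']; ring
      · rw [← h, h', Psi_even, neg_smul, sub_neg_eq_add, ← sub_eq_add_neg]; ring
    linarith
  · exact Fn_no_max F H ha haD hb hb1 hq heig hD hz hmax h

end

section
variable {n : ℕ} {Ω : Set (Rn n)} {ρ φ : Rn n → ℝ}

lemma deriv_nonpos_left {k : ℝ → ℝ} {k' r : ℝ} (hr : 0 < r) (hk : HasDerivAt k k' r)
    (h : ∀ t, 0 < t → t < r → k r ≤ k t) : k' ≤ 0 := by
  have h1 := (hasDerivAt_iff_tendsto_slope.mp hk).mono_left
    (nhdsWithin_mono r (fun t (ht : t < r) => ht.ne) : 𝓝[<] r ≤ 𝓝[≠] r)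
  refine le_of_tendsto h1 ?_
  filter_upwards [self_mem_nhdsWithin, nhdsWithin_le_nhds (lt_mem_nhds hr)] with t ht ht0
  rw [slope_def_field]
  have ht' : t < r := ht
  exact div_nonpos_of_nonneg_of_nonpos (sub_nonneg.mpr (h t ht0 ht')) (by linarith)

lemma modulus (F : Phi Ω ρ φ) (H : Dom Ω ρ) {a b D : ℝ} (ha : 0 < a) (haD : a * D < Real.pi)
    (hb : 0 < b) (hb1 : b < 1) {q : Rn n → ℝ} {lam : ℝ} (hq : ConvexOn ℝ (closure Ω) q)
    (heig : ∀ x ∈ Ω, lap φ x - q x * φ x = -lam * φ x)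
    (hD : ∀ x ∈ closure Ω, ∀ y ∈ closure Ω, dist x y ≤ D)
    {m e : Rn n} {r : ℝ} (he : ‖e‖ = 1) (hr : 0 < r) (h1 : m + r • e ∈ Ω) (h2 : m - r • e ∈ Ω) :
    fderiv ℝ (lg φ) (m + r • e) e - fderiv ℝ (lg φ) (m - r • e) e
      ≤ -(2 * (a * b * Real.tan (a * r))) := by
  have hz : (m, e, r, r) ∈ An Ω := ⟨he, h1, h2, by simp [abs_of_pos hr]⟩
  have hrD := (An_pts H hD hz).2.2.2.2.2.2.2
  have cr : 0 < Real.cos (a * r) := cos_pos_of ha haD (by rwa [abs_of_pos hr])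
  have dre : HasDerivAt (fun t : ℝ => m + t • e) e r := by
    simpa using ((hasDerivAt_id r).smul_const e).const_add m
  have dre' : HasDerivAt (fun t : ℝ => m - t • e) (-e) r := by
    simpa using ((hasDerivAt_id r).smul_const e).const_sub m
  have hk := ((comp_fderiv (lg_smooth F H h1) dre rfl).add
    (comp_fderiv (lg_smooth F H h2) dre' rfl)).sub ((Psi_deriv (b := b) cr).const_mul 2)
  have := deriv_nonpos_left hr hk (by
    intro t ht0 ht
    have := Fn_nonpos F H ha haD hb hb1 hq heig hD (z := (m, e, r, t))
      ⟨he, h1, h2, by simp [abs_of_pos ht0, ht.le]⟩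
    simp only [Fn] at this
    simp only [Pi.add_apply, Pi.sub_apply]
    linarith)
  simp only [map_neg] at this
  linarith

lemma hess_le (F : Phi Ω ρ φ) (H : Dom Ω ρ) {a b D : ℝ} (ha : 0 < a) (haD : a * D < Real.pi)
    (hb : 0 < b) (hb1 : b < 1) {q : Rn n → ℝ} {lam : ℝ} (hq : ConvexOn ℝ (closure Ω) q)
    (heig : ∀ x ∈ Ω, lap φ x - q x * φ x = -lam * φ x)
    (hD : ∀ x ∈ closure Ω, ∀ y ∈ closure Ω, dist x y ≤ D)
    {m e : Rn n} (he : ‖e‖ = 1) (hm : m ∈ Ω) :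
    fderiv ℝ (fderiv ℝ (lg φ)) m e e ≤ -(a ^ 2 * b) := by
  obtain ⟨a1, b1⟩ := line_derivs e (lg_smooth F H hm)
  obtain ⟨a2, b2⟩ := line_derivs (-e) (lg_smooth F H hm)
  have c0 : 0 < Real.cos (a * 0) := by simp
  have hpos : ∀ᶠ t in 𝓝 (0:ℝ), 0 < Real.cos (a * t) := by
    have : ContinuousAt (fun t : ℝ => Real.cos (a * t)) 0 := Continuous.continuousAt (by fun_prop)
    exact this.eventually (lt_mem_nhds c0)
  have e1 : ∀ᶠ t : ℝ in 𝓝 0, m + |t| • e ∈ Ω :=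
    ev_mem H (Continuous.continuousAt (by fun_prop)) (by simpa using hm)
  have e2 : ∀ᶠ t : ℝ in 𝓝 0, m - |t| • e ∈ Ω :=
    ev_mem H (Continuous.continuousAt (by fun_prop)) (by simpa using hm)
  have hl : IsLocalMax (fun t : ℝ => lg φ (m + t • e) + lg φ (m + t • -e) - 2 * Psi a b t) 0 := by
    filter_upwards [e1, e2] with t h1 h2
    have := Fn_nonpos F H ha haD hb hb1 hq heig hD (z := (m, e, |t|, 0))
      ⟨he, h1, h2, by simp⟩
    simp only [Fn] at this
    have hs : lg φ (m + |t| • e) + lg φ (m - |t| • e) - 2 * Psi a b |t| =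
      lg φ (m + t • e) + lg φ (m + t • -e) - 2 * Psi a b t := by
      rcases abs_choice t with h | h
      · rw [h, smul_neg, ← sub_eq_add_neg]
      · rw [h, Psi_even, smul_neg, neg_smul, sub_neg_eq_add]; ring
    simp only [zero_smul, add_zero, sub_zero] at this ⊢
    linarith
  have := second_order_max (h1 := fun t : ℝ => fderiv ℝ (lg φ) (m + t • e) e +
      fderiv ℝ (lg φ) (m + t • -e) (-e) - 2 * (-(a * b * Real.tan (a * t))))
    (by
      filter_upwards [a1, a2, hpos] with t c1 c2 c3
      exact (c1.add c2).sub ((Psi_deriv c3).const_mul 2))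
    ((b1.add b2).sub ((Psi_deriv2 c0).const_mul 2)) hl
  have h2 := this.2
  simp only [map_neg, neg_apply, neg_neg, mul_zero, Real.tan_zero] at h2
  linarith

lemma lam0_bound (F : Phi Ω ρ φ) (H : Dom Ω ρ) {a b D : ℝ} (ha : 0 < a) (haD : a * D < Real.pi)
    (hb : 0 < b) (hb1 : b < 1) {q : Rn n → ℝ} {lam : ℝ} (hq : ConvexOn ℝ (closure Ω) q)
    (hqc : ContinuousOn q (closure Ω))
    (heig : ∀ x ∈ Ω, lap φ x - q x * φ x = -lam * φ x)
    (hD : ∀ x ∈ closure Ω, ∀ y ∈ closure Ω, dist x y ≤ D) :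
    sInf (q '' Ω) + n * a ^ 2 * b ≤ lam := by
  obtain ⟨x₁, hx₁⟩ := H.ne
  obtain ⟨x, hx, hmax⟩ := H.compact.exists_isMaxOn ⟨x₁, subset_closure hx₁⟩ F.sm.continuousOn
  have hxp : 0 < φ x := (F.pos x₁ hx₁).trans_le (hmax (subset_closure hx₁))
  have hxΩ : x ∈ Ω := by
    rcases Dom.cl_cases hx with h | h
    · exact h
    · have := F.bdv x h
      linarith
  have hlm : IsLocalMax φ x := by
    filter_upwards [H.nhds hxΩ] with y hy using hmax hy
  have hd0 : fderiv ℝ φ x = 0 := hlm.fderiv_eq_zero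
  have hg : gradient (lg φ) x = 0 := by
    refine ext_inner_right ℝ fun v => ?_
    rw [← fderiv_inner_gradient]
    have := (log_derivs (cdat H F.sm hxΩ) hxp v).2.1
    unfold lg
    rw [this, hd0]
    simp
  have hp := lg_pde F H heig hxΩ
  rw [hg] at hp
  have hsum : ∑ i, fderiv ℝ (fderiv ℝ (lg φ)) x (EuclideanSpace.single i 1)
      (EuclideanSpace.single i 1) ≤ ∑ i : Fin n, -(a ^ 2 * b) :=
    Finset.sum_le_sum fun i _ => hess_le F H ha haD hb hb1 hq heig hD (by simp) hxΩ
  rw [Finset.sum_const, Finset.card_univ, Fintype.card_fin, nsmul_eq_mul] at hsum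
  have hbdd : BddBelow (q '' Ω) :=
    (H.compact.bddBelow_image hqc).mono (image_mono subset_closure)
  have := csInf_le hbdd (mem_image_of_mem q hxΩ)
  simp only [norm_zero] at hp
  linarith

lemma mul_derivs {f g : Rn n → ℝ} {x : Rn n} (hf : ContDiffAt ℝ 2 f x) (hg : ContDiffAt ℝ 2 g x)
    (v : Rn n) : fderiv ℝ (fderiv ℝ (fun y => f y * g y)) x v v =
      fderiv ℝ (fderiv ℝ f) x v v * g x + 2 * (fderiv ℝ f x v * fderiv ℝ g x v)
        + f x * fderiv ℝ (fderiv ℝ g) x v v := by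
  obtain ⟨a1, b1⟩ := line_derivs v hf
  obtain ⟨a2, b2⟩ := line_derivs v hg
  obtain ⟨a3, b3⟩ := line_derivs v (hf.mul hg)
  have heq : (fun s : ℝ => fderiv ℝ (fun y => f y * g y) (x + s • v) v) =ᶠ[𝓝 0]
      fun s => fderiv ℝ f (x + s • v) v * g (x + s • v) +
        f (x + s • v) * fderiv ℝ g (x + s • v) v := by
    filter_upwards [a1, a2, a3] with s c1 c2 c3 using c3.unique (c1.mul c2)
  have k1 := a1.self_of_nhds
  have k2 := a2.self_of_nhds
  have := (((b1.mul k2).add (k1.mul b2)).congr_of_eventuallyEq heq).unique b3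
  simp only [zero_smul, add_zero] at this
  rw [← this]
  ring

lemma w_pde (F : Phi Ω ρ φ) (H : Dom Ω ρ) {q φ₁ w : Rn n → ℝ} {lam lam1 : ℝ}
    (heig : ∀ x ∈ Ω, lap φ x - q x * φ x = -lam * φ x)
    (heig1 : ∀ x ∈ Ω, lap φ₁ x - q x * φ₁ x = -lam1 * φ₁ x)
    (hφ₁ : ContDiffOn ℝ 2 φ₁ (closure Ω)) (hwC : ContDiffOn ℝ 2 w (closure Ω))
    (hw : ∀ x ∈ Ω, w x = φ₁ x / φ x) {x : Rn n} (hx : x ∈ Ω) :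
    ∑ i, fderiv ℝ (fderiv ℝ w) x (EuclideanSpace.single i 1) (EuclideanSpace.single i 1) =
      -(lam1 - lam) * w x - 2 * ⟪gradient w x, gradient (lg φ) x⟫ := by
  have hp := F.pos x hx
  have hev : φ₁ =ᶠ[𝓝 x] fun y => w y * φ y := by
    filter_upwards [H.op.mem_nhds hx] with y hy
    rw [hw y hy, div_mul_cancel₀ _ (F.pos y hy).ne']
  have h1 : lap φ₁ x = ∑ i, (fderiv ℝ (fderiv ℝ w) x (EuclideanSpace.single i 1)
      (EuclideanSpace.single i 1) * φ x + 2 * (fderiv ℝ w x (EuclideanSpace.single i 1) *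
        fderiv ℝ φ x (EuclideanSpace.single i 1))
        + w x * fderiv ℝ (fderiv ℝ φ) x (EuclideanSpace.single i 1)
          (EuclideanSpace.single i 1)) := by
    rw [lap_eq (cdat H hφ₁ hx)]
    refine Finset.sum_congr rfl fun i _ => ?_
    rw [hev.fderiv.fderiv_eq, mul_derivs (cdat H hwC hx) (cdat H F.sm hx)]
  rw [Finset.sum_add_distrib, Finset.sum_add_distrib, ← Finset.sum_mul, ← Finset.mul_sum,
    ← Finset.mul_sum, ← lap_eq (cdat H F.sm hx)] at h1
  have h2 : ∑ i, fderiv ℝ w x (EuclideanSpace.single i 1) *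
        fderiv ℝ φ x (EuclideanSpace.single i 1) =
        φ x * ⟪gradient w x, gradient (lg φ) x⟫ := by
    rw [real_inner_comm, PiLp.inner_apply, Finset.mul_sum]
    refine Finset.sum_congr rfl fun i _ => ?_
    have := (log_derivs (cdat H F.sm hx) hp (EuclideanSpace.single i 1)).2.1
    have h3 : fderiv ℝ φ x (EuclideanSpace.single i 1) = φ x * fderiv ℝ (lg φ) x
        (EuclideanSpace.single i 1) := by
      unfold lg; rw [this]; field_simp
    rw [h3, fderiv_inner_gradient, fderiv_inner_gradient, EuclideanSpace.inner_single_right,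
      EuclideanSpace.inner_single_right]
    simp
    ring
  have h3 := heig x hx
  have h4 := heig1 x hx
  rw [h2] at h1
  rw [h1, hev.self_of_nhds] at h4
  apply mul_right_cancel₀ hp.ne'
  linear_combination h4 - w x * h3

end

/-- The modulus used in the gap estimate. -/
noncomputable def fm (a α d : ℝ) : ℝ := Real.sin (a * (d / 2)) ^ α

/-- Derivative of the modulus. -/
noncomputable def fm1 (a α d : ℝ) : ℝ :=
  Real.cos (a * (d / 2)) * (a / 2) * α * Real.sin (a * (d / 2)) ^ (α - 1)

lemma fm_sin_deriv (a d : ℝ) : HasDerivAt (fun d => Real.sin (a * (d / 2)))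
    (Real.cos (a * (d / 2)) * (a / 2)) d := by
  have h1 : HasDerivAt (fun d => a * (d / 2)) (a / 2) d := by
    have := ((hasDerivAt_id d).div_const 2).const_mul a
    simp only [id] at this
    rwa [mul_one_div] at this
  exact h1.sin

lemma fm_deriv {a α d : ℝ} (hs : 0 < Real.sin (a * (d / 2))) :
    HasDerivAt (fm a α) (fm1 a α d) d :=
  (fm_sin_deriv a d).rpow_const (Or.inl hs.ne')

lemma fm_deriv2 {a α d : ℝ} (hs : 0 < Real.sin (a * (d / 2))) :
    HasDerivAt (fm1 a α) (-Real.sin (a * (d / 2)) * (a / 2) * (a / 2) * α *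
      Real.sin (a * (d / 2)) ^ (α - 1) + Real.cos (a * (d / 2)) * (a / 2) * α *
      (Real.cos (a * (d / 2)) * (a / 2) * (α - 1) * Real.sin (a * (d / 2)) ^ (α - 1 - 1))) d := by
  have h1 : HasDerivAt (fun d => a * (d / 2)) (a / 2) d := by
    have := ((hasDerivAt_id d).div_const 2).const_mul a
    simp only [id] at this
    rwa [mul_one_div] at this
  exact ((h1.cos.mul_const (a / 2)).mul_const α).mul
    ((fm_sin_deriv a d).rpow_const (p := α - 1) (Or.inl hs.ne'))

lemma fm_ineq {a b α d f2 : ℝ} (ha : 0 < a) (hα : 0 < α) (hα1 : α < 1)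
    (hs : 0 < Real.sin (a * (d / 2))) (hc : 0 < Real.cos (a * (d / 2)))
    (h2 : f2 = (-Real.sin (a * (d / 2)) * (a / 2) * (a / 2) * α *
      Real.sin (a * (d / 2)) ^ (α - 1) + Real.cos (a * (d / 2)) * (a / 2) * α *
      (Real.cos (a * (d / 2)) * (a / 2) * (α - 1) * Real.sin (a * (d / 2)) ^ (α - 1 - 1)))) :
    4 * f2 - 4 * fm1 a α d * (a * b * Real.tan (a * (d / 2))) ≤
      -(α * a ^ 2 * (1 + 2 * b)) * fm a α d := by
  unfold fm1 fm
  rw [h2, Real.rpow_sub_one hs.ne' (α - 1), Real.rpow_sub_one hs.ne' α, Real.tan_eq_sin_div_cos]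
  set s := Real.sin (a * (d / 2))
  set c := Real.cos (a * (d / 2))
  have hS : 0 < s ^ α := Real.rpow_pos_of_pos hs α
  set S := s ^ α
  have : 4 * (-s * (a / 2) * (a / 2) * α * (S / s) + c * (a / 2) * α *
      (c * (a / 2) * (α - 1) * (S / s / s))) - 4 * (c * (a / 2) * α * (S / s)) *
      (a * b * (s / c)) = -(α * a ^ 2 * (1 + 2 * b)) * S - a ^ 2 * α * (1 - α) * (c / s) ^ 2 * S := by
    field_simp
    ring
  rw [this]
  have h1 : 0 < 1 - α := by linarith
  have : 0 ≤ a ^ 2 * α * (1 - α) * (c / s) ^ 2 * S := by positivity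
  linarith

section
variable {n : ℕ} {Ω : Set (Rn n)} {ρ φ : Rn n → ℝ}

lemma norm_line_deriv {z d : Rn n} (hz : z ≠ 0) :
    HasDerivAt (fun t : ℝ => ‖z + t • d‖) (⟪z, d⟫ / ‖z‖) 0 := by
  have h1 : HasDerivAt (fun t : ℝ => z + t • d) d 0 := by
    simpa using ((hasDerivAt_id (0:ℝ)).smul_const d).const_add z
  have hzn : 0 < ‖z‖ := norm_pos_iff.mpr hz
  have h2 := h1.norm_sq.sqrt (by simpa using hzn.ne')
  simp only [Real.sqrt_sq (norm_nonneg _), zero_smul, add_zero] at h2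
  convert h2 using 1
  field_simp

lemma bd_excl (H : Dom Ω ρ) {w : Rn n → ℝ} {g : ℝ → ℝ} {g' C : ℝ} {x y : Rn n}
    (hwC : DifferentiableOn ℝ w (closure Ω))
    (hwν : ∀ x ∈ frontier Ω, fderivWithin ℝ w (closure Ω) x (gradient ρ x) = 0)
    (hx : x ∈ frontier Ω) (hy : y ∈ closure Ω) (hxy : x ≠ y)
    (hg : HasDerivAt g g' ‖x - y‖) (hg' : 0 < g') (hC : 0 < C)
    (hmax : ∀ z ∈ closure Ω, w z - C * g ‖z - y‖ ≤ w x - C * g ‖x - y‖) : False := by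
  have hs := H.support hx hy hxy.symm
  rw [fderiv_inner_gradient] at hs
  set N := gradient ρ x with hN
  have hN0 : N ≠ 0 := H.gr x hx
  have hd : fderiv ℝ ρ x (-N) < 0 := by
    rw [fderiv_inner_gradient, inner_neg_right, real_inner_self_eq_norm_sq]
    have : 0 < ‖N‖ := norm_pos_iff.mpr hN0
    rw [neg_lt_zero]
    positivity
  have hz : x - y ≠ 0 := sub_ne_zero.mpr hxy
  have hzn : 0 < ‖x - y‖ := norm_pos_iff.mpr hz
  have h1 := H.inward_deriv hx hd hwC
  rw [map_neg, hwν x hx, neg_zero] at h1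
  have h2 := norm_line_deriv (d := -N) hz
  have h3 : HasDerivAt (fun t : ℝ => g ‖x - y + t • -N‖) (g' * (⟪x - y, -N⟫ / ‖x - y‖)) 0 :=
    HasDerivAt.comp (h₂ := g) (0:ℝ) (by simpa using hg) h2
  have h4 := h1.sub (h3.const_mul C).hasDerivWithinAt
  have hneg : ⟪x - y, -N⟫ < 0 := by
    have : ⟪N, y - x⟫ = ⟪x - y, -N⟫ := by
      rw [inner_neg_right, real_inner_comm, ← inner_neg_left, neg_sub]
    linarith
  have hval : 0 < 0 - C * (g' * (⟪x - y, -N⟫ / ‖x - y‖)) := by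
    have : ⟪x - y, -N⟫ / ‖x - y‖ < 0 := div_neg_of_neg_of_pos hneg hzn
    have := mul_pos hC (mul_pos hg' (neg_pos.mpr this))
    linarith
  have h5 := (hasDerivWithinAt_iff_tendsto_slope' (by simp)).mp h4
  have h6 : 0 - C * (g' * (⟪x - y, -N⟫ / ‖x - y‖)) ≤ 0 := by
    refine le_of_tendsto h5 ?_
    filter_upwards [self_mem_nhdsWithin, H.inward hx hd] with t ht ht2
    have ht' : 0 < t := ht
    rw [slope_def_field]
    refine div_nonpos_of_nonpos_of_nonneg ?_ (by linarith)
    have := hmax _ (subset_closure ht2)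
    have e : x + t • -N - y = x - y + t • -N := by module
    rw [e] at this
    simp only [Pi.sub_apply, zero_smul, add_zero]
    linarith
  linarith

end

section
variable {n : ℕ} {Ω : Set (Rn n)} {ρ φ : Rn n → ℝ}

lemma sin_pos_of {a D d : ℝ} (ha : 0 < a) (haD : a * D < Real.pi) (hd : 0 < d) (hdD : d ≤ D) :
    0 < Real.sin (a * (d / 2)) := by
  apply Real.sin_pos_of_pos_of_lt_pi
  · positivity
  · nlinarith [Real.pi_pos]

lemma w_lip (H : Dom Ω ρ) {w : Rn n → ℝ} (hwC : ContDiffOn ℝ 2 w (closure Ω)) :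
    ∃ L : ℝ, 0 ≤ L ∧ ∀ x ∈ closure Ω, ∀ y ∈ closure Ω, |w x - w y| ≤ L * ‖x - y‖ := by
  obtain ⟨L, hL⟩ := H.compact.exists_bound_of_continuousOn (d1_cont H hwC)
  refine ⟨max L 0, le_max_right _ _, fun x hx y hy => ?_⟩
  have := H.cv.norm_image_sub_le_of_norm_fderivWithin_le (f := w) (C := max L 0)
    (hwC.differentiableOn (by norm_num)) (fun z hz => (hL z hz).trans (le_max_left _ _)) hy hx
  simpa using this

lemma ratio_bound {a D α d L A : ℝ} (ha : 0 < a) (haD : a * D < Real.pi) (hα : 0 < α)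
    (hL : 0 ≤ L) (hd : 0 ≤ d) (hdD : d ≤ D) (hA : |A| ≤ L * d) :
    |A / fm a α d| ≤ L * (Real.pi / a) ^ α * d ^ (1 - α) := by
  rcases eq_or_lt_of_le hd with h | h
  · subst h
    have : A = 0 := by simpa using hA
    rw [this]
    simp only [zero_div, abs_zero]
    positivity
  have hle : (a * d / Real.pi) ^ α ≤ fm a α d := by
    unfold fm
    refine Real.rpow_le_rpow (by positivity) ?_ hα.le
    have := Real.mul_le_sin (x := a * (d / 2)) (by positivity) (by nlinarith)
    refine le_trans (le_of_eq ?_) this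
    field_simp
  have hp : 0 < (a * d / Real.pi) ^ α := by positivity
  rw [abs_div, abs_of_pos (hp.trans_le hle)]
  calc |A| / fm a α d ≤ L * d / (a * d / Real.pi) ^ α := by gcongr
    _ = L * (Real.pi / a) ^ α * d ^ (1 - α) := by
      have e1 : a * d / Real.pi = d / (Real.pi / a) := by field_simp
      rw [e1, Real.div_rpow hd (by positivity), Real.rpow_sub h, Real.rpow_one]
      field_simp

lemma ratio_max (H : Dom Ω ρ) {a D α : ℝ} (ha : 0 < a) (haD : a * D < Real.pi) (hα : 0 < α)
    (hα1 : α < 1) (hD : ∀ x ∈ closure Ω, ∀ y ∈ closure Ω, dist x y ≤ D)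
    {w : Rn n → ℝ} (hwC : ContDiffOn ℝ 2 w (closure Ω))
    (hwnc : ¬ ∃ c : ℝ, ∀ x ∈ closure Ω, w x = c) :
    ∃ C : ℝ, 0 < C ∧ ∃ x ∈ closure Ω, ∃ y ∈ closure Ω, x ≠ y ∧ w x - w y = C * fm a α ‖x - y‖ ∧
      ∀ x' ∈ closure Ω, ∀ y' ∈ closure Ω, w x' - w y' ≤ C * fm a α ‖x' - y'‖ := by
  obtain ⟨L, hL0, hL⟩ := w_lip H hwC
  have hfpos : ∀ x ∈ closure Ω, ∀ y ∈ closure Ω, x ≠ y → 0 < fm a α ‖x - y‖ := by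
    intro x hx y hy hxy
    have h1 : 0 < ‖x - y‖ := norm_pos_iff.mpr (sub_ne_zero.mpr hxy)
    have h2 := hD x hx y hy
    rw [dist_eq_norm] at h2
    exact Real.rpow_pos_of_pos (sin_pos_of ha haD h1 h2) α
  let R : Rn n × Rn n → ℝ := fun z => (w z.1 - w z.2) / fm a α ‖z.1 - z.2‖
  have hwc := hwC.continuousOn
  have hcont : ContinuousOn R (closure Ω ×ˢ closure Ω) := by
    rintro ⟨x, y⟩ ⟨hx, hy⟩
    simp only at hx hy
    by_cases hxy : x = y
    · subst hxy
      have hR0 : R (x, x) = 0 := by simp [R]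
      rw [ContinuousWithinAt, hR0]
      have hB : Tendsto (fun z : Rn n × Rn n => L * (Real.pi / a) ^ α * ‖z.1 - z.2‖ ^ (1 - α))
          (𝓝[closure Ω ×ˢ closure Ω] (x, x)) (𝓝 0) := by
        have hc : ContinuousAt
            (fun z : Rn n × Rn n => L * (Real.pi / a) ^ α * ‖z.1 - z.2‖ ^ (1 - α)) (x, x) := by
          refine continuousAt_const.mul (ContinuousAt.rpow_const ?_ (Or.inr (by linarith)))
          exact Continuous.continuousAt (by fun_prop)
        have h0 : L * (Real.pi / a) ^ α * ‖x - x‖ ^ (1 - α) = 0 := by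
          rw [sub_self, norm_zero, Real.zero_rpow (by linarith), mul_zero]
        have := hc.tendsto.mono_left (nhdsWithin_le_nhds (s := closure Ω ×ˢ closure Ω))
        simp only [h0] at this
        exact this
      refine squeeze_zero_norm' ?_ hB
      filter_upwards [self_mem_nhdsWithin] with z hz
      have h2 := hD z.1 hz.1 z.2 hz.2
      rw [dist_eq_norm] at h2
      exact ratio_bound ha haD hα hL0 (norm_nonneg _) h2 (hL _ hz.1 _ hz.2)
    · have hp := hfpos x hx y hy hxy
      have hs : 0 < Real.sin (a * (‖x - y‖ / 2)) := by
        have h1 : 0 < ‖x - y‖ := norm_pos_iff.mpr (sub_ne_zero.mpr hxy)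
        have h2 := hD x hx y hy
        rw [dist_eq_norm] at h2
        exact sin_pos_of ha haD h1 h2
      have c1 : ContinuousWithinAt (fun z : Rn n × Rn n => w z.1) (closure Ω ×ˢ closure Ω) (x, y) :=
        (hwc x hx).comp continuousWithinAt_fst (fun z hz => hz.1)
      have c2 : ContinuousWithinAt (fun z : Rn n × Rn n => w z.2) (closure Ω ×ˢ closure Ω) (x, y) :=
        (hwc y hy).comp continuousWithinAt_snd (fun z hz => hz.2)
      have c3 : ContinuousAt (fun z : Rn n × Rn n => fm a α ‖z.1 - z.2‖) (x, y) :=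
        (fm_deriv hs).continuousAt.comp_of_eq
          (Continuous.continuousAt (f := fun z : Rn n × Rn n => ‖z.1 - z.2‖) (by fun_prop)) rfl
      exact (c1.sub c2).div c3.continuousWithinAt hp.ne'
  have hex : ∃ x ∈ closure Ω, ∃ y ∈ closure Ω, w y < w x := by
    by_contra hcon
    push Not at hcon
    obtain ⟨x₁, hx₁⟩ := H.ne
    exact hwnc ⟨w x₁, fun x hx => le_antisymm (hcon x hx x₁ (subset_closure hx₁))
      (hcon x₁ (subset_closure hx₁) x hx)⟩
  obtain ⟨x₁, hx₁, y₁, hy₁, hlt⟩ := hex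
  obtain ⟨⟨x, y⟩, ⟨hx, hy⟩, hmax⟩ := (H.compact.prod H.compact).exists_isMaxOn
    ⟨(x₁, y₁), hx₁, hy₁⟩ hcont
  simp only at hx hy
  have hC : 0 < R (x, y) := by
    refine lt_of_lt_of_le ?_ (hmax (show (x₁, y₁) ∈ closure Ω ×ˢ closure Ω from ⟨hx₁, hy₁⟩))
    exact div_pos (sub_pos.mpr hlt) (hfpos _ hx₁ _ hy₁ (by rintro rfl; exact lt_irrefl _ hlt))
  have hxy : x ≠ y := by
    rintro rfl
    simp [R] at hC
  refine ⟨R (x, y), hC, x, hx, y, hy, hxy, ?_, ?_⟩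
  · exact (div_mul_cancel₀ _ (hfpos x hx y hy hxy).ne').symm
  · intro x' hx' y' hy'
    by_cases h : x' = y'
    · subst h
      have : 0 ≤ fm a α ‖x' - x'‖ := by
        simp [fm, Real.zero_rpow hα.ne']
      rw [sub_self (w x')]
      positivity
    · have := hmax (show (x', y') ∈ closure Ω ×ˢ closure Ω from ⟨hx', hy'⟩)
      exact (div_le_iff₀ (hfpos x' hx' y' hy' h)).mp this

set_option maxHeartbeats 1000000 in
lemma gap (F : Phi Ω ρ φ) (H : Dom Ω ρ) {a b D α : ℝ} (ha : 0 < a) (haD : a * D < Real.pi)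
    (hb : 0 < b) (hb1 : b < 1) (hα : 0 < α) (hα1 : α < 1)
    {q φ₁ w : Rn n → ℝ} {lam lam1 : ℝ} (hq : ConvexOn ℝ (closure Ω) q)
    (heig : ∀ x ∈ Ω, lap φ x - q x * φ x = -lam * φ x)
    (heig1 : ∀ x ∈ Ω, lap φ₁ x - q x * φ₁ x = -lam1 * φ₁ x)
    (hφ₁ : ContDiffOn ℝ 2 φ₁ (closure Ω)) (hwC : ContDiffOn ℝ 2 w (closure Ω))
    (hw : ∀ x ∈ Ω, w x = φ₁ x / φ x)
    (hwnc : ¬ ∃ c : ℝ, ∀ x ∈ closure Ω, w x = c)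
    (hwν : ∀ x ∈ frontier Ω, fderivWithin ℝ w (closure Ω) x (gradient ρ x) = 0)
    (hD : ∀ x ∈ closure Ω, ∀ y ∈ closure Ω, dist x y ≤ D) :
    α * a ^ 2 * (1 + 2 * b) ≤ lam1 - lam := by
  obtain ⟨C, hC, x, hx, y, hy, hxy, heq, hle⟩ := ratio_max H ha haD hα hα1 hD hwC hwnc
  have hz : x - y ≠ 0 := sub_ne_zero.mpr hxy
  set d := ‖x - y‖ with hd
  have hd0 : 0 < d := norm_pos_iff.mpr hz
  have hdD : d ≤ D := by have := hD x hx y hy; rwa [dist_eq_norm] at this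
  have hs : 0 < Real.sin (a * (d / 2)) := sin_pos_of ha haD hd0 hdD
  have hc : 0 < Real.cos (a * (d / 2)) :=
    cos_pos_of ha haD (by rw [abs_of_pos (by positivity)]; linarith)
  have hf1 : 0 < fm1 a α d := by unfold fm1; positivity
  have hfp : 0 < fm a α d := by unfold fm; positivity
  have hwd : DifferentiableOn ℝ w (closure Ω) := hwC.differentiableOn (by norm_num)
  have hxΩ : x ∈ Ω := by
    rcases Dom.cl_cases hx with h | h
    · exact h
    exfalso
    refine bd_excl H hwd hwν h hy hxy (fm_deriv hs) hf1 hC fun z hz => ?_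
    have := hle z hz y hy
    linarith
  have hyΩ : y ∈ Ω := by
    rcases Dom.cl_cases hy with h | h
    · exact h
    exfalso
    refine bd_excl H (w := fun z => - w z) hwd.neg ?_ h hx hxy.symm (g := fm a α)
      (g' := fm1 a α d) (by rw [norm_sub_rev]; exact fm_deriv hs) hf1 hC fun z hz => ?_
    · intro z hz
      rw [fderivWithin_fun_neg (H.udiff z (frontier_subset_closure hz)), neg_apply, hwν z hz,
        neg_zero]
    · have := hle x hx z hz
      rw [norm_sub_rev z x, norm_sub_rev y x]
      linarith
  obtain ⟨e, he⟩ : ∃ e : Rn n, e = d⁻¹ • (x - y) := ⟨_, rfl⟩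
  have hen : ‖e‖ = 1 := by
    rw [he, norm_smul, norm_inv, Real.norm_of_nonneg hd0.le, ← hd]; field_simp
  have hde : x - y = d • e := by rw [he, smul_smul, mul_inv_cancel₀ hd0.ne', one_smul]
  have wx := cdat H hwC hxΩ
  have wy := cdat H hwC hyΩ
  have evm : ∀ {z : Rn n} (v : Rn n), z ∈ Ω → ∀ᶠ t : ℝ in 𝓝 0, z + t • v ∈ closure Ω := by
    intro z v hz
    exact (ev_mem H (g := fun t : ℝ => z + t • v) (Continuous.continuousAt (by fun_prop))
      (by simpa using hz)).mono fun t ht => subset_closure ht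
  -- first order conditions
  have hinn : ∀ v, ⟪x - y, v⟫ / ‖x - y‖ = ⟪e, v⟫ := by
    intro v
    rw [← hd, hde, inner_smul_left]
    simp
    field_simp
  have G1 : gradient w x = (C * fm1 a α d) • e := by
    refine ext_inner_right ℝ fun v => ?_
    rw [← fderiv_inner_gradient, inner_smul_left]
    have k1 := (line_derivs v wx).1.self_of_nhds
    have k2 : HasDerivAt (fun t : ℝ => fm a α ‖x - y + t • v‖) (fm1 a α d * ⟪e, v⟫) 0 := by
      have := norm_line_deriv (d := v) hz
      rw [hinn] at this
      exact HasDerivAt.comp (h₂ := fm a α) (0:ℝ) (by simpa using fm_deriv hs) this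
    have hl : IsLocalMax (fun t : ℝ => w (x + t • v) - C * fm a α ‖x - y + t • v‖) 0 := by
      filter_upwards [evm v hxΩ] with t ht
      have := hle _ ht y hy
      have e1 : x + t • v - y = x - y + t • v := by module
      rw [e1] at this
      simp only [zero_smul, add_zero, ← hd]
      linarith
    have := hl.hasDerivAt_eq_zero (k1.sub (k2.const_mul C))
    simp only [zero_smul, add_zero] at this
    simp
    linarith
  have G2 : gradient w y = (C * fm1 a α d) • e := by
    refine ext_inner_right ℝ fun v => ?_
    rw [← fderiv_inner_gradient, inner_smul_left]
    have k1 := (line_derivs v wy).1.self_of_nhds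
    have k2 : HasDerivAt (fun t : ℝ => fm a α ‖x - y + t • -v‖) (fm1 a α d * ⟪e, -v⟫) 0 := by
      have := norm_line_deriv (d := -v) hz
      rw [hinn] at this
      exact HasDerivAt.comp (h₂ := fm a α) (0:ℝ) (by simpa using fm_deriv hs) this
    have hl : IsLocalMax (fun t : ℝ => - w (y + t • v) - C * fm a α ‖x - y + t • -v‖) 0 := by
      filter_upwards [evm v hyΩ] with t ht
      have := hle x hx _ ht
      have e1 : x - (y + t • v) = x - y + t • -v := by module
      rw [e1] at this
      simp only [zero_smul, add_zero, ← hd]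
      linarith
    have := hl.hasDerivAt_eq_zero (k1.neg.sub (k2.const_mul C))
    simp only [zero_smul, add_zero, inner_neg_right] at this
    simp
    linarith
  -- second order conditions
  set Q : Rn n →L[ℝ] Rn n →L[ℝ] ℝ := fderiv ℝ (fderiv ℝ w) x - fderiv ℝ (fderiv ℝ w) y with hQ
  have Q1 : ∀ v, Q v v ≤ 0 := by
    intro v
    obtain ⟨a1, b1⟩ := line_derivs v wx
    obtain ⟨a2, b2⟩ := line_derivs v wy
    have hl : IsLocalMax (fun t : ℝ => w (x + t • v) - w (y + t • v)) 0 := by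
      filter_upwards [evm v hxΩ, evm v hyΩ] with t h1 h2
      have := hle _ h1 _ h2
      have e1 : x + t • v - (y + t • v) = x - y := by module
      rw [e1, ← hd] at this
      simp only [zero_smul, add_zero]
      linarith
    have := second_order_max (by
      filter_upwards [a1, a2] with t c1 c2
      exact c1.sub c2) (b1.sub b2) hl
    simpa [hQ] using this.2
  obtain ⟨f2, hf2⟩ : ∃ f2, f2 = (-Real.sin (a * (d / 2)) * (a / 2) * (a / 2) * α *
      Real.sin (a * (d / 2)) ^ (α - 1) + Real.cos (a * (d / 2)) * (a / 2) * α *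
      (Real.cos (a * (d / 2)) * (a / 2) * (α - 1) * Real.sin (a * (d / 2)) ^ (α - 1 - 1))) :=
    ⟨_, rfl⟩
  have Q2 : Q e e ≤ 4 * C * f2 := by
    obtain ⟨a1, b1⟩ := line_derivs e wx
    obtain ⟨a2, b2⟩ := line_derivs (-e) wy
    have hlin : ∀ t : ℝ, HasDerivAt (fun t : ℝ => d + 2 * t) 2 t := fun t => by
      simpa using ((hasDerivAt_id t).const_mul 2).const_add d
    have evp : ∀ᶠ t : ℝ in 𝓝 0, 0 < d + 2 * t :=
      (hlin 0).continuousAt.eventually (lt_mem_nhds (by simpa using hd0))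
    have evs : ∀ᶠ t : ℝ in 𝓝 0, 0 < Real.sin (a * ((d + 2 * t) / 2)) := by
      have : ContinuousAt (fun t : ℝ => Real.sin (a * ((d + 2 * t) / 2))) 0 :=
        Continuous.continuousAt (by fun_prop)
      exact this.eventually (lt_mem_nhds (by simpa using hs))
    have hl : IsLocalMax (fun t : ℝ => w (x + t • e) - w (y + t • -e) - C * fm a α (d + 2 * t))
        0 := by
      filter_upwards [evm e hxΩ, evm (-e) hyΩ, evp] with t h1 h2 h3
      have := hle _ h1 _ h2
      have e1 : x + t • e - (y + t • -e) = (d + 2 * t) • e := by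
        rw [add_smul, ← hde]; module
      rw [e1, norm_smul, hen, mul_one, Real.norm_of_nonneg h3.le] at this
      simp only [zero_smul, add_zero, mul_zero]
      linarith
    have k2 : HasDerivAt (fun t : ℝ => fm1 a α (d + 2 * t) * 2) (f2 * 2 * 2) 0 := by
      have := fm_deriv2 (α := α) hs
      rw [← hf2] at this
      exact (HasDerivAt.comp (h₂ := fm1 a α) (0:ℝ) (by simpa using this) (hlin 0)).mul_const 2
    have := second_order_max (by
      filter_upwards [a1, a2, evs] with t c1 c2 c3
      have c4 : HasDerivAt (fun t : ℝ => fm a α (d + 2 * t)) (fm1 a α (d + 2 * t) * 2) t :=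
        HasDerivAt.comp (h₂ := fm a α) t (fm_deriv c3) (hlin t)
      exact (c1.sub c2).sub (c4.const_mul C)) ((b1.sub b2).sub (k2.const_mul C)) hl
    have h2 := this.2
    simp only [map_neg, neg_apply, neg_neg] at h2
    simp only [hQ, sub_apply]
    linarith
  have T := trace_le Q Q1 hen
  have hT : ∑ i, Q (EuclideanSpace.single i 1) (EuclideanSpace.single i 1) =
      -(lam1 - lam) * (C * fm a α d) - 2 * (C * fm1 a α d) *
        (fderiv ℝ (lg φ) x e - fderiv ℝ (lg φ) y e) := by
    simp only [hQ, sub_apply, Finset.sum_sub_distrib]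
    rw [w_pde F H heig heig1 hφ₁ hwC hw hxΩ, w_pde F H heig heig1 hφ₁ hwC hw hyΩ, G1, G2, ← heq,
      fderiv_inner_gradient, fderiv_inner_gradient, inner_smul_left, inner_smul_left,
      real_inner_comm e, real_inner_comm e]
    simp
    ring
  have hM : fderiv ℝ (lg φ) x e - fderiv ℝ (lg φ) y e ≤
      -(2 * (a * b * Real.tan (a * (d / 2)))) := by
    have p1 : x = ((1/2 : ℝ) • (x + y)) + (d / 2) • e := by
      have : (d / 2) • e = (1/2 : ℝ) • (x - y) := by rw [hde, smul_smul]; ring_nf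
      rw [this]; module
    have p2 : y = ((1/2 : ℝ) • (x + y)) - (d / 2) • e := by
      have : (d / 2) • e = (1/2 : ℝ) • (x - y) := by rw [hde, smul_smul]; ring_nf
      rw [this]; module
    have := modulus F H ha haD hb hb1 hq heig hD (m := (1/2 : ℝ) • (x + y)) (r := d / 2) hen
      (by positivity) (by rw [← p1]; exact hxΩ) (by rw [← p2]; exact hyΩ)
    rwa [← p1, ← p2] at this
  have hI := fm_ineq (b := b) ha hα hα1 hs hc hf2
  have hM2 := mul_le_mul_of_nonneg_left hM (show 0 ≤ 2 * (C * fm1 a α d) by positivity)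
  have hI2 := mul_le_mul_of_nonneg_left hI hC.le
  have hfin : (α * a ^ 2 * (1 + 2 * b)) * (C * fm a α d) ≤ (lam1 - lam) * (C * fm a α d) := by
    linarith
  exact le_of_mul_le_mul_right hfin (by positivity)

end

end Helpers

theorem stmt_11 {n : ℕ}
    (Ω : Set (EuclideanSpace ℝ (Fin n))) (ρ : EuclideanSpace ℝ (Fin n) → ℝ)
    (hΩ : IsOpen Ω) (hbd : Bornology.IsBounded Ω)
    (hρ : ContDiff ℝ 2 ρ)
    (hΩρ : Ω = {x | ρ x < 0})
    (hfr : frontier Ω = {x | ρ x = 0})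
    (hν : ∀ x ∈ frontier Ω, gradient ρ x ≠ 0)
    (hsc : ∀ x ∈ frontier Ω, ∀ v : EuclideanSpace ℝ (Fin n), v ≠ 0 → ⟪gradient ρ x, v⟫ = 0 →
      0 < fderiv ℝ (fun y => fderiv ℝ ρ y v) x v)
    (hne : Ω.Nonempty)
    (D : ℝ) (hD : Metric.diam Ω = D)
    (q : EuclideanSpace ℝ (Fin n) → ℝ)
    (hq : ConvexOn ℝ (closure Ω) q) (hqC : ContDiffOn ℝ 1 q (closure Ω))
    (φ₀ : EuclideanSpace ℝ (Fin n) → ℝ) (lam0 : ℝ)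
    (hφC : ContDiffOn ℝ 2 φ₀ (closure Ω))
    (hφpos : ∀ x ∈ Ω, 0 < φ₀ x)
    (hφbd : ∀ x ∈ frontier Ω, φ₀ x = 0)
    (hφν : ∀ x ∈ frontier Ω, fderivWithin ℝ φ₀ (closure Ω) x (gradient ρ x) < 0)
    (heig : ∀ x ∈ Ω, lap φ₀ x - q x * φ₀ x = -lam0 * φ₀ x)
    (φ₁ : EuclideanSpace ℝ (Fin n) → ℝ) (lam1 : ℝ) (w : EuclideanSpace ℝ (Fin n) → ℝ)
    (hφ₁C : ContDiffOn ℝ 2 φ₁ (closure Ω))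
    (hφ₁bd : ∀ x ∈ frontier Ω, φ₁ x = 0)
    (hφ₁ne : ∃ x ∈ closure Ω, φ₁ x ≠ 0)
    (heig1 : ∀ x ∈ Ω, lap φ₁ x - q x * φ₁ x = -lam1 * φ₁ x)
    (hwC : ContDiffOn ℝ 2 w (closure Ω))
    (hw : ∀ x ∈ Ω, w x = φ₁ x / φ₀ x)
    (hwnc : ¬ ∃ c : ℝ, ∀ x ∈ closure Ω, w x = c)
    (hwν : ∀ x ∈ frontier Ω, fderivWithin ℝ w (closure Ω) x (gradient ρ x) = 0)
 :
    ((n : ℝ) + 3) * (Real.pi / D) ^ 2 + sInf (q '' Ω) ≤ lam1 := by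
  have hgr : ∀ x v, ⟪gradient ρ x, v⟫ = fderiv ℝ ρ x v := fun x v =>
    (fderiv_inner_gradient ρ x v).symm
  have H : Dom Ω ρ := by
    refine ⟨hΩ, hbd, hρ, hΩρ, hfr, hν, ?_, hq.1, hne⟩
    intro x hx v hv h0
    have h1 := hsc x hx v hv (by rw [hgr]; exact h0)
    have h2 : DifferentiableAt ℝ (fderiv ℝ ρ) x :=
      (hρ.contDiffAt.fderiv_right (m := 1) (by norm_num)).differentiableAt (by norm_num)
    have h3 := (h2.hasFDerivAt.clm_apply (hasFDerivAt_const v x)).fderiv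
    rw [h3] at h1
    simpa using h1
  have F : Phi Ω ρ φ₀ := ⟨hφC, hφpos, hφbd, hφν⟩
  have hDd : ∀ x ∈ closure Ω, ∀ y ∈ closure Ω, dist x y ≤ D := by
    intro x hx y hy
    rw [← hD, ← Metric.diam_closure]
    exact Metric.dist_le_diam_of_mem hbd.closure hx hy
  have hDpos : 0 < D := by
    by_contra hcon
    push Not at hcon
    obtain ⟨x₁, hx₁⟩ := hne
    refine hwnc ⟨w x₁, fun x hx => ?_⟩
    have h1 := (hDd x hx x₁ (subset_closure hx₁)).trans hcon
    rw [dist_le_zero.mp h1]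
  have key : ∀ θ : ℝ, 0 < θ → θ < 1 →
      sInf (q '' Ω) + n * (θ * (Real.pi / D)) ^ 2 * θ +
        θ * (θ * (Real.pi / D)) ^ 2 * (1 + 2 * θ) ≤ lam1 := by
    intro θ h0 h1
    have ha : 0 < θ * (Real.pi / D) := by positivity
    have haD : θ * (Real.pi / D) * D < Real.pi := by
      have : θ * (Real.pi / D) * D = θ * Real.pi := by field_simp
      rw [this]
      nlinarith [Real.pi_pos]
    have k1 := lam0_bound F H ha haD h0 h1 hq hqC.continuousOn heig hDd
    have k2 := gap F H ha haD h0 h1 h0 h1 hq heig heig1 hφ₁C hwC hw hwnc hwν hDd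
    linarith
  have hlim : Filter.Tendsto (fun θ : ℝ => sInf (q '' Ω) + n * (θ * (Real.pi / D)) ^ 2 * θ +
        θ * (θ * (Real.pi / D)) ^ 2 * (1 + 2 * θ)) (nhdsWithin 1 (Iio 1))
      (nhds (sInf (q '' Ω) + n * (1 * (Real.pi / D)) ^ 2 * 1 +
        1 * (1 * (Real.pi / D)) ^ 2 * (1 + 2 * 1))) := by
    refine Filter.Tendsto.mono_left (Continuous.tendsto ?_ 1) nhdsWithin_le_nhds
    fun_prop
  have hfin := le_of_tendsto hlim (by
    filter_upwards [self_mem_nhdsWithin,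
      nhdsWithin_le_nhds (lt_mem_nhds (zero_lt_one : (0:ℝ) < 1))] with θ h1 h0
    exact key θ h0 h1)
  linarith
end

section
/- Let Ω ⊂ ℝⁿ be a bounded open set with C² boundary whose second fundamental form with respect to the outward normal is positive definite (strictly convex), and let q be a convex function, C¹ on the closure of Ω. Let φ₀ be a first Dirichlet eigenfunction of L_q = Δ − q with eigenvalue λ₀. Then λ₀ ≥ n (π²/4) (α(n)/|Ω|)^{2/n} + inf_{x ∈ Ω} q(x), where |Ω| is the Lebesgue measure of Ω and α(n) is the Lebesgue measure of the unit ball in ℝⁿ. -/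
open scoped RealInnerProductSpace
open Set MeasureTheory


lemma oneD_aux {a b : ℝ} (hab : a < b) {f f' f'' : ℝ → ℝ} (hf : ContinuousOn f (Icc a b))
    (hf' : ContinuousOn f' (Icc a b)) (hf'' : ContinuousOn f'' (Icc a b))
    (h1 : ∀ t ∈ Ioo a b, HasDerivAt f (f' t) t) (h2 : ∀ t ∈ Ioo a b, HasDerivAt f' (f'' t) t)
    (fa : f a = 0) (fb : f b = 0) (k : ℝ) (hk0 : 0 < k) (hk : k * (b - a) < Real.pi) :
    ∫ t in a..b, (f t * f'' t + k ^ 2 * f t ^ 2) ≤ 0 := by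
  have hcos : ∀ t ∈ Icc a b, 0 < Real.cos (k * (t - (a + b) / 2)) := by
    intro t ht
    apply Real.cos_pos_of_mem_Ioo
    have h3 := mul_le_mul_of_nonneg_left ht.1 hk0.le
    have h4 := mul_le_mul_of_nonneg_left ht.2 hk0.le
    constructor <;> nlinarith
  have := intervalIntegral.integral_le_sub_of_hasDeriv_right_of_le
    (g := fun t => f t * f' t + k * Real.tan (k * (t - (a + b) / 2)) * f t ^ 2)
    (g' := fun t => (f' t * f' t + f t * f'' t) +
      ((k * (1 / Real.cos (k * (t - (a + b) / 2)) ^ 2 * (k * 1))) * f t ^ 2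
        + k * Real.tan (k * (t - (a + b) / 2)) * (2 * f t ^ 1 * f' t)))
    (φ := fun t => f t * f'' t + k ^ 2 * f t ^ 2) hab.le ?_ ?_ ?_ ?_
  · simpa [fa, fb] using this
  · apply (hf.mul hf').add
    apply ContinuousOn.mul _ (hf.pow 2)
    apply continuousOn_const.mul
    intro t ht
    apply ContinuousAt.continuousWithinAt
    have hc := Real.continuousAt_tan.2 (hcos t ht).ne'
    exact ContinuousAt.comp (f := fun t => k * (t - (a + b) / 2)) hc (by fun_prop)
  · intro t ht
    apply HasDerivAt.hasDerivWithinAt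
    apply ((h1 t ht).mul (h2 t ht)).add
    have hl : HasDerivAt (fun t => k * (t - (a + b) / 2)) (k * 1) t :=
      ((hasDerivAt_id t).sub_const _).const_mul k
    have ht2 := (Real.hasDerivAt_tan (hcos t (Ioo_subset_Icc_self ht)).ne').comp t hl
    have := (ht2.const_mul k).mul ((h1 t ht).pow 2)
    exact this.congr_deriv (by simp)
  · apply ContinuousOn.integrableOn_Icc
    exact (hf.mul hf'').add (continuousOn_const.mul (hf.pow 2))
  · intro t ht
    have hc := hcos t (Ioo_subset_Icc_self ht)
    have : 1 / Real.cos (k * (t - (a + b) / 2)) ^ 2 = 1 + Real.tan (k * (t - (a + b) / 2)) ^ 2 := by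
      rw [one_div, ← Real.inv_one_add_tan_sq hc.ne', inv_inv]
    simp only [this]
    nlinarith [sq_nonneg (f' t + k * Real.tan (k * (t - (a + b) / 2)) * f t)]

lemma oneD {a b : ℝ} (hab : a < b) {f f' f'' : ℝ → ℝ} (hf : ContinuousOn f (Icc a b))
    (hf' : ContinuousOn f' (Icc a b)) (hf'' : ContinuousOn f'' (Icc a b))
    (h1 : ∀ t ∈ Ioo a b, HasDerivAt f (f' t) t) (h2 : ∀ t ∈ Ioo a b, HasDerivAt f' (f'' t) t)
    (fa : f a = 0) (fb : f b = 0) (A : ℝ) (hA : A ≤ (Real.pi / (b - a)) ^ 2) :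
    ∫ t in a..b, (f t * f'' t + A * f t ^ 2) ≤ 0 := by
  have hI1 : IntervalIntegrable (fun t => f t * f'' t) volume a b :=
    ContinuousOn.intervalIntegrable (by rw [uIcc_of_le hab.le]; exact hf.mul hf'')
  have hI2 : IntervalIntegrable (fun t => f t ^ 2) volume a b :=
    ContinuousOn.intervalIntegrable (by rw [uIcc_of_le hab.le]; exact hf.pow 2)
  have split : ∀ c : ℝ, ∫ t in a..b, (f t * f'' t + c * f t ^ 2)
      = (∫ t in a..b, f t * f'' t) + c * ∫ t in a..b, f t ^ 2 := by
    intro c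
    rw [intervalIntegral.integral_add hI1 (hI2.const_mul c), intervalIntegral.integral_const_mul]
  have hpos : 0 ≤ ∫ t in a..b, f t ^ 2 :=
    intervalIntegral.integral_nonneg hab.le (fun t _ => sq_nonneg _)
  have hba : 0 < b - a := sub_pos.2 hab
  set K := Real.pi / (b - a) with hK
  have hKpos : 0 < K := div_pos Real.pi_pos hba
  have key : ∀ k ∈ Ioo 0 K, (∫ t in a..b, f t * f'' t) + k ^ 2 * ∫ t in a..b, f t ^ 2 ≤ 0 := by
    intro k hk
    rw [← split]
    exact oneD_aux hab hf hf' hf'' h1 h2 fa fb k hk.1 (by rw [hK, mem_Ioo, lt_div_iff₀ hba] at hk; exact hk.2)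
  have lim : (∫ t in a..b, f t * f'' t) + K ^ 2 * ∫ t in a..b, f t ^ 2 ≤ 0 := by
    have hc : K ∈ closure (Ioo 0 K) := by
      rw [closure_Ioo hKpos.ne]; exact ⟨hKpos.le, le_rfl⟩
    have hcont : Continuous fun k : ℝ => (∫ t in a..b, f t * f'' t) + k ^ 2 * ∫ t in a..b, f t ^ 2 := by
      fun_prop
    exact closure_minimal (t := {k : ℝ | (∫ t in a..b, f t * f'' t) + k ^ 2 * ∫ t in a..b, f t ^ 2 ≤ 0}) key
      (isClosed_le hcont continuous_const) hc
  rw [split]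
  nlinarith

lemma slicing {n : ℕ} (e : EuclideanSpace ℝ (Fin n)) (he : ‖e‖ = 1)
    (F : EuclideanSpace ℝ (Fin n) → ℝ) (hF : Integrable F) (hFm : Measurable F)
    (h : ∀ x, ∫ t : ℝ, F (x + t • e) ≤ 0) : ∫ x, F x ≤ 0 := by
  set g : ℝ → ℝ := (Ioc (0:ℝ) 1).indicator 1 with hg
  have hgm : Measurable g := measurable_one.indicator measurableSet_Ioc
  have hg0 : ∀ t, 0 ≤ g t := fun t => indicator_nonneg (fun _ _ => zero_le_one) t
  have hgi : Integrable g := by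
    rw [hg, integrable_indicator_iff measurableSet_Ioc]
    exact integrableOn_const (by simp)
  have hg1 : ∫ t, g t = 1 := by
    rw [hg, integral_indicator measurableSet_Ioc]; simp
  have hgs : ∀ c : ℝ, Integrable fun t => g (c - t) := fun c => hgi.comp_sub_left c
  have hgs1 : ∀ c : ℝ, ∫ t, g (c - t) = 1 := fun c => by
    rw [integral_sub_left_eq_self g volume c, hg1]
  have hHm : Measurable fun p : EuclideanSpace ℝ (Fin n) × ℝ => F p.1 * g (⟪p.1, e⟫ - p.2) := by
    fun_prop
  have hKm : Measurable fun p : EuclideanSpace ℝ (Fin n) × ℝ => F (p.1 + p.2 • e) * g ⟪p.1, e⟫ := by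
    fun_prop
  have hH : Integrable (fun p : EuclideanSpace ℝ (Fin n) × ℝ => F p.1 * g (⟪p.1, e⟫ - p.2))
      (volume.prod volume) := by
    rw [integrable_prod_iff hHm.aestronglyMeasurable]
    refine ⟨.of_forall fun x => (hgs ⟪x, e⟫).const_mul (F x), ?_⟩
    have : (fun x => ∫ t, ‖F x * g (⟪x, e⟫ - t)‖) = fun x => ‖F x‖ := by
      ext x
      simp only [norm_mul, integral_const_mul]
      have : ∀ t, ‖g (⟪x, e⟫ - t)‖ = g (⟪x, e⟫ - t) := fun t => Real.norm_of_nonneg (hg0 _)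
      simp only [this, hgs1, mul_one]
    simp only [this]
    exact hF.norm
  have hee : ⟪e, e⟫ = 1 := by rw [real_inner_self_eq_norm_sq, he]; norm_num
  have shift : ∀ t : ℝ, (fun x => F (x + t • e) * g ⟪x, e⟫)
      = fun x => (fun y => F y * g (⟪y, e⟫ - t)) (x + t • e) := by
    intro t; ext x
    simp [inner_add_left, inner_smul_left, he]
  have hK : Integrable (fun p : EuclideanSpace ℝ (Fin n) × ℝ => F (p.1 + p.2 • e) * g ⟪p.1, e⟫)
      (volume.prod volume) := by
    rw [integrable_prod_iff' hKm.aestronglyMeasurable]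
    rw [integrable_prod_iff' hHm.aestronglyMeasurable] at hH
    refine ⟨?_, ?_⟩
    · filter_upwards [hH.1] with t ht
      simp only [shift]
      exact ht.comp_add_right _
    · convert hH.2 using 2 with t
      have := integral_add_right_eq_self (μ := volume)
        (fun y : EuclideanSpace ℝ (Fin n) => ‖F y * g (⟪y, e⟫ - t)‖) (t • e)
      rw [← this]
      congr 1; ext x
      exact congrArg norm (congrFun (shift t) x)
  have e1 : ∫ x, F x = ∫ x, ∫ t : ℝ, F (x + t • e) * g ⟪x, e⟫ := by
    rw [integral_integral_swap hK]
    have : (fun t : ℝ => ∫ x, F (x + t • e) * g ⟪x, e⟫) = fun t => ∫ y, F y * g (⟪y, e⟫ - t) := by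
      ext t
      rw [shift, integral_add_right_eq_self (μ := volume)
        (fun y : EuclideanSpace ℝ (Fin n) => F y * g (⟪y, e⟫ - t)) (t • e)]
    rw [this, integral_integral_swap (f := fun (t : ℝ) y => F y * g (⟪y, e⟫ - t)) hH.swap]
    simp only [integral_const_mul, hgs1, mul_one]
  rw [e1]
  apply integral_nonpos
  intro x
  simp only [integral_mul_const]
  exact mul_nonpos_of_nonpos_of_nonneg (h x) (hg0 _)


open scoped Pointwise in
lemma sphere_inv {n : ℕ} (U : EuclideanSpace ℝ (Fin n) ≃ₗᵢ[ℝ] EuclideanSpace ℝ (Fin n))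
    (f : EuclideanSpace ℝ (Fin n) → ℝ) :
    ∫ e : Metric.sphere (0 : EuclideanSpace ℝ (Fin n)) 1, f (U e)
        ∂(volume : Measure (EuclideanSpace ℝ (Fin n))).toSphere
      = ∫ e : Metric.sphere (0 : EuclideanSpace ℝ (Fin n)) 1, f e
        ∂(volume : Measure (EuclideanSpace ℝ (Fin n))).toSphere := by
  have hUm : ∀ e : Metric.sphere (0 : EuclideanSpace ℝ (Fin n)) 1,
      U e ∈ Metric.sphere (0 : EuclideanSpace ℝ (Fin n)) 1 := by
    intro e; simp
  have hUm' : ∀ e : Metric.sphere (0 : EuclideanSpace ℝ (Fin n)) 1,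
      U.symm e ∈ Metric.sphere (0 : EuclideanSpace ℝ (Fin n)) 1 := by
    intro e; simp
  let V : Metric.sphere (0 : EuclideanSpace ℝ (Fin n)) 1 ≃ₜ
      Metric.sphere (0 : EuclideanSpace ℝ (Fin n)) 1 :=
    { toFun := fun e => ⟨U e, hUm e⟩
      invFun := fun e => ⟨U.symm e, hUm' e⟩
      left_inv := fun e => by simp
      right_inv := fun e => by simp
      continuous_toFun := by fun_prop
      continuous_invFun := by fun_prop }
  have mp : MeasurePreserving V (volume : Measure (EuclideanSpace ℝ (Fin n))).toSphere
      (volume : Measure (EuclideanSpace ℝ (Fin n))).toSphere := by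
    refine ⟨V.measurable, ?_⟩
    ext s hs
    rw [Measure.map_apply V.measurable hs, Measure.toSphere_apply' _ (V.measurable hs),
      Measure.toSphere_apply' _ hs]
    congr 1
    have : Ioo (0:ℝ) 1 • ((↑) '' (V ⁻¹' s) : Set (EuclideanSpace ℝ (Fin n)))
        = U ⁻¹' (Ioo (0:ℝ) 1 • ((↑) '' s : Set (EuclideanSpace ℝ (Fin n)))) := by
      ext x
      simp only [mem_preimage, Set.mem_smul, mem_image]
      constructor
      · rintro ⟨t, ht, _, ⟨e, he, rfl⟩, rfl⟩
        exact ⟨t, ht, _, ⟨V e, he, rfl⟩, by simp [V]⟩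
      · rintro ⟨t, ht, _, ⟨e, he, rfl⟩, hx⟩
        refine ⟨t, ht, _, ⟨V.symm e, by simpa using he, rfl⟩, ?_⟩
        apply U.injective
        rw [← hx]
        simp [V]
    rw [this]
    exact U.measurePreserving.measure_preimage_emb U.toHomeomorph.measurableEmbedding _
  exact mp.integral_comp V.measurableEmbedding (fun e => f e)

lemma sphere_cont {n : ℕ} {f : Metric.sphere (0 : EuclideanSpace ℝ (Fin n)) 1 → ℝ}
    (hf : Continuous f) : Integrable f (volume : Measure (EuclideanSpace ℝ (Fin n))).toSphere :=
  hf.integrable_of_hasCompactSupport (HasCompactSupport.of_compactSpace f)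

lemma sphere_moment_eq {n : ℕ} (u v : EuclideanSpace ℝ (Fin n)) (huv : ‖u‖ = ‖v‖) :
    ∫ e : Metric.sphere (0 : EuclideanSpace ℝ (Fin n)) 1, ⟪u, (e : EuclideanSpace ℝ (Fin n))⟫ ^ 2
        ∂(volume : Measure (EuclideanSpace ℝ (Fin n))).toSphere
      = ∫ e : Metric.sphere (0 : EuclideanSpace ℝ (Fin n)) 1,
        ⟪v, (e : EuclideanSpace ℝ (Fin n))⟫ ^ 2
        ∂(volume : Measure (EuclideanSpace ℝ (Fin n))).toSphere := by
  have h := Submodule.reflection_sub huv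
  set U := Submodule.reflection (ℝ ∙ (u - v))ᗮ
  rw [← sphere_inv U (fun e => ⟪v, e⟫ ^ 2)]
  congr 1; ext e
  rw [← h, U.inner_map_map]

lemma sphere_quad {n : ℕ} (B : EuclideanSpace ℝ (Fin n) →L[ℝ] EuclideanSpace ℝ (Fin n) →L[ℝ] ℝ) :
    (n : ℝ) * ∫ e : Metric.sphere (0 : EuclideanSpace ℝ (Fin n)) 1, B e e
        ∂(volume : Measure (EuclideanSpace ℝ (Fin n))).toSphere
      = (volume : Measure (EuclideanSpace ℝ (Fin n))).toSphere.real univ *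
        ∑ i, B (EuclideanSpace.single i 1) (EuclideanSpace.single i 1) := by
  set σ := (volume : Measure (EuclideanSpace ℝ (Fin n))).toSphere
  have coord : ∀ i (e : EuclideanSpace ℝ (Fin n)), ⟪EuclideanSpace.single i (1:ℝ), e⟫ = e i := by
    intro i e; simp [EuclideanSpace.inner_single_left]
  have hcont : ∀ i j, Continuous fun e : Metric.sphere (0 : EuclideanSpace ℝ (Fin n)) 1 => (e : EuclideanSpace ℝ (Fin n)) i * (e : EuclideanSpace ℝ (Fin n)) j := by
    intro i j; fun_prop
  have diag : ∀ i j, ∫ e : Metric.sphere (0 : EuclideanSpace ℝ (Fin n)) 1, (e : EuclideanSpace ℝ (Fin n)) i ^ 2 ∂σ = ∫ e : Metric.sphere (0 : EuclideanSpace ℝ (Fin n)) 1, (e : EuclideanSpace ℝ (Fin n)) j ^ 2 ∂σ := by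
    intro i j
    have := sphere_moment_eq (EuclideanSpace.single i (1:ℝ)) (EuclideanSpace.single j (1:ℝ)) (by simp)
    simpa only [coord] using this
  have off : ∀ i j, i ≠ j → ∫ e : Metric.sphere (0 : EuclideanSpace ℝ (Fin n)) 1, (e : EuclideanSpace ℝ (Fin n)) i * (e : EuclideanSpace ℝ (Fin n)) j ∂σ = 0 := by
    intro i j hij
    have hn : ‖EuclideanSpace.single i (1:ℝ) + EuclideanSpace.single j (1:ℝ)‖
        = ‖EuclideanSpace.single i (1:ℝ) - EuclideanSpace.single j (1:ℝ)‖ := by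
      rw [← sq_eq_sq₀ (norm_nonneg _) (norm_nonneg _), norm_add_sq_real, norm_sub_sq_real, coord]
      simp [hij]
    have := sphere_moment_eq _ _ hn
    simp only [inner_add_left, inner_sub_left, coord] at this
    have h4 : ∫ e : Metric.sphere (0 : EuclideanSpace ℝ (Fin n)) 1, (((e : EuclideanSpace ℝ (Fin n)) i + (e : EuclideanSpace ℝ (Fin n)) j) ^ 2
       - ((e : EuclideanSpace ℝ (Fin n)) i - (e : EuclideanSpace ℝ (Fin n)) j) ^ 2) ∂σ = 0 := by
      rw [integral_sub (sphere_cont (by fun_prop)) (sphere_cont (by fun_prop))]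
      exact sub_eq_zero.2 this
    have h5 : ∀ e : Metric.sphere (0 : EuclideanSpace ℝ (Fin n)) 1, (((e : EuclideanSpace ℝ (Fin n)) i + (e : EuclideanSpace ℝ (Fin n)) j) ^ 2
       - ((e : EuclideanSpace ℝ (Fin n)) i - (e : EuclideanSpace ℝ (Fin n)) j) ^ 2)
       = 4 * ((e : EuclideanSpace ℝ (Fin n)) i * (e : EuclideanSpace ℝ (Fin n)) j) := fun e => by ring
    simp only [h5, integral_const_mul] at h4
    linarith
  have tot : ∑ j, ∫ e : Metric.sphere (0 : EuclideanSpace ℝ (Fin n)) 1, (e : EuclideanSpace ℝ (Fin n)) j ^ 2 ∂σ = σ.real univ := by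
    rw [← integral_finsetSum _ (fun j _ => sphere_cont (by fun_prop))]
    have : ∀ e : Metric.sphere (0 : EuclideanSpace ℝ (Fin n)) 1, ∑ j, (e : EuclideanSpace ℝ (Fin n)) j ^ 2 = 1 := by
      intro e
      have h := EuclideanSpace.norm_sq_eq (e : EuclideanSpace ℝ (Fin n))
      simpa using h.symm
    simp only [this, integral_const, smul_eq_mul, mul_one]
    rfl
  have diag' : ∀ i, (n : ℝ) * ∫ e : Metric.sphere (0 : EuclideanSpace ℝ (Fin n)) 1, (e : EuclideanSpace ℝ (Fin n)) i ^ 2 ∂σ = σ.real univ := by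
    intro i
    rw [← tot, Finset.sum_congr rfl (fun j _ => diag j i)]
    simp
  have expand : ∀ e : Metric.sphere (0 : EuclideanSpace ℝ (Fin n)) 1, B e e = ∑ i, ∑ j, (e : EuclideanSpace ℝ (Fin n)) i * (e : EuclideanSpace ℝ (Fin n)) j
      * B (EuclideanSpace.single i 1) (EuclideanSpace.single j 1) := by
    intro e
    have he : (e : EuclideanSpace ℝ (Fin n)) = ∑ i, (e : EuclideanSpace ℝ (Fin n)) i • EuclideanSpace.single i (1:ℝ) := by
      have := (EuclideanSpace.basisFun (Fin n) ℝ).sum_repr (e : EuclideanSpace ℝ (Fin n))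
      simpa using this.symm
    conv_lhs => rw [he]
    simp only [map_sum, sum_apply, map_smul, smul_apply, smul_eq_mul]
    simp only [Finset.mul_sum]
    rw [Finset.sum_comm]
    refine Finset.sum_congr rfl fun i _ => Finset.sum_congr rfl fun j _ => by ring
  simp only [expand]
  rw [integral_finsetSum _ (fun i _ => sphere_cont (by fun_prop)), Finset.mul_sum, Finset.mul_sum]
  refine Finset.sum_congr rfl fun i _ => ?_
  rw [integral_finsetSum _ (fun i _ => sphere_cont (by fun_prop))]
  rw [Finset.sum_eq_single i]
  · rw [integral_mul_const, ← mul_assoc]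
    congr 1
    simpa only [sq] using diag' i
  · intro j _ hj
    rw [integral_mul_const, off i j hj.symm, zero_mul]
  · simp

lemma polar {n : ℕ} (hn : 0 < n) (K : Set (EuclideanSpace ℝ (Fin n))) (hK : MeasurableSet K)
    (r : Metric.sphere (0 : EuclideanSpace ℝ (Fin n)) 1 → ℝ) (hr : ∀ e, 0 ≤ r e)
    (h : ∀ e t, 0 < t → t < r e → t • (e : EuclideanSpace ℝ (Fin n)) ∈ K) :
    ∫⁻ e, ENNReal.ofReal (r e ^ n / n) ∂(volume : Measure (EuclideanSpace ℝ (Fin n))).toSphere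
      ≤ volume K := by
  have : Nontrivial (EuclideanSpace ℝ (Fin n)) := by
    have : NeZero n := ⟨hn.ne'⟩
    infer_instance
  set H := homeomorphUnitSphereProd (EuclideanSpace ℝ (Fin n))
  have mp := (volume : Measure (EuclideanSpace ℝ (Fin n))).measurePreserving_homeomorphUnitSphereProd
  let T : Set (Metric.sphere (0 : EuclideanSpace ℝ (Fin n)) 1 × Ioi (0:ℝ)) :=
    H.symm ⁻¹' ((↑) ⁻¹' K)
  have hTm : MeasurableSet T := H.symm.measurable (measurable_subtype_coe hK)
  have h1 : (volume : Measure (EuclideanSpace ℝ (Fin n))).comap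
      (Subtype.val : ({0}ᶜ : Set (EuclideanSpace ℝ (Fin n))) → _) ((↑) ⁻¹' K) ≤ volume K := by
    rw [comap_subtype_coe_apply (measurableSet_singleton _).compl]
    exact measure_mono (image_preimage_subset _ _)
  have h2 : ((↑) ⁻¹' K : Set ({0}ᶜ : Set (EuclideanSpace ℝ (Fin n)))) = H ⁻¹' T := by
    ext x; simp [T]
  rw [h2, mp.measure_preimage hTm.nullMeasurableSet, Measure.prod_apply hTm] at h1
  refine le_trans (lintegral_mono fun e => ?_) h1
  rcases (hr e).eq_or_lt with h0 | h0
  · simp [← h0, hn.ne']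
  · have := Measure.volumeIoiPow_apply_Iio (n - 1) ⟨r e, h0⟩
    have hd : Module.finrank ℝ (EuclideanSpace ℝ (Fin n)) = n := by simp
    have hn1 : ((n - 1 : ℕ) : ℝ) + 1 = n := by exact_mod_cast Nat.sub_add_cancel hn
    rw [hn1, Nat.sub_add_cancel hn] at this
    rw [hd, ← this]
    apply measure_mono
    intro t ht
    have := h e t t.2 ht
    simpa [T, H] using this


noncomputable def chordLen {n : ℕ} (Ω : Set (EuclideanSpace ℝ (Fin n)))
    (x e : EuclideanSpace ℝ (Fin n)) : ℝ := (volume {t : ℝ | x + t • e ∈ Ω}).toReal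

noncomputable def rayLen {n : ℕ} (Ω : Set (EuclideanSpace ℝ (Fin n)))
    (x e : EuclideanSpace ℝ (Fin n)) : ℝ := (volume {t : ℝ | 0 < t ∧ x + t • e ∈ Ω}).toReal

lemma chordLen_nonneg {n : ℕ} (Ω : Set (EuclideanSpace ℝ (Fin n)))
    (x e : EuclideanSpace ℝ (Fin n)) : 0 ≤ chordLen Ω x e := ENNReal.toReal_nonneg

lemma rayLen_nonneg {n : ℕ} (Ω : Set (EuclideanSpace ℝ (Fin n)))
    (x e : EuclideanSpace ℝ (Fin n)) : 0 ≤ rayLen Ω x e := ENNReal.toReal_nonneg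

lemma measurable_chordLen {n : ℕ} {Ω : Set (EuclideanSpace ℝ (Fin n))} (hΩ : IsOpen Ω) :
    Measurable fun p : EuclideanSpace ℝ (Fin n) × EuclideanSpace ℝ (Fin n) =>
      chordLen Ω p.1 p.2 := by
  have : MeasurableSet {z : (EuclideanSpace ℝ (Fin n) × EuclideanSpace ℝ (Fin n)) × ℝ |
      z.1.1 + z.2 • z.1.2 ∈ Ω} := by
    apply IsOpen.measurableSet
    exact hΩ.preimage (f := fun z : (EuclideanSpace ℝ (Fin n) × EuclideanSpace ℝ (Fin n)) × ℝ =>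
      z.1.1 + z.2 • z.1.2) (by fun_prop)
  exact (measurable_measure_prodMk_left (ν := (volume : Measure ℝ)) this).ennreal_toReal

lemma measurable_rayLen {n : ℕ} {Ω : Set (EuclideanSpace ℝ (Fin n))} (hΩ : IsOpen Ω) :
    Measurable fun p : EuclideanSpace ℝ (Fin n) × EuclideanSpace ℝ (Fin n) =>
      rayLen Ω p.1 p.2 := by
  have : MeasurableSet {z : (EuclideanSpace ℝ (Fin n) × EuclideanSpace ℝ (Fin n)) × ℝ |
      0 < z.2 ∧ z.1.1 + z.2 • z.1.2 ∈ Ω} := by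
    apply IsOpen.measurableSet
    apply IsOpen.and
    · exact isOpen_lt continuous_const (by fun_prop)
    exact hΩ.preimage (f := fun z : (EuclideanSpace ℝ (Fin n) × EuclideanSpace ℝ (Fin n)) × ℝ =>
      z.1.1 + z.2 • z.1.2) (by fun_prop)
  exact (measurable_measure_prodMk_left (ν := (volume : Measure ℝ)) this).ennreal_toReal

lemma chordLen_shift {n : ℕ} (Ω : Set (EuclideanSpace ℝ (Fin n)))
    (x e : EuclideanSpace ℝ (Fin n)) (s : ℝ) : chordLen Ω (x + s • e) e = chordLen Ω x e := by
  unfold chordLen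
  congr 1
  rw [← measure_preimage_add volume s {t : ℝ | x + t • e ∈ Ω}]
  congr 1
  ext t
  simp [add_smul, add_assoc]

lemma chordLen_le {n : ℕ} {Ω : Set (EuclideanSpace ℝ (Fin n))} (hb : Bornology.IsBounded Ω)
    (x e : EuclideanSpace ℝ (Fin n)) (he : ‖e‖ = 1) : chordLen Ω x e ≤ Metric.diam Ω := by
  unfold chordLen Metric.diam
  apply ENNReal.toReal_mono hb.ediam_ne_top
  refine (Real.volume_le_diam _).trans ?_
  apply Metric.ediam_le
  intro t ht s hs
  have h := Metric.edist_le_ediam_of_mem ht hs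
  have : edist t s = edist (x + t • e) (x + s • e) := by
    rw [edist_dist, edist_dist, dist_add_left, dist_eq_norm, dist_eq_norm, ← sub_smul, norm_smul, he, mul_one]
  rw [this]
  exact Metric.edist_le_ediam_of_mem ht hs

lemma chord_Ioo {n : ℕ} {Ω : Set (EuclideanSpace ℝ (Fin n))} (hΩ : IsOpen Ω)
    (hb : Bornology.IsBounded Ω) (hc : Convex ℝ Ω)
    (x e : EuclideanSpace ℝ (Fin n)) (he : ‖e‖ = 1) (hne : {t : ℝ | x + t • e ∈ Ω}.Nonempty) :
    ∃ a b, a < b ∧ {t : ℝ | x + t • e ∈ Ω} = Ioo a b ∧ x + a • e ∈ frontier Ω ∧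
      x + b • e ∈ frontier Ω ∧ ∀ t ∈ Icc a b, x + t • e ∈ closure Ω := by
  set T := {t : ℝ | x + t • e ∈ Ω} with hT
  have hcont : Continuous fun t : ℝ => x + t • e := by fun_prop
  have hTo : IsOpen T := hΩ.preimage hcont
  have hTc : Convex ℝ T := by
    intro s hs t ht α β hα hβ hαβ
    have := hc hs ht hα hβ hαβ
    simp only [hT, mem_ofPred_eq]
    convert this using 1
    have hx : x = α • x + β • x := by rw [← add_smul, hαβ, one_smul]
    conv_lhs => rw [hx]
    simp only [smul_eq_mul, smul_add, add_smul, mul_smul]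
    abel
  have hTb : Bornology.IsBounded T := by
    obtain ⟨R, hR⟩ := hb.exists_norm_le
    refine isBounded_iff_forall_norm_le.2 ⟨R + ‖x‖, fun t ht => ?_⟩
    have h1 := hR _ ht
    have h2 : t • e = (x + t • e) - x := by abel
    have h3 : ‖t‖ = ‖t • e‖ := by rw [norm_smul, he, mul_one]
    rw [h3, h2]
    exact (norm_sub_le _ _).trans (by linarith)
  have hbelow := hTb.bddBelow
  have habove := hTb.bddAbove
  have hI : T = Ioo (sInf T) (sSup T) := by
    apply Subset.antisymm
    · have := interior_mono (subset_Icc_csInf_csSup hbelow habove)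
      rwa [hTo.interior_eq, interior_Icc] at this
    · exact IsConnected.Ioo_csInf_csSup_subset ⟨hne, hTc.isPreconnected⟩ hbelow habove
  set a := sInf T
  set b := sSup T
  have hab : a < b := by rw [hI] at hne; exact nonempty_Ioo.1 hne
  have hcl : ∀ t ∈ Icc a b, x + t • e ∈ closure Ω := by
    intro t ht
    rw [← closure_Ioo hab.ne, ← hI] at ht
    exact map_mem_closure (f := fun t : ℝ => x + t • e) hcont ht (fun s hs => hs)
  refine ⟨a, b, hab, hI, ?_, ?_, hcl⟩
  · rw [hΩ.frontier_eq]
    refine ⟨hcl a ⟨le_rfl, hab.le⟩, fun h => ?_⟩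
    have : a ∈ T := h
    rw [hI] at this
    exact lt_irrefl _ this.1
  · rw [hΩ.frontier_eq]
    refine ⟨hcl b ⟨hab.le, le_rfl⟩, fun h => ?_⟩
    have : b ∈ T := h
    rw [hI] at this
    exact lt_irrefl _ this.2

lemma chord_ray {n : ℕ} {Ω : Set (EuclideanSpace ℝ (Fin n))} (hΩ : IsOpen Ω)
    (hb : Bornology.IsBounded Ω) (hc : Convex ℝ Ω)
    (x e : EuclideanSpace ℝ (Fin n)) (he : ‖e‖ = 1) (hx : x ∈ Ω) :
    chordLen Ω x e = rayLen Ω x e + rayLen Ω x (-e) ∧ 0 < chordLen Ω x e ∧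
      ∀ t, 0 < t → t < rayLen Ω x e → x + t • e ∈ Ω := by
  have h0 : (0:ℝ) ∈ {t : ℝ | x + t • e ∈ Ω} := by simpa using hx
  obtain ⟨a, b, hab, hI, -⟩ := chord_Ioo hΩ hb hc x e he ⟨0, h0⟩
  have h0' := h0
  rw [hI] at h0'
  have hc : chordLen Ω x e = b - a := by
    rw [chordLen, hI, Real.volume_Ioo, ENNReal.toReal_ofReal (by linarith)]
  have hr : rayLen Ω x e = b := by
    have : {t : ℝ | 0 < t ∧ x + t • e ∈ Ω} = Ioo 0 b := by
      ext t
      have : x + t • e ∈ Ω ↔ t ∈ Ioo a b := by rw [← hI]; rfl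
      simp only [mem_ofPred_eq, this, mem_Ioo]
      exact ⟨fun h => ⟨h.1, h.2.2⟩, fun h => ⟨h.1, h0'.1.trans h.1, h.2⟩⟩
    rw [rayLen, this, Real.volume_Ioo, sub_zero, ENNReal.toReal_ofReal h0'.2.le]
  have hl : rayLen Ω x (-e) = -a := by
    have : {t : ℝ | 0 < t ∧ x + t • (-e) ∈ Ω} = Ioo 0 (-a) := by
      ext t
      have : x + t • (-e) ∈ Ω ↔ -t ∈ Ioo a b := by rw [← hI]; simp
      simp only [mem_ofPred_eq, this, mem_Ioo]
      exact ⟨fun h => ⟨h.1, by linarith [h.2.1]⟩, fun h => ⟨h.1, by linarith [h.2], by linarith [h.1, h0'.2]⟩⟩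
    rw [rayLen, this, Real.volume_Ioo, sub_zero, ENNReal.toReal_ofReal (by linarith [h0'.1])]
  refine ⟨by rw [hc, hr, hl]; ring, by rw [hc]; linarith, fun t ht htr => ?_⟩
  rw [hr] at htr
  have : t ∈ {t : ℝ | x + t • e ∈ Ω} := by rw [hI]; exact ⟨h0'.1.trans ht, htr⟩
  exact this

lemma weight_le {n : ℕ} (hn : 0 < n) {l L : ℝ} (hl : 0 < l) (hL : 0 < L) :
    (l ^ 2)⁻¹ * (1 + 2 / n - 2 / n * (L / l) ^ n) ≤ (L ^ 2)⁻¹ := by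
  have hn' : (0:ℝ) < n := by exact_mod_cast hn
  obtain ⟨u, hu⟩ : ∃ u, Real.exp u = L / l := ⟨_, Real.exp_log (by positivity)⟩
  have hLe : L = l * Real.exp u := by rw [hu]; field_simp
  have h1 := Real.add_one_le_exp (-2 * u)
  have h2 := Real.add_one_le_exp (n * u)
  have h3 : (L / l) ^ n = Real.exp (n * u) := by rw [← hu, Real.exp_nat_mul]
  have h4 : (L ^ 2)⁻¹ = (l ^ 2)⁻¹ * Real.exp (-2 * u) := by
    rw [hLe, mul_pow, mul_inv, ← Real.exp_nat_mul, ← Real.exp_neg]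
    norm_num
  rw [h3, h4]
  apply mul_le_mul_of_nonneg_left _ (by positivity)
  have h5 : 2 / (n:ℝ) * (n * u + 1) ≤ 2 / n * Real.exp (n * u) :=
    mul_le_mul_of_nonneg_left h2 (by positivity)
  have h6 : 2 / (n:ℝ) * (n * u + 1) = 2 * u + 2 / n := by field_simp
  linarith


lemma avg_chord {n : ℕ} (hn : 0 < n) {Ω : Set (EuclideanSpace ℝ (Fin n))} (hΩ : IsOpen Ω)
    (hb : Bornology.IsBounded Ω) (hc : Convex ℝ Ω)
    (x : EuclideanSpace ℝ (Fin n)) (hx : x ∈ Ω) :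
    ∫ e : Metric.sphere (0 : EuclideanSpace ℝ (Fin n)) 1, chordLen Ω x e ^ n
      ∂(volume : Measure (EuclideanSpace ℝ (Fin n))).toSphere ≤ n * 2 ^ n * (volume Ω).toReal := by
  set σ := (volume : Measure (EuclideanSpace ℝ (Fin n))).toSphere
  have hn' : (0:ℝ) < n := by exact_mod_cast hn
  have hne : ∀ e : Metric.sphere (0 : EuclideanSpace ℝ (Fin n)) 1,
    ‖(e : EuclideanSpace ℝ (Fin n))‖ = 1 := fun e => by simp
  have hmc : Measurable fun e : Metric.sphere (0 : EuclideanSpace ℝ (Fin n)) 1 => chordLen Ω x e :=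
    (measurable_chordLen hΩ).comp (f := fun e : Metric.sphere (0 : EuclideanSpace ℝ (Fin n)) 1 =>
      ((x, e) : EuclideanSpace ℝ (Fin n) × EuclideanSpace ℝ (Fin n))) (by fun_prop)
  have hmr : Measurable fun e : Metric.sphere (0 : EuclideanSpace ℝ (Fin n)) 1 => rayLen Ω x e :=
    (measurable_rayLen hΩ).comp (f := fun e : Metric.sphere (0 : EuclideanSpace ℝ (Fin n)) 1 =>
      ((x, e) : EuclideanSpace ℝ (Fin n) × EuclideanSpace ℝ (Fin n))) (by fun_prop)
  have hmr' : Measurable fun e : Metric.sphere (0 : EuclideanSpace ℝ (Fin n)) 1 => rayLen Ω x (-e) :=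
    (measurable_rayLen hΩ).comp (f := fun e : Metric.sphere (0 : EuclideanSpace ℝ (Fin n)) 1 =>
      ((x, -e) : EuclideanSpace ℝ (Fin n) × EuclideanSpace ℝ (Fin n))) (by fun_prop)
  have p1 : ∫⁻ e : Metric.sphere (0 : EuclideanSpace ℝ (Fin n)) 1,
      ENNReal.ofReal (rayLen Ω x e ^ n / n) ∂σ ≤ volume Ω := by
    have h := polar hn ((fun v => x + v) ⁻¹' Ω) (hΩ.measurableSet.preimage (by fun_prop))
      (fun e => rayLen Ω x e) (fun e => rayLen_nonneg _ _ _)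
      (fun e t ht h => (chord_ray hΩ hb hc x e (hne e) hx).2.2 t ht h)
    rwa [measure_preimage_add] at h
  have p2 : ∫⁻ e : Metric.sphere (0 : EuclideanSpace ℝ (Fin n)) 1,
      ENNReal.ofReal (rayLen Ω x (-e) ^ n / n) ∂σ ≤ volume Ω := by
    have h := polar hn ((fun v => x - v) ⁻¹' Ω) (hΩ.measurableSet.preimage (by fun_prop))
      (fun e => rayLen Ω x (-e)) (fun e => rayLen_nonneg _ _ _)
      (fun e t ht h => by
        have := (chord_ray hΩ hb hc x (-e) (by simp) hx).2.2 t ht h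
        simpa [sub_eq_add_neg] using this)
    rwa [(Measure.measurePreserving_sub_left volume x).measure_preimage hΩ.measurableSet.nullMeasurableSet] at h
  have pt : ∀ e : Metric.sphere (0 : EuclideanSpace ℝ (Fin n)) 1,
      ENNReal.ofReal (chordLen Ω x e ^ n) ≤ ENNReal.ofReal (n * 2 ^ (n - 1)) *
        (ENNReal.ofReal (rayLen Ω x e ^ n / n) + ENNReal.ofReal (rayLen Ω x (-e) ^ n / n)) := by
    intro e
    have r0 := rayLen_nonneg Ω x e
    have r1 := rayLen_nonneg Ω x (-e)
    rw [← ENNReal.ofReal_add (by positivity) (by positivity), ← ENNReal.ofReal_mul (by positivity)]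
    apply ENNReal.ofReal_le_ofReal
    rw [(chord_ray hΩ hb hc x e (hne e) hx).1]
    have hp := add_pow_le r0 r1 n
    have he : (n:ℝ) * 2 ^ (n - 1) * (rayLen Ω x e ^ n / n + rayLen Ω x (-e) ^ n / n)
      = 2 ^ (n - 1) * (rayLen Ω x e ^ n + rayLen Ω x (-e) ^ n) := by field_simp
    rw [he]
    exact hp
  have p3 : ∫⁻ e : Metric.sphere (0 : EuclideanSpace ℝ (Fin n)) 1,
      ENNReal.ofReal (chordLen Ω x e ^ n) ∂σ ≤ ENNReal.ofReal (n * 2 ^ (n - 1)) * (volume Ω + volume Ω) := by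
    have p12 := add_le_add p1 p2
    generalize hcc : ENNReal.ofReal (n * 2 ^ (n - 1)) = c
    grw [← p12]
    subst hcc
    rw [← lintegral_add_left (by fun_prop), ← lintegral_const_mul _ (by fun_prop)]
    apply lintegral_mono
    intro e
    exact pt e
  have hV : volume Ω ≠ ⊤ := hb.measure_lt_top.ne
  rw [integral_eq_lintegral_of_nonneg_ae (.of_forall fun e => pow_nonneg (chordLen_nonneg _ _ _) n)
    (hmc.pow_const n).aestronglyMeasurable]
  have p4 := ENNReal.toReal_mono
    (ENNReal.mul_ne_top ENNReal.ofReal_ne_top (ENNReal.add_ne_top.2 ⟨hV, hV⟩)) p3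
  have p5 : (ENNReal.ofReal (n * 2 ^ (n - 1)) * (volume Ω + volume Ω)).toReal
      = n * 2 ^ n * (volume Ω).toReal := by
    rw [ENNReal.toReal_mul, ENNReal.toReal_ofReal (by positivity), ENNReal.toReal_add hV hV]
    have : (2:ℝ) ^ n = 2 ^ (n - 1) * 2 := by rw [← pow_succ, Nat.sub_add_cancel hn]
    rw [this]; ring
  rw [p5] at p4
  exact p4

lemma line_le {n : ℕ} {Ω : Set (EuclideanSpace ℝ (Fin n))} (hΩ : IsOpen Ω)
    (hb : Bornology.IsBounded Ω) (hc : Convex ℝ Ω)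
    {φ : EuclideanSpace ℝ (Fin n) → ℝ}
    {D1 : EuclideanSpace ℝ (Fin n) → EuclideanSpace ℝ (Fin n) →L[ℝ] ℝ}
    {D2 : EuclideanSpace ℝ (Fin n) → EuclideanSpace ℝ (Fin n) →L[ℝ] EuclideanSpace ℝ (Fin n) →L[ℝ] ℝ}
    (c0 : ContinuousOn φ (closure Ω)) (c1 : ContinuousOn D1 (closure Ω))
    (c2 : ContinuousOn D2 (closure Ω))
    (d1 : ∀ x ∈ Ω, HasFDerivAt φ (D1 x) x) (d2 : ∀ x ∈ Ω, HasFDerivAt D1 (D2 x) x)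
    (hfr : ∀ x ∈ frontier Ω, φ x = 0)
    (x e : EuclideanSpace ℝ (Fin n)) (he : ‖e‖ = 1) (A : ℝ)
    (hA : 0 < chordLen Ω x e → A ≤ (Real.pi / chordLen Ω x e) ^ 2) :
    ∫ t : ℝ, Ω.indicator (fun y => φ y * D2 y e e + A * φ y ^ 2) (x + t • e) ≤ 0 := by
  have hind : (fun t : ℝ => Ω.indicator (fun y => φ y * D2 y e e + A * φ y ^ 2) (x + t • e))
      = {t : ℝ | x + t • e ∈ Ω}.indicator
        (fun t => φ (x + t • e) * D2 (x + t • e) e e + A * φ (x + t • e) ^ 2) := by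
    ext t
    simp only [indicator, mem_ofPred_eq]
  rw [hind]
  rcases Set.eq_empty_or_nonempty {t : ℝ | x + t • e ∈ Ω} with h0 | hne
  · rw [h0]; simp
  obtain ⟨a, b, hab, hI, ha, hb', hcl⟩ := chord_Ioo hΩ hb hc x e he hne
  have hlen : chordLen Ω x e = b - a := by
    rw [chordLen, hI, Real.volume_Ioo, ENNReal.toReal_ofReal (by linarith)]
  rw [hlen] at hA
  rw [hI, integral_indicator measurableSet_Ioo, ← integral_Ioc_eq_integral_Ioo,
    ← intervalIntegral.integral_of_le hab.le]
  have hline : ∀ t : ℝ, HasDerivAt (fun t : ℝ => x + t • e) e t := by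
    intro t
    have := ((hasDerivAt_id t).smul_const e).const_add x
    simpa using this
  have hin : ∀ t ∈ Ioo a b, x + t • e ∈ Ω := by
    intro t ht
    rw [← hI] at ht; exact ht
  have hlc : ContinuousOn (fun t : ℝ => x + t • e) (Icc a b) := by fun_prop
  have k0 := c0.comp hlc hcl
  have k1 := c1.comp hlc hcl
  have k2 := c2.comp hlc hcl
  exact oneD hab (f := fun t => φ (x + t • e)) (f' := fun t => D1 (x + t • e) e)
    (f'' := fun t => D2 (x + t • e) e e) k0 (k1.clm_apply continuousOn_const)
    ((k2.clm_apply continuousOn_const).clm_apply continuousOn_const)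
    (fun t ht => (d1 _ (hin t ht)).comp_hasDerivAt t (hline t))
    (fun t ht => by
      have h := (d2 _ (hin t ht)).comp_hasDerivAt t (hline t)
      have := h.clm_apply (hasDerivAt_const t e)
      simpa using this)
    (hfr _ ha) (hfr _ hb') A (hA (by linarith))



lemma measurable_ind {X : Type*} [TopologicalSpace X] [MeasurableSpace X] [BorelSpace X]
    {s : Set X} (hs : IsOpen s) {f : X → ℝ} (hf : ContinuousOn f s) : Measurable (s.indicator f) := by
  classical
  rw [← Set.piecewise_eq_indicator]
  exact hf.measurable_piecewise continuousOn_const hs.measurableSet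

set_option maxHeartbeats 2000000 in
lemma main_aux {n : ℕ} (hn : 0 < n) {Ω : Set (EuclideanSpace ℝ (Fin n))} (hΩ : IsOpen Ω)
    (hb : Bornology.IsBounded Ω) (hc : Convex ℝ Ω) (hne : Ω.Nonempty)
    {φ : EuclideanSpace ℝ (Fin n) → ℝ}
    {D1 : EuclideanSpace ℝ (Fin n) → EuclideanSpace ℝ (Fin n) →L[ℝ] ℝ}
    {D2 : EuclideanSpace ℝ (Fin n) → EuclideanSpace ℝ (Fin n) →L[ℝ] EuclideanSpace ℝ (Fin n) →L[ℝ] ℝ}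
    (c0 : ContinuousOn φ (closure Ω)) (c1 : ContinuousOn D1 (closure Ω))
    (c2 : ContinuousOn D2 (closure Ω))
    (d1 : ∀ x ∈ Ω, HasFDerivAt φ (D1 x) x) (d2 : ∀ x ∈ Ω, HasFDerivAt D1 (D2 x) x)
    (hfr : ∀ x ∈ frontier Ω, φ x = 0) (hpos : ∀ x ∈ Ω, 0 < φ x) (Λ : ℝ)
    (hlap : ∀ x ∈ Ω, -Λ * φ x ≤ ∑ i, D2 x (EuclideanSpace.single i 1) (EuclideanSpace.single i 1))
    (l : ℝ) (hl : 0 < l)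
    (hln : l ^ n * (volume (Metric.ball (0 : EuclideanSpace ℝ (Fin n)) 1)).toReal
      = 2 ^ n * (volume Ω).toReal) :
    n * (Real.pi ^ 2 * (l ^ 2)⁻¹) ≤ Λ := by
  have hn' : (0:ℝ) < n := by exact_mod_cast hn
  set σ := (volume : Measure (EuclideanSpace ℝ (Fin n))).toSphere with hσ
  have hσn : σ.real univ = n * (volume (Metric.ball (0 : EuclideanSpace ℝ (Fin n)) 1)).toReal := by
    rw [hσ, Measure.toSphere_real_apply_univ]
    simp [Measure.real]
  have hα : 0 < (volume (Metric.ball (0 : EuclideanSpace ℝ (Fin n)) 1)).toReal :=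
    ENNReal.toReal_pos (Metric.measure_ball_pos _ _ one_pos).ne' Metric.isBounded_ball.measure_lt_top.ne
  have hσpos : 0 < σ.real univ := by rw [hσn]; positivity
  have hcomp : IsCompact (closure Ω) := hb.isCompact_closure
  obtain ⟨M0, hM0⟩ := hcomp.exists_bound_of_continuousOn c0
  obtain ⟨M2, hM2⟩ := hcomp.exists_bound_of_continuousOn (f := D2) c2
  set W : ℝ → ℝ := fun L => (l ^ 2)⁻¹ * (1 + 2 / n - 2 / n * (L / l) ^ n) with hW
  have hWm : Measurable W := by fun_prop
  obtain ⟨MW, hMW⟩ := (isCompact_Icc (a := (0:ℝ)) (b := Metric.diam Ω)).exists_bound_of_continuousOn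
    (f := W) (by fun_prop)
  set J : EuclideanSpace ℝ (Fin n) → EuclideanSpace ℝ (Fin n) → ℝ := fun x e =>
    Ω.indicator (fun y => φ y * D2 y e e + (Real.pi ^ 2 * W (chordLen Ω y e)) * φ y ^ 2) x with hJ
  have hnorm : ∀ e : Metric.sphere (0 : EuclideanSpace ℝ (Fin n)) 1,
    ‖(e : EuclideanSpace ℝ (Fin n))‖ = 1 := fun e => by simp
  -- bound
  obtain ⟨M, hM⟩ : ∃ M : ℝ, ∀ x e, ‖e‖ = 1 → ‖J x e‖ ≤ Ω.indicator (fun _ => M) x := by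
    refine ⟨M0 * M2 + Real.pi ^ 2 * MW * M0 ^ 2, fun x e he => ?_⟩
    by_cases hx : x ∈ Ω
    · simp only [hJ, indicator_of_mem hx]
      have hx' := subset_closure hx
      have b0 := hM0 x hx'
      have b2 : ‖D2 x e e‖ ≤ M2 := by
        have h := (D2 x).le_opNorm₂ e e
        rw [he, mul_one, mul_one] at h
        exact h.trans (hM2 x hx')
      have bW := hMW (chordLen Ω x e) ⟨chordLen_nonneg _ _ _, chordLen_le hb x e he⟩
      have : 0 ≤ MW := (norm_nonneg _).trans bW
      refine (norm_add_le _ _).trans (add_le_add ?_ ?_)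
      · rw [norm_mul]
        exact mul_le_mul b0 b2 (norm_nonneg _) ((norm_nonneg _).trans b0)
      · rw [norm_mul, norm_mul, norm_pow, norm_pow, Real.norm_of_nonneg Real.pi_pos.le]
        gcongr
    · simp [hJ, hx]
  have hMi : Integrable (Ω.indicator (fun _ => M)) (volume : Measure (EuclideanSpace ℝ (Fin n))) := by
    rw [integrable_indicator_iff hΩ.measurableSet]
    exact integrableOn_const hb.measure_lt_top.ne
  -- measurability
  have hJm : Measurable fun p : EuclideanSpace ℝ (Fin n) × Metric.sphere (0 : EuclideanSpace ℝ (Fin n)) 1 =>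
      J p.1 p.2 := by
    have hop : IsOpen (Ω ×ˢ (univ : Set (Metric.sphere (0 : EuclideanSpace ℝ (Fin n)) 1))) :=
      hΩ.prod isOpen_univ
    have hfst : ContinuousOn (fun p : EuclideanSpace ℝ (Fin n) × Metric.sphere (0 : EuclideanSpace ℝ (Fin n)) 1 => p.1)
      (Ω ×ˢ univ) := by fun_prop
    have hsnd : ContinuousOn (fun p : EuclideanSpace ℝ (Fin n) × Metric.sphere (0 : EuclideanSpace ℝ (Fin n)) 1 =>
      (p.2 : EuclideanSpace ℝ (Fin n))) (Ω ×ˢ univ) := by fun_prop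
    have k0 : ContinuousOn (fun p : EuclideanSpace ℝ (Fin n) × Metric.sphere (0 : EuclideanSpace ℝ (Fin n)) 1 => φ p.1)
      (Ω ×ˢ univ) := c0.comp hfst (fun p hp => subset_closure hp.1)
    have k2 : ContinuousOn (fun p : EuclideanSpace ℝ (Fin n) × Metric.sphere (0 : EuclideanSpace ℝ (Fin n)) 1 => D2 p.1)
      (Ω ×ˢ univ) := c2.comp hfst (fun p hp => subset_closure hp.1)
    have m1 := measurable_ind hop (k0.mul ((k2.clm_apply hsnd).clm_apply hsnd))
    have m2 := measurable_ind hop (k0.pow 2)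
    have m3 : Measurable fun p : EuclideanSpace ℝ (Fin n) × Metric.sphere (0 : EuclideanSpace ℝ (Fin n)) 1 =>
        W (chordLen Ω p.1 p.2) := hWm.comp ((measurable_chordLen hΩ).comp
          (f := fun p : EuclideanSpace ℝ (Fin n) × Metric.sphere (0 : EuclideanSpace ℝ (Fin n)) 1 =>
          ((p.1, p.2) : EuclideanSpace ℝ (Fin n) × EuclideanSpace ℝ (Fin n))) (by fun_prop))
    convert m1.add ((m3.const_mul (Real.pi ^ 2)).mul m2) using 1
    ext p
    by_cases hp : p.1 ∈ Ω
    · have : p ∈ Ω ×ˢ (univ : Set (Metric.sphere (0 : EuclideanSpace ℝ (Fin n)) 1)) := ⟨hp, mem_univ _⟩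
      simp [hJ, hp]
    · have : p ∉ Ω ×ˢ (univ : Set (Metric.sphere (0 : EuclideanSpace ℝ (Fin n)) 1)) := fun h => hp h.1
      simp [hJ, hp]
  have hJe : ∀ e : Metric.sphere (0 : EuclideanSpace ℝ (Fin n)) 1, Measurable fun x => J x e := fun e =>
    hJm.comp (f := fun x => (x, e)) measurable_prodMk_right
  have hJi : ∀ e : Metric.sphere (0 : EuclideanSpace ℝ (Fin n)) 1, Integrable fun x => J x e := fun e =>
    hMi.mono' (hJe e).aestronglyMeasurable (.of_forall fun x => hM x e (hnorm e))
  have hJp : Integrable (fun p : EuclideanSpace ℝ (Fin n) × Metric.sphere (0 : EuclideanSpace ℝ (Fin n)) 1 =>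
      J p.1 p.2) (volume.prod σ) :=
    (hMi.comp_fst σ).mono' hJm.aestronglyMeasurable (.of_forall fun p => hM p.1 p.2 (hnorm p.2))
  -- step 1
  have step1 : ∀ e : Metric.sphere (0 : EuclideanSpace ℝ (Fin n)) 1, ∫ x, J x e ≤ 0 := by
    intro e
    refine slicing (e : EuclideanSpace ℝ (Fin n)) (hnorm e)
      (fun x => J x (e : EuclideanSpace ℝ (Fin n))) (hJi e) (hJe e) (fun x => ?_)
    have := line_le hΩ hb hc c0 c1 c2 d1 d2 hfr x e (hnorm e)
      (Real.pi ^ 2 * W (chordLen Ω x e)) (fun hp => by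
        rw [div_pow, div_eq_mul_inv]
        exact mul_le_mul_of_nonneg_left (weight_le hn hl hp) (by positivity))
    refine le_of_eq_of_le ?_ this
    congr 1
    ext t
    simp only [hJ, indicator]
    rw [chordLen_shift]
  -- step 3
  set κ : ℝ := Real.pi ^ 2 * (l ^ 2)⁻¹ - Λ / n with hκ
  have step3 : ∀ x, Ω.indicator (fun y => σ.real univ * κ * φ y ^ 2) x
      ≤ ∫ e : Metric.sphere (0 : EuclideanSpace ℝ (Fin n)) 1, J x e ∂σ := by
    intro x
    by_cases hx : x ∈ Ω
    swap
    · simp [hJ, hx]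
    simp only [hJ, indicator_of_mem hx]
    have hQ := sphere_quad (D2 x)
    have hQi : Integrable (fun e : Metric.sphere (0 : EuclideanSpace ℝ (Fin n)) 1 => D2 x e e) σ :=
      sphere_cont (by fun_prop)
    have hmc : Measurable fun e : Metric.sphere (0 : EuclideanSpace ℝ (Fin n)) 1 => chordLen Ω x e :=
      (measurable_chordLen hΩ).comp (f := fun e : Metric.sphere (0 : EuclideanSpace ℝ (Fin n)) 1 =>
        ((x, e) : EuclideanSpace ℝ (Fin n) × EuclideanSpace ℝ (Fin n))) (by fun_prop)
    have hLi : Integrable (fun e : Metric.sphere (0 : EuclideanSpace ℝ (Fin n)) 1 => chordLen Ω x e ^ n) σ := by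
      refine (integrable_const (Metric.diam Ω ^ n)).mono' (hmc.pow_const n).aestronglyMeasurable
        (.of_forall fun e => ?_)
      rw [Real.norm_of_nonneg (pow_nonneg (chordLen_nonneg _ _ _) _)]
      exact pow_le_pow_left₀ (chordLen_nonneg _ _ _) (chordLen_le hb x e (hnorm e)) n
    have hWe : ∀ e : Metric.sphere (0 : EuclideanSpace ℝ (Fin n)) 1, W (chordLen Ω x e)
        = (l ^ 2)⁻¹ * (1 + 2 / n) - (l ^ 2)⁻¹ * (2 / n) / l ^ n * chordLen Ω x e ^ n := by
      intro e
      simp only [hW, div_pow]; ring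
    have hWi : Integrable (fun e : Metric.sphere (0 : EuclideanSpace ℝ (Fin n)) 1 => W (chordLen Ω x e)) σ := by
      simp only [hWe]
      exact (integrable_const _).sub (hLi.const_mul _)
    have hWint : σ.real univ * (l ^ 2)⁻¹ ≤
        ∫ e : Metric.sphere (0 : EuclideanSpace ℝ (Fin n)) 1, W (chordLen Ω x e) ∂σ := by
      simp only [hWe]
      rw [integral_sub (integrable_const _) (hLi.const_mul _), integral_const, integral_const_mul,
        smul_eq_mul]
      have ha := avg_chord hn hΩ hb hc x hx
      have hln2 : (n:ℝ) * 2 ^ n * (volume Ω).toReal = σ.real univ * l ^ n := by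
        rw [hσn, mul_assoc, ← hln]; ring
      rw [hln2] at ha
      have h1 : (l ^ 2)⁻¹ * (2 / n) / l ^ n *
          ∫ e : Metric.sphere (0 : EuclideanSpace ℝ (Fin n)) 1, chordLen Ω x e ^ n ∂σ
          ≤ (l ^ 2)⁻¹ * (2 / n) / l ^ n * (σ.real univ * l ^ n) :=
        mul_le_mul_of_nonneg_left ha (by positivity)
      have h2 : (l ^ 2)⁻¹ * (2 / n) / l ^ n * (σ.real univ * l ^ n)
        = (l ^ 2)⁻¹ * (2 / n) * σ.real univ := by field_simp
      rw [h2] at h1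
      linarith
    rw [integral_add (hQi.const_mul _) ((hWi.const_mul _).mul_const _), integral_const_mul,
      integral_mul_const, integral_const_mul]
    have hQ2 : -(σ.real univ * Λ / n) * φ x ≤ ∫ e : Metric.sphere (0 : EuclideanSpace ℝ (Fin n)) 1, D2 x e e ∂σ := by
      have h1 := mul_le_mul_of_nonneg_left (hlap x hx) hσpos.le
      rw [← hQ] at h1
      have h2 : -(σ.real univ * Λ / n) * φ x = (σ.real univ * (-Λ * φ x)) / n := by ring
      rw [h2, div_le_iff₀ hn']
      linarith
    have g1 := mul_le_mul_of_nonneg_left hQ2 (hpos x hx).le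
    have g2 := mul_le_mul_of_nonneg_right (mul_le_mul_of_nonneg_left hWint (sq_nonneg Real.pi))
      (sq_nonneg (φ x))
    refine le_trans (le_of_eq ?_) (add_le_add g1 g2)
    rw [hκ]; ring
  by_contra hcon
  push Not at hcon
  have hκpos : 0 < κ := by
    rw [hκ, sub_pos, div_lt_iff₀ hn']; linarith
  have hcφ : ContinuousOn (fun y => σ.real univ * κ * φ y ^ 2) (closure Ω) :=
    continuousOn_const.mul (c0.pow 2)
  have hIntr : IntegrableOn (fun y => σ.real univ * κ * φ y ^ 2) Ω :=
    (hcφ.integrableOn_compact hcomp).mono_set subset_closure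
  have h1 : ∫ x, Ω.indicator (fun y => σ.real univ * κ * φ y ^ 2) x
      ≤ ∫ x, ∫ e : Metric.sphere (0 : EuclideanSpace ℝ (Fin n)) 1, J x e ∂σ :=
    integral_mono (hIntr.integrable_indicator hΩ.measurableSet) hJp.integral_prod_left step3
  rw [integral_integral_swap (f := fun x (e : Metric.sphere (0 : EuclideanSpace ℝ (Fin n)) 1) => J x e) hJp] at h1
  have h2 : ∫ e : Metric.sphere (0 : EuclideanSpace ℝ (Fin n)) 1, (∫ x, J x e) ∂σ ≤ 0 :=
    integral_nonpos step1
  have h3 : 0 < ∫ x, Ω.indicator (fun y => σ.real univ * κ * φ y ^ 2) x := by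
    rw [integral_pos_iff_support_of_nonneg _ (hIntr.integrable_indicator hΩ.measurableSet)]
    · have : Ω ⊆ Function.support (Ω.indicator (fun y => σ.real univ * κ * φ y ^ 2)) := by
        intro x hx
        rw [Function.mem_support, indicator_of_mem hx]
        have := hpos x hx
        positivity
      exact (hΩ.measure_pos volume hne).trans_le (measure_mono this)
    · intro x
      exact indicator_nonneg (fun y _ => by positivity) x
  linarith


theorem stmt_12 {n : ℕ}
    (Ω : Set (EuclideanSpace ℝ (Fin n))) (ρ : EuclideanSpace ℝ (Fin n) → ℝ)
    (hΩ : IsOpen Ω) (hbd : Bornology.IsBounded Ω)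
    (hρ : ContDiff ℝ 2 ρ)
    (hΩρ : Ω = {x | ρ x < 0})
    (hfr : frontier Ω = {x | ρ x = 0})
    (hν : ∀ x ∈ frontier Ω, gradient ρ x ≠ 0)
    (hsc : ∀ x ∈ frontier Ω, ∀ v : EuclideanSpace ℝ (Fin n), v ≠ 0 → ⟪gradient ρ x, v⟫ = 0 →
      0 < fderiv ℝ (fun y => fderiv ℝ ρ y v) x v)
    (hne : Ω.Nonempty)
    (q : EuclideanSpace ℝ (Fin n) → ℝ)
    (hq : ConvexOn ℝ (closure Ω) q) (hqC : ContDiffOn ℝ 1 q (closure Ω))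
    (φ₀ : EuclideanSpace ℝ (Fin n) → ℝ) (lam0 : ℝ)
    (hφC : ContDiffOn ℝ 2 φ₀ (closure Ω))
    (hφpos : ∀ x ∈ Ω, 0 < φ₀ x)
    (hφbd : ∀ x ∈ frontier Ω, φ₀ x = 0)
    (hφν : ∀ x ∈ frontier Ω, fderivWithin ℝ φ₀ (closure Ω) x (gradient ρ x) < 0)
    (heig : ∀ x ∈ Ω, lap φ₀ x - q x * φ₀ x = -lam0 * φ₀ x)
 :
    (n : ℝ) * (Real.pi ^ 2 / 4) *
        ((volume (Metric.ball (0 : EuclideanSpace ℝ (Fin n)) 1)).toReal / (volume Ω).toReal) ^ ((2 : ℝ) / (n : ℝ))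
      + sInf (q '' Ω) ≤ lam0 := by
  have hcl : closure Ω = {x | ρ x ≤ 0} := by
    rw [closure_eq_self_union_frontier, hfr]
    ext x
    rw [hΩρ]
    simp only [mem_union, mem_ofPred_eq]
    exact le_iff_lt_or_eq.symm
  have hIntr : interior (closure Ω) = Ω := by
    apply Subset.antisymm _ (interior_maximal subset_closure hΩ)
    intro x hx
    by_contra hxΩ
    have hxf : x ∈ frontier Ω := by
      rw [hΩ.frontier_eq]; exact ⟨interior_subset hx, hxΩ⟩
    have hx0 : ρ x = 0 := by rw [hfr] at hxf; exact hxf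
    have hmax : IsLocalMax ρ x := by
      filter_upwards [isOpen_interior.mem_nhds hx] with y hy
      have := interior_subset hy
      rw [hcl] at this
      rw [hx0]; exact this
    apply hν x hxf
    simp [gradient, hmax.fderiv_eq_zero]
  have hconv : Convex ℝ Ω := by rw [← hIntr]; exact hq.1.interior
  have hcomp : IsCompact (closure Ω) := hbd.isCompact_closure
  have hbelow : BddBelow (q '' Ω) :=
    (hcomp.image_of_continuousOn hqC.continuousOn).bddBelow.mono (image_mono subset_closure)
  have hinf : ∀ x ∈ Ω, sInf (q '' Ω) ≤ q x := fun x hx => csInf_le hbelow (mem_image_of_mem q hx)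
  rcases Nat.eq_zero_or_pos n with h0 | hn
  · subst h0
    obtain ⟨x, hx⟩ := hne
    have h1 := heig x hx
    have h2 := hφpos x hx
    have h3 := hinf x hx
    have h4 : lap φ₀ x = 0 := by simp [lap]
    rw [h4] at h1
    have h5 : q x = lam0 := mul_right_cancel₀ h2.ne' (by linarith)
    simp only [Nat.cast_zero, zero_mul, zero_add]
    linarith
  have hn' : (0:ℝ) < n := by exact_mod_cast hn
  have hud : UniqueDiffOn ℝ (closure Ω) := uniqueDiffOn_convex hq.1 (by rw [hIntr]; exact hne)
  set D1 := fderivWithin ℝ φ₀ (closure Ω) with hD1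
  set D2 := fderivWithin ℝ D1 (closure Ω) with hD2
  have s1 : ContDiffOn ℝ 1 D1 (closure Ω) := hφC.fderivWithin hud (by norm_num)
  have c2 : ContinuousOn D2 (closure Ω) := s1.continuousOn_fderivWithin hud (by norm_num)
  have hnhds : ∀ x ∈ Ω, closure Ω ∈ nhds x := fun x hx =>
    Filter.mem_of_superset (hΩ.mem_nhds hx) subset_closure
  have d1 : ∀ x ∈ Ω, HasFDerivAt φ₀ (D1 x) x := fun x hx =>
    ((hφC.differentiableOn (by norm_num)) x (subset_closure hx)).hasFDerivWithinAt.hasFDerivAt (hnhds x hx)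
  have d2 : ∀ x ∈ Ω, HasFDerivAt D1 (D2 x) x := fun x hx =>
    ((s1.differentiableOn (by norm_num)) x (subset_closure hx)).hasFDerivWithinAt.hasFDerivAt (hnhds x hx)
  have hlapeq : ∀ x ∈ Ω, lap φ₀ x
      = ∑ i, D2 x (EuclideanSpace.single i 1) (EuclideanSpace.single i 1) := by
    intro x hx
    unfold lap
    refine Finset.sum_congr rfl fun i _ => ?_
    have hev : (fun y => fderiv ℝ φ₀ y (EuclideanSpace.single i 1))
        =ᶠ[nhds x] fun y => D1 y (EuclideanSpace.single i 1) := by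
      filter_upwards [hΩ.mem_nhds hx] with y hy
      rw [(d1 y hy).fderiv]
    rw [hev.fderiv_eq]
    have := (d2 x hx).clm_apply (hasFDerivAt_const (EuclideanSpace.single i (1:ℝ)) x)
    rw [this.fderiv]
    simp
  set α := (volume (Metric.ball (0 : EuclideanSpace ℝ (Fin n)) 1)).toReal with hαdef
  have hα : 0 < α :=
    ENNReal.toReal_pos (Metric.measure_ball_pos _ _ one_pos).ne' Metric.isBounded_ball.measure_lt_top.ne
  set V := (volume Ω).toReal with hVdef
  have hV : 0 < V := ENNReal.toReal_pos (hΩ.measure_pos volume hne).ne' hbd.measure_lt_top.ne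
  have key := main_aux hn hΩ hbd hconv hne hφC.continuousOn s1.continuousOn c2 d1 d2 hφbd hφpos
    (lam0 - sInf (q '' Ω)) (fun x hx => by
      rw [← hlapeq x hx]
      have h1 := heig x hx
      have h2 := mul_le_mul_of_nonneg_right (hinf x hx) (hφpos x hx).le
      linarith)
    (2 * (V / α) ^ ((1:ℝ) / n)) (by positivity) (by
      rw [mul_pow, ← Real.rpow_natCast ((V / α) ^ ((1:ℝ) / n)), ← Real.rpow_mul (by positivity),
        one_div_mul_cancel hn'.ne', Real.rpow_one, mul_assoc, ← hαdef, div_mul_cancel₀ _ hα.ne'])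
  have e1 : ((2 * (V / α) ^ ((1:ℝ) / n)) ^ 2)⁻¹ = 1 / 4 * (α / V) ^ ((2:ℝ) / n) := by
    rw [mul_pow, ← Real.rpow_natCast ((V / α) ^ ((1:ℝ) / n)), ← Real.rpow_mul (by positivity),
      mul_inv, ← Real.inv_rpow (by positivity), inv_div]
    norm_num
    congr 1
    ring
  rw [e1] at key
  linarith
end
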